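/- Let p < q be odd primes with q ≤ 2p + 1 and let H be a non-semisimple Hopf algebra over ℂ of dimension p·q with antipode S. Then every finite-dimensional simple H-module V is isomorphic to its fourth dual V****; concretely, there exists a ℂ-linear automorphism a of V such that a(x • v) = S⁴(x) • a(v) for all x ∈ H and v ∈ V, i.e., V is isomorphic to its twist along the algebra automorphism S⁴ of H. -/

import Mathlib

section
open TensorProduct Coalgebra HopfAlgebra WithConv

section Hits
variable {k C : Type*} [Field k] [AddCommGroup C] [Module k C] [Coalgebra k C]

/-- The operator `x ↦ f(x₁) x₂`. -/
noncomputable def leftHit (f : C →ₗ[k] k) : C →ₗ[k] C :=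
  (TensorProduct.lid k C).toLinearMap ∘ₗ f.rTensor C ∘ₗ comul

/-- The operator `x ↦ x₁ f(x₂)`. -/
noncomputable def rightHit (f : C →ₗ[k] k) : C →ₗ[k] C :=
  (TensorProduct.rid k C).toLinearMap ∘ₗ f.lTensor C ∘ₗ comul

theorem leftHit_apply (f : C →ₗ[k] k) (x : C) :
    leftHit f x = TensorProduct.lid k C (f.rTensor C (comul x)) := rfl

theorem rightHit_apply (f : C →ₗ[k] k) (x : C) :
    rightHit f x = TensorProduct.rid k C (f.lTensor C (comul x)) := rfl

theorem leftHit_repr (f : C →ₗ[k] k) {x : C} {ι : Type*} (r : Coalgebra.Repr k x ι) :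
    leftHit f x = ∑ i ∈ r.index, f (r.left i) • r.right i := by
  simp [leftHit, ← r.eq]

theorem rightHit_repr (f : C →ₗ[k] k) {x : C} {ι : Type*} (r : Coalgebra.Repr k x ι) :
    rightHit f x = ∑ i ∈ r.index, f (r.right i) • r.left i := by
  simp [rightHit, ← r.eq]

theorem comul_leftHit (f : C →ₗ[k] k) (x : C) :
    comul (R := k) (leftHit f x) = (leftHit f).rTensor C (comul x) := by
  have h := congrArg (fun v => (TensorProduct.lid k (C ⊗[k] C)) ((f.rTensor (C ⊗[k] C))
    v)) (Coalgebra.coassoc_apply (R := k) x)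
  rw [leftHit]
  have e1 : (TensorProduct.lid k (C ⊗[k] C)).toLinearMap ∘ₗ (f.rTensor (C ⊗[k] C)) ∘ₗ
      (comul (R := k) (A := C)).lTensor C
      = comul (R := k) (A := C) ∘ₗ (TensorProduct.lid k C).toLinearMap ∘ₗ f.rTensor C := by
    ext a b; simp
  have e2 : (TensorProduct.lid k (C ⊗[k] C)).toLinearMap ∘ₗ (f.rTensor (C ⊗[k] C)) ∘ₗ
      (TensorProduct.assoc k C C C).toLinearMap =
      ((TensorProduct.lid k C).toLinearMap ∘ₗ f.rTensor C).rTensor C := by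
    ext a b c; simp [TensorProduct.smul_tmul']
  have e1 := congrArg (fun F => F (comul x)) e1
  have e2 := congrArg (fun F => F ((comul (R := k) (A := C)).rTensor C (comul x))) e2
  simp only [LinearMap.comp_apply, LinearEquiv.coe_coe] at e1 e2 h ⊢
  rw [← e1, ← h, e2, ← LinearMap.comp_apply, ← LinearMap.rTensor_comp]
  rfl

theorem comul_rightHit (f : C →ₗ[k] k) (x : C) :
    comul (R := k) (rightHit f x) = (rightHit f).lTensor C (comul x) := by
  have h := congrArg (fun v => (TensorProduct.rid k (C ⊗[k] C)) ((f.lTensor (C ⊗[k] C))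
    ((TensorProduct.assoc k C C C).symm v))) (Coalgebra.coassoc_apply (R := k) x)
  rw [rightHit]
  have e1 : (TensorProduct.rid k (C ⊗[k] C)).toLinearMap ∘ₗ (f.lTensor (C ⊗[k] C)) ∘ₗ
      (comul (R := k) (A := C)).rTensor C
      = comul (R := k) (A := C) ∘ₗ (TensorProduct.rid k C).toLinearMap ∘ₗ f.lTensor C := by
    ext a b; simp
  have e2 : (TensorProduct.rid k (C ⊗[k] C)).toLinearMap ∘ₗ (f.lTensor (C ⊗[k] C)) ∘ₗ
      (TensorProduct.assoc k C C C).symm.toLinearMap =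
      ((TensorProduct.rid k C).toLinearMap ∘ₗ f.lTensor C).lTensor C := by
    ext a b c; simp
  have e1 := congrArg (fun F => F (comul x)) e1
  have e2 := congrArg (fun F => F ((comul (R := k) (A := C)).lTensor C (comul x))) e2
  simp only [LinearMap.comp_apply, LinearEquiv.coe_coe, LinearEquiv.symm_apply_apply] at e1 e2 h ⊢
  rw [← e1, h, e2, ← LinearMap.comp_apply, ← LinearMap.lTensor_comp]
  rfl

theorem apply_leftHit (f g : C →ₗ[k] k) (x : C) : f (leftHit g x) = g (rightHit f x) := by
  rw [leftHit_repr g (ℛ k x), rightHit_repr f (ℛ k x)]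
  simp [mul_comm]

theorem leftHit_counit (x : C) : leftHit (counit (R := k)) x = x := by
  rw [leftHit_repr _ (ℛ k x)]
  exact Coalgebra.sum_counit_smul (R := k) (ℛ k x)

theorem rightHit_counit (x : C) : rightHit (counit (R := k)) x = x := by
  simp [rightHit, Coalgebra.lTensor_counit_comul]

theorem counit_leftHit (f : C →ₗ[k] k) (x : C) : counit (R := k) (leftHit f x) = f x := by
  rw [apply_leftHit, rightHit_counit]

theorem counit_rightHit (f : C →ₗ[k] k) (x : C) : counit (R := k) (rightHit f x) = f x := by
  rw [← apply_leftHit, leftHit_counit]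

theorem rightHit_repr_comul (f : C →ₗ[k] k) {x : C} {ι : Type*} (r : Coalgebra.Repr k x ι) :
    comul (R := k) (rightHit f x) = ∑ i ∈ r.index, r.left i ⊗ₜ rightHit f (r.right i) := by
  rw [comul_rightHit, ← r.eq]; simp

theorem rightHit_rightHit (f g : C →ₗ[k] k) (x : C) :
    rightHit f (rightHit g x) = rightHit (f ∘ₗ rightHit g) x := by
  rw [rightHit_apply, comul_rightHit, rightHit_apply (f ∘ₗ _), LinearMap.lTensor_comp,
    LinearMap.comp_apply]

theorem leftHit_leftHit (f g : C →ₗ[k] k) (x : C) :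
    leftHit f (leftHit g x) = leftHit (f ∘ₗ leftHit g) x := by
  rw [leftHit_apply, comul_leftHit, leftHit_apply (f ∘ₗ _), LinearMap.rTensor_comp,
    LinearMap.comp_apply]

theorem leftHit_rightHit (f g : C →ₗ[k] k) (x : C) :
    leftHit f (rightHit g x) = rightHit g (leftHit f x) := by
  rw [leftHit_apply, rightHit_repr_comul g (ℛ k x), leftHit_repr f (ℛ k x)]
  simp

/-- Coordinates of a coproduct with respect to a basis in the second factor. -/
theorem comul_eq_sum_rightHit {ι : Type*} [Fintype ι] (b : Module.Basis ι k C) (x : C) :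
    comul (R := k) x = ∑ j, rightHit (b.coord j) x ⊗ₜ b j := by
  have h : ∀ t : C ⊗[k] C, t = ∑ j, TensorProduct.rid k C ((b.coord j).lTensor C t) ⊗ₜ b j := by
    intro t
    induction t with
    | zero => simp
    | tmul y z =>
      conv_lhs => rw [← b.sum_repr z, TensorProduct.tmul_sum]
      simp [TensorProduct.smul_tmul]
    | add y z hy hz =>
      conv_lhs => rw [hy, hz]
      simp [TensorProduct.add_tmul, Finset.sum_add_distrib]
  exact h (comul x)

end Hits

section Antipode
variable {k H : Type*} [Field k] [Ring H] [HopfAlgebra k H]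

local notation "S" => HopfAlgebra.antipode k (A := H)
local notation "i₁" => (Algebra.TensorProduct.includeLeft : H →ₐ[k] H ⊗[k] H)
local notation "i₂" => (Algebra.TensorProduct.includeRight : H →ₐ[k] H ⊗[k] H)

theorem conv_antipode_left {A : Type*} [Ring A] [Algebra k A] (f : H →ₐ[k] A) :
    toConv (f.toLinearMap ∘ₗ S) * toConv f.toLinearMap = 1 := by
  have h := LinearMap.algHom_comp_convMul_distrib f (toConv S)
    (toConv (LinearMap.id (R := k) (M := H)))
  rw [LinearMap.antipode_mul_id] at h
  exact WithConv.ofConv_injective (h.symm.trans (by ext a; simp))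

theorem conv_includeLeft_includeRight :
    (toConv (AlgHom.toLinearMap i₁) * toConv (AlgHom.toLinearMap i₂) :
      WithConv (H →ₗ[k] H ⊗[k] H)) = toConv comul := by
  ext x
  rw [(ℛ k x).convMul_apply]
  simp [(ℛ k x).eq]

theorem comul_antipode (x : H) : comul (R := k) (S x) =
    TensorProduct.map S S (TensorProduct.comm k H H (comul x)) := by
  have h1 : toConv (TensorProduct.map S S ∘ₗ (TensorProduct.comm k H H).toLinearMap ∘ₗ comul) =
     toConv ((AlgHom.toLinearMap i₂) ∘ₗ S) * toConv ((AlgHom.toLinearMap i₁) ∘ₗ S) := by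
    ext x
    rw [(ℛ k x).convMul_apply]
    simp only [LinearMap.comp_apply]
    conv_lhs => rw [← (ℛ k x).eq]
    simp
  have h2 : (toConv ((AlgHom.toLinearMap i₂) ∘ₗ S) * toConv ((AlgHom.toLinearMap i₁) ∘ₗ S)) *
      (toConv (AlgHom.toLinearMap i₁) * toConv (AlgHom.toLinearMap i₂)) =
      (1 : WithConv (H →ₗ[k] H ⊗[k] H)) := by
    rw [mul_assoc, ← mul_assoc (toConv (AlgHom.toLinearMap i₁ ∘ₗ S)), conv_antipode_left i₁,
      one_mul, conv_antipode_left i₂]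
  have h3 : (toConv (AlgHom.toLinearMap i₁) * toConv (AlgHom.toLinearMap i₂)) *
      toConv (comul ∘ₗ S) = (1 : WithConv (H →ₗ[k] H ⊗[k] H)) := by
    rw [conv_includeLeft_includeRight]
    exact LinearMap.comul_right_inv
  exact (LinearMap.congr_fun (congrArg ofConv (h1.trans (left_inv_eq_right_inv h2 h3))) x).symm

theorem comul_antipode_repr {x : H} {ι : Type*} (r : Coalgebra.Repr k x ι) :
    comul (R := k) (S x) = ∑ i ∈ r.index, S (r.right i) ⊗ₜ S (r.left i) := by
  rw [comul_antipode, ← r.eq]; simp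

theorem rightHit_antipode (f : H →ₗ[k] k) (x : H) :
    rightHit f (S x) = S (leftHit (f ∘ₗ S) x) := by
  rw [rightHit_apply, comul_antipode_repr (ℛ k x), leftHit_repr _ (ℛ k x)]
  simp

theorem leftHit_antipode (f : H →ₗ[k] k) (x : H) :
    leftHit f (S x) = S (rightHit (f ∘ₗ S) x) := by
  rw [leftHit_apply, comul_antipode_repr (ℛ k x), rightHit_repr _ (ℛ k x)]
  simp

theorem sum_rightHit_mul_antipode {ι : Type*} [Fintype ι] (b : Module.Basis ι k H) (x : H) :
    ∑ j, rightHit (b.coord j) x * S (b j) = algebraMap k H (counit x) := by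
  have := HopfAlgebra.mul_antipode_lTensor_comul_apply (R := k) x
  rw [comul_eq_sum_rightHit b] at this
  simpa using this

end Antipode

section Integrals
variable {k H : Type*} [Field k] [Ring H] [HopfAlgebra k H]

local notation "S" => HopfAlgebra.antipode k (A := H)

/-- A left integral in the dual: a functional `l` with `x₁ l(x₂) = l(x) 1`. -/
def IsDualIntegral (l : H →ₗ[k] k) : Prop := ∀ x, rightHit l x = l x • (1 : H)

theorem rightHit_mul_repr (f : H →ₗ[k] k) {x y : H} {ι κ : Type*} (r : Coalgebra.Repr k x ι)
    (s : Coalgebra.Repr k y κ) : rightHit f (x * y) =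
      ∑ i ∈ r.index, ∑ j ∈ s.index, f (r.right i * s.right j) • (r.left i * s.left j) := by
  rw [rightHit_apply, Bialgebra.comul_mul, ← r.eq, ← s.eq, Finset.sum_mul_sum]
  simp

theorem leftHit_mul_repr (f : H →ₗ[k] k) {x y : H} {ι κ : Type*} (r : Coalgebra.Repr k x ι)
    (s : Coalgebra.Repr k y κ) : leftHit f (x * y) =
      ∑ i ∈ r.index, ∑ j ∈ s.index, f (r.left i * s.left j) • (r.right i * s.right j) := by
  rw [leftHit_apply, Bialgebra.comul_mul, ← r.eq, ← s.eq, Finset.sum_mul_sum]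
  simp

/-- `y₁ l(y₂ S(x)) = l(y S(x₁)) x₂`. -/
theorem IsDualIntegral.rightHit_mul_antipode {l : H →ₗ[k] k} (hl : IsDualIntegral l) (x y : H) :
    rightHit (l ∘ₗ LinearMap.mulRight k (S x)) y = leftHit (l ∘ₗ LinearMap.mulLeft k y ∘ₗ S) x := by
  let A : H →ₗ[k] H := ∑ i ∈ (ℛ k y).index,
    (l ∘ₗ LinearMap.mulLeft k ((ℛ k y).right i) ∘ₗ S).smulRight ((ℛ k y).left i)
  have hA : ∀ z, A z = rightHit (l ∘ₗ LinearMap.mulRight k (S z)) y := by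
    intro z
    rw [rightHit_repr _ (ℛ k y)]
    simp [A, LinearMap.sum_apply]
  have h1 : toConv A * toConv S = toConv ((l ∘ₗ LinearMap.mulLeft k y ∘ₗ S).smulRight (1 : H)) := by
    ext z
    rw [(ℛ k z).convMul_apply]
    have hz := hl (y * S z)
    rw [rightHit_apply, Bialgebra.comul_mul, comul_antipode_repr (ℛ k z), ← (ℛ k y).eq,
      Finset.sum_mul_sum, Finset.sum_comm] at hz
    simp [A, LinearMap.sum_apply, Finset.sum_mul] at hz ⊢
    exact hz
  have h2 : toConv A = toConv ((l ∘ₗ LinearMap.mulLeft k y ∘ₗ S).smulRight (1 : H)) *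
      toConv LinearMap.id := by
    rw [← h1, mul_assoc, LinearMap.antipode_mul_id, mul_one]
  rw [← hA, leftHit_repr _ (ℛ k x)]
  have h3 := LinearMap.congr_fun (congrArg ofConv h2) x
  rw [(ℛ k x).convMul_apply] at h3
  simpa using h3

/-- `y₁ l(x y₂) = S(x₁) l(x₂ y)`. -/
theorem IsDualIntegral.rightHit_mulLeft {l : H →ₗ[k] k} (hl : IsDualIntegral l) (x y : H) :
    rightHit (l ∘ₗ LinearMap.mulLeft k x) y = S (rightHit (l ∘ₗ LinearMap.mulRight k y) x) := by
  let B : H →ₗ[k] H := ∑ i ∈ (ℛ k y).index,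
    (l ∘ₗ LinearMap.mulRight k ((ℛ k y).right i)).smulRight ((ℛ k y).left i)
  have hB : ∀ z, B z = rightHit (l ∘ₗ LinearMap.mulLeft k z) y := by
    intro z
    rw [rightHit_repr _ (ℛ k y)]
    simp [B, LinearMap.sum_apply]
  have h1 : toConv LinearMap.id * toConv B =
      toConv ((l ∘ₗ LinearMap.mulRight k y).smulRight (1 : H)) := by
    ext z
    rw [(ℛ k z).convMul_apply]
    have hz := hl (z * y)
    rw [rightHit_mul_repr _ (ℛ k z) (ℛ k y)] at hz
    simp [B, LinearMap.sum_apply, Finset.mul_sum] at hz ⊢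
    exact hz
  have h2 : toConv B = toConv S * toConv ((l ∘ₗ LinearMap.mulRight k y).smulRight (1 : H)) := by
    rw [← h1, ← mul_assoc, LinearMap.antipode_mul_id, one_mul]
  rw [← hB, rightHit_repr _ (ℛ k x)]
  have h3 := LinearMap.congr_fun (congrArg ofConv h2) x
  rw [(ℛ k x).convMul_apply] at h3
  simpa using h3

section Nondegenerate
variable [FiniteDimensional k H]

theorem eq_zero_of_forall_dual {V : Type*} [AddCommGroup V] [Module k V] {v : V}
    (h : ∀ g : V →ₗ[k] k, g v = 0) : v = 0 :=
  (Module.forall_dual_apply_eq_zero_iff k v).1 h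

theorem IsDualIntegral.eq_zero_of_mul_antipode {l : H →ₗ[k] k} (hl : IsDualIntegral l)
    (h0 : l ≠ 0) {x : H} (hx : ∀ y, l (y * S x) = 0) : x = 0 := by
  have key : ∀ z : H, (∀ y, l (y * S z) = 0) → counit (R := k) z = 0 := by
    intro z hz
    have hR : ∀ (g : H →ₗ[k] k) y, l (y * S (rightHit g z)) = 0 := by
      intro g y
      have h := congrArg g (hl.rightHit_mul_antipode z y)
      rw [apply_leftHit] at h
      have e : (l ∘ₗ LinearMap.mulRight k (S z)) = 0 := by ext w; simpa using hz w
      rw [e] at h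
      simpa [rightHit_apply] using h.symm
    obtain ⟨y, hy⟩ : ∃ y, l y ≠ 0 := by
      by_contra! hcon
      exact h0 (LinearMap.ext hcon)
    have h2 : S (algebraMap k H (counit z)) = algebraMap k H (counit z) := by
      rw [Algebra.algebraMap_eq_smul_one, map_smul, HopfAlgebra.antipode_one]
    have h1 : l (y * S (algebraMap k H (counit z))) = 0 := by
      rw [← sum_rightHit_mul_antipode (Module.finBasis k H) z, map_sum, Finset.mul_sum, map_sum]
      refine Finset.sum_eq_zero fun j _ => ?_
      rw [HopfAlgebra.antipode_mul_antidistrib, ← mul_assoc]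
      exact hR _ _
    rw [h2, Algebra.algebraMap_eq_smul_one, mul_smul_comm, mul_one, map_smul, smul_eq_mul] at h1
    exact (mul_eq_zero.1 h1).resolve_right hy
  have hR : ∀ (g : H →ₗ[k] k) y, l (y * S (rightHit g x)) = 0 := by
    intro g y
    have h := congrArg g (hl.rightHit_mul_antipode x y)
    rw [apply_leftHit] at h
    have e : (l ∘ₗ LinearMap.mulRight k (S x)) = 0 := by ext w; simpa using hx w
    rw [e] at h
    simpa [rightHit_apply] using h.symm
  refine eq_zero_of_forall_dual (k := k) fun g => ?_
  rw [← counit_rightHit]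
  exact key _ (hR g)

end Nondegenerate
end Integrals

section IntegralExistence
variable {k H : Type*} [Field k] [Ring H] [HopfAlgebra k H]

local notation "S" => HopfAlgebra.antipode k (A := H)
local notation "i₁" => (Algebra.TensorProduct.includeLeft : H →ₐ[k] H ⊗[k] H)
local notation "i₂" => (Algebra.TensorProduct.includeRight : H →ₐ[k] H ⊗[k] H)

theorem sum_coord_smul_apply {ι M N : Type*} [Fintype ι] [AddCommGroup M] [Module k M]
    [AddCommGroup N] [Module k N] (b : Module.Basis ι k M) (T : M →ₗ[k] N) (w : M) :
    ∑ i, b.coord i w • T (b i) = T w := by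
  rw [← (congrArg T (b.sum_repr w)), map_sum]
  simp

theorem sum_comul_antipode_mul {z : H} {ι : Type*} (r : Coalgebra.Repr k z ι) :
    ∑ i ∈ r.index, comul (R := k) (S (r.left i)) * (r.right i ⊗ₜ 1) = 1 ⊗ₜ S z := by
  have h0 : toConv (comul ∘ₗ S) =
      toConv ((AlgHom.toLinearMap i₂) ∘ₗ S) * toConv ((AlgHom.toLinearMap i₁) ∘ₗ S) := by
    ext x
    rw [(ℛ k x).convMul_apply]
    simp [comul_antipode_repr (ℛ k x)]
  have h1 : toConv (comul ∘ₗ S) * toConv (AlgHom.toLinearMap i₁) =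
      toConv ((AlgHom.toLinearMap i₂) ∘ₗ S) := by
    rw [h0, mul_assoc (toConv ((AlgHom.toLinearMap i₂) ∘ₗ S)), conv_antipode_left i₁, mul_one]
  have h2 := LinearMap.congr_fun (congrArg ofConv h1) z
  rw [r.convMul_apply] at h2
  simpa using h2

theorem sum_apply_leftHit_mul_antipode (g f : H →ₗ[k] k) (x : H) {z : H} {ι : Type*}
    (r : Coalgebra.Repr k z ι) :
    ∑ i ∈ r.index, f (leftHit (g ∘ₗ LinearMap.mulRight k (r.right i)) (x * S (r.left i))) =
      f (leftHit g x * S z) := by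
  have h := congrArg (fun v => LinearMap.mul' k k (TensorProduct.map g f (comul x * v)))
    (sum_comul_antipode_mul r)
  rw [Finset.mul_sum, map_sum, map_sum] at h
  have e1 : ∀ (w y : H), LinearMap.mul' k k (TensorProduct.map g f (comul w * (y ⊗ₜ 1))) =
      f (leftHit (g ∘ₗ LinearMap.mulRight k y) w) := by
    intro w y
    rw [leftHit_repr _ (ℛ k w)]
    conv_lhs => rw [← (ℛ k w).eq]
    simp [Finset.sum_mul]
  have e2 : LinearMap.mul' k k (TensorProduct.map g f (comul x * (1 ⊗ₜ S z))) =
      f (leftHit g x * S z) := by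
    rw [leftHit_repr _ (ℛ k x)]
    conv_lhs => rw [← (ℛ k x).eq]
    simp [Finset.sum_mul]
  rw [e2] at h
  rw [← h]
  refine Finset.sum_congr rfl fun i _ => ?_
  rw [← mul_assoc, ← Bialgebra.comul_mul, e1]

theorem sum_apply_leftHit_mul_antipode_antipode (g f : H →ₗ[k] k) (x : H) {z : H} {ι : Type*}
    (r : Coalgebra.Repr k z ι) :
    ∑ i ∈ r.index, f (leftHit (g ∘ₗ LinearMap.mulRight k (S (r.left i))) (x * S (S (r.right i)))) =
      f (leftHit g x * S (S z)) :=
  sum_apply_leftHit_mul_antipode g f x (z := S z)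
    { index := r.index, left := fun i => S (r.right i), right := fun i => S (r.left i),
      eq := (comul_antipode_repr r).symm }

theorem sum_mul_antipode_rightHit (f : H →ₗ[k] k) {w : H} {ι : Type*} (r : Coalgebra.Repr k w ι) :
    ∑ i ∈ r.index, r.left i * S (rightHit f (r.right i)) = f w • (1 : H) := by
  have h := HopfAlgebra.mul_antipode_lTensor_comul_apply (R := k) (rightHit f w)
  rw [rightHit_repr_comul f r, counit_rightHit] at h
  simpa [Algebra.algebraMap_eq_smul_one] using h

theorem sum_antipode_rightHit_mul {ι : Type*} [Fintype ι] (b : Module.Basis ι k H) (x : H) :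
    ∑ j, S (rightHit (b.coord j) x) * b j = counit (R := k) x • (1 : H) := by
  have := HopfAlgebra.mul_antipode_rTensor_comul_apply (R := k) x
  rw [comul_eq_sum_rightHit b] at this
  simpa [Algebra.algebraMap_eq_smul_one] using this

variable [FiniteDimensional k H]

/-- The trace of `z ↦ (x S²(z))₁ f((x S²(z))₂)`, as a functional of `x`. -/
noncomputable def traceIntegral (f : H →ₗ[k] k) : H →ₗ[k] k :=
  ∑ i, (Module.finBasis k H).coord i ∘ₗ rightHit f ∘ₗ
    LinearMap.mulRight k (S (S (Module.finBasis k H i)))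

theorem traceIntegral_apply (f : H →ₗ[k] k) (x : H) : traceIntegral f x =
    ∑ i, (Module.finBasis k H).coord i (rightHit f (x * S (S (Module.finBasis k H i)))) := by
  simp [traceIntegral, LinearMap.sum_apply]

theorem traceIntegral_isDualIntegral (f : H →ₗ[k] k) : IsDualIntegral (traceIntegral f) := by
  set b := Module.finBasis k H with hb
  intro x
  refine sub_eq_zero.1 (eq_zero_of_forall_dual (k := k) fun g => ?_)
  rw [map_sub, sub_eq_zero, ← apply_leftHit, traceIntegral_apply, map_smul, traceIntegral_apply,
    smul_eq_mul, Finset.sum_mul, ← hb]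
  have e1 : ∀ i, b.coord i (rightHit f (leftHit g x * S (S (b i)))) =
      ∑ j, b.coord i (leftHit (g ∘ₗ LinearMap.mulRight k (S (rightHit (b.coord j) (b i))))
        (rightHit f (x * S (S (b j))))) := by
    intro i
    have := sum_apply_leftHit_mul_antipode_antipode g (b.coord i ∘ₗ rightHit f) x (z := b i)
      { index := Finset.univ, left := fun j => rightHit (b.coord j) (b i), right := fun j => b j,
        eq := (comul_eq_sum_rightHit b (b i)).symm }
    rw [LinearMap.comp_apply] at this
    rw [← this]
    simp [leftHit_rightHit]
  have e2 : ∀ (φ : H →ₗ[k] k) w, ∑ i, b.coord i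
      (leftHit (g ∘ₗ LinearMap.mulRight k (S (rightHit φ (b i)))) w) = φ w * g 1 := by
    intro φ w
    have h := congrArg g (sum_mul_antipode_rightHit φ (ℛ k w))
    rw [map_sum, map_smul, smul_eq_mul] at h
    rw [← h]
    have : ∀ i, b.coord i
      (leftHit (g ∘ₗ LinearMap.mulRight k (S (rightHit φ (b i)))) w) =
      ∑ j ∈ (ℛ k w).index, b.coord i ((ℛ k w).right j) *
        g ((ℛ k w).left j * S (rightHit φ (b i))) := by
      intro i
      rw [leftHit_repr _ (ℛ k w)]
      simp [mul_comm]
    simp_rw [this]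
    rw [Finset.sum_comm]
    refine Finset.sum_congr rfl fun j _ => ?_
    simpa using sum_coord_smul_apply b
      (g ∘ₗ LinearMap.mulLeft k ((ℛ k w).left j) ∘ₗ S ∘ₗ rightHit φ) ((ℛ k w).right j)
  simp_rw [e1]
  rw [Finset.sum_comm]
  exact Finset.sum_congr rfl fun j _ => e2 _ _

theorem sum_traceIntegral (f : H →ₗ[k] k) (x : H) :
    ∑ j, traceIntegral ((Module.finBasis k H).coord j ∘ₗ rightHit f)
      (x * S (Module.finBasis k H j)) = f x := by
  set b := Module.finBasis k H with hb
  let X : H →ₗ[k] H := rightHit f ∘ₗ LinearMap.mulLeft k x ∘ₗ S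
  have e1 : ∀ j, traceIntegral (b.coord j ∘ₗ rightHit f) (x * S (b j)) =
      ∑ i, ∑ l, b.coord l (X (S (b i) * b j)) * b.coord i (rightHit (b.coord j) (b l)) := by
    intro j
    rw [traceIntegral_apply, ← hb]
    refine Finset.sum_congr rfl fun i _ => ?_
    rw [← rightHit_rightHit, mul_assoc, ← HopfAlgebra.antipode_mul_antidistrib]
    change b.coord i (rightHit (b.coord j) (X (S (b i) * b j))) = _
    simpa using (sum_coord_smul_apply b (b.coord i ∘ₗ rightHit (b.coord j))
      (X (S (b i) * b j))).symm
  have e2 : ∀ l, ∑ j, ∑ i, b.coord l (X (S (b i) * b j)) * b.coord i (rightHit (b.coord j) (b l))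
      = b.coord l (X 1) * counit (b l) := by
    intro l
    have h := congrArg (fun v => b.coord l (X v)) (sum_antipode_rightHit_mul b (b l))
    rw [map_smul, map_smul, smul_eq_mul, mul_comm] at h
    rw [← h, map_sum, map_sum]
    refine Finset.sum_congr rfl fun j _ => ?_
    simpa [mul_comm] using sum_coord_smul_apply b
      (b.coord l ∘ₗ X ∘ₗ LinearMap.mulRight k (b j) ∘ₗ S) (rightHit (b.coord j) (b l))
  simp_rw [e1]
  have e3 : ∑ j, ∑ i, ∑ l, b.coord l (X (S (b i) * b j)) * b.coord i (rightHit (b.coord j) (b l))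
    = ∑ l, ∑ j, ∑ i, b.coord l (X (S (b i) * b j)) * b.coord i (rightHit (b.coord j) (b l)) := by
    refine Eq.trans ?_ Finset.sum_comm
    exact Finset.sum_congr rfl fun j _ => Finset.sum_comm
  rw [e3]
  simp_rw [e2]
  have h4 := sum_coord_smul_apply b (counit (R := k)) (X 1)
  have h5 : counit (R := k) (X 1) = f x := by
    simp [X, HopfAlgebra.antipode_one, counit_rightHit]
  rw [h5] at h4
  simpa using h4

variable (k H) in
theorem exists_isDualIntegral [Nontrivial H] : ∃ l : H →ₗ[k] k, IsDualIntegral l ∧ l ≠ 0 := by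
  by_contra! hcon
  refine one_ne_zero (α := H) (eq_zero_of_forall_dual (k := k) fun f => ?_)
  rw [← sum_traceIntegral]
  refine Finset.sum_eq_zero fun j _ => ?_
  rw [hcon _ (traceIntegral_isDualIntegral _)]
  rfl

end IntegralExistence

section Characters
variable {k H : Type*} [Field k] [Ring H] [HopfAlgebra k H]

local notation "S" => HopfAlgebra.antipode k (A := H)

theorem rightHit_mul (χ : H →ₐ[k] k) (x y : H) :
    rightHit χ.toLinearMap (x * y) = rightHit χ.toLinearMap x * rightHit χ.toLinearMap y := by
  rw [rightHit_mul_repr _ (ℛ k x) (ℛ k y), rightHit_repr _ (ℛ k x), rightHit_repr _ (ℛ k y),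
    Finset.sum_mul_sum]
  simp [mul_smul_mul_comm]

theorem leftHit_mul (χ : H →ₐ[k] k) (x y : H) :
    leftHit χ.toLinearMap (x * y) = leftHit χ.toLinearMap x * leftHit χ.toLinearMap y := by
  rw [leftHit_mul_repr _ (ℛ k x) (ℛ k y), leftHit_repr _ (ℛ k x), leftHit_repr _ (ℛ k y),
    Finset.sum_mul_sum]
  simp [mul_smul_mul_comm]

/-- The algebra endomorphism `x ↦ x₁ χ(x₂)` attached to a character. -/
noncomputable def rightTwist (χ : H →ₐ[k] k) : H →ₐ[k] H :=
  AlgHom.ofLinearMap (rightHit χ.toLinearMap)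
    (by rw [rightHit_apply, Bialgebra.comul_one, Algebra.TensorProduct.one_def]; simp)
    (rightHit_mul χ)

/-- The algebra endomorphism `x ↦ χ(x₁) x₂` attached to a character. -/
noncomputable def leftTwist (χ : H →ₐ[k] k) : H →ₐ[k] H :=
  AlgHom.ofLinearMap (leftHit χ.toLinearMap)
    (by rw [leftHit_apply, Bialgebra.comul_one, Algebra.TensorProduct.one_def]; simp)
    (leftHit_mul χ)

theorem rightTwist_apply (χ : H →ₐ[k] k) (x : H) :
    rightTwist χ x = rightHit χ.toLinearMap x := rfl

theorem leftTwist_apply (χ : H →ₐ[k] k) (x : H) :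
    leftTwist χ x = leftHit χ.toLinearMap x := rfl

/-- The inverse `χ ∘ S` of a character. -/
noncomputable def characterInv (χ : H →ₐ[k] k) : H →ₐ[k] k :=
  AlgHom.ofLinearMap (χ.toLinearMap ∘ₗ S) (by simp [HopfAlgebra.antipode_one])
    (fun x y => by simp [HopfAlgebra.antipode_mul_antidistrib, mul_comm])

theorem toLinearMap_injective_withConv : Function.Injective
    (fun χ : WithConv (H →ₐ[k] k) => toConv χ.ofConv.toLinearMap) := fun _ _ h =>
  WithConv.ofConv_injective (AlgHom.toLinearMap_injective (WithConv.toConv_injective h))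

noncomputable instance characterGroup : Group (WithConv (H →ₐ[k] k)) where
  inv χ := toConv (characterInv χ.ofConv)
  inv_mul_cancel χ := toLinearMap_injective_withConv <| by
    change toConv (toConv (characterInv χ.ofConv) * χ).ofConv.toLinearMap = _
    rw [AlgHom.toLinearMap_convMul]
    exact conv_antipode_left χ.ofConv

theorem ofConv_mul_apply (χ β : WithConv (H →ₐ[k] k)) (x : H) :
    (χ * β).ofConv x = χ.ofConv (rightTwist β.ofConv x) := by
  have h := LinearMap.congr_fun (congrArg ofConv (AlgHom.toLinearMap_convMul χ β)) x
  rw [(ℛ k x).convMul_apply] at h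
  rw [rightTwist_apply, rightHit_repr _ (ℛ k x)]
  simpa [mul_comm] using h

theorem ofConv_mul_apply' (χ β : WithConv (H →ₐ[k] k)) (x : H) :
    (χ * β).ofConv x = β.ofConv (leftTwist χ.ofConv x) := by
  rw [ofConv_mul_apply]
  exact (apply_leftHit β.ofConv.toLinearMap χ.ofConv.toLinearMap x).symm

theorem rightTwist_mul (χ β : WithConv (H →ₐ[k] k)) (x : H) :
    rightTwist (χ * β).ofConv x = rightTwist χ.ofConv (rightTwist β.ofConv x) := by
  simp only [rightTwist_apply]
  rw [rightHit_rightHit]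
  congr 2
  ext y
  exact ofConv_mul_apply χ β y

theorem leftTwist_mul (χ β : WithConv (H →ₐ[k] k)) (x : H) :
    leftTwist (χ * β).ofConv x = leftTwist β.ofConv (leftTwist χ.ofConv x) := by
  simp only [leftTwist_apply]
  rw [leftHit_leftHit]
  congr 2
  ext y
  exact ofConv_mul_apply' χ β y

theorem rightTwist_one (x : H) : rightTwist (1 : WithConv (H →ₐ[k] k)).ofConv x = x :=
  rightHit_counit x

theorem leftTwist_one (x : H) : leftTwist (1 : WithConv (H →ₐ[k] k)).ofConv x = x :=
  leftHit_counit x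

theorem leftTwist_rightTwist (χ β : H →ₐ[k] k) (x : H) :
    leftTwist χ (rightTwist β x) = rightTwist β (leftTwist χ x) := leftHit_rightHit _ _ _

theorem rightTwist_antipode (χ : WithConv (H →ₐ[k] k)) (x : H) :
    rightTwist χ.ofConv (S x) = S (leftTwist (χ⁻¹).ofConv x) := rightHit_antipode _ _

theorem leftTwist_antipode (χ : WithConv (H →ₐ[k] k)) (x : H) :
    leftTwist χ.ofConv (S x) = S (rightTwist (χ⁻¹).ofConv x) := leftHit_antipode _ _

/-- The action of pairs of characters on `H` by algebra endomorphisms,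
`(χ, β) • x = χ⁻¹(x₁) x₂ β(x₃)`. -/
noncomputable def biTwist :
    WithConv (H →ₐ[k] k) × WithConv (H →ₐ[k] k) →* (H →ₐ[k] H) where
  toFun g := (leftTwist (g.1⁻¹).ofConv).comp (rightTwist g.2.ofConv)
  map_one' := by
    ext x
    simp [rightTwist_one, leftTwist_one]
  map_mul' g h := by
    ext x
    simp [rightTwist_mul, leftTwist_mul, leftTwist_rightTwist]

theorem biTwist_apply (g : WithConv (H →ₐ[k] k) × WithConv (H →ₐ[k] k)) (x : H) :
    biTwist g x = leftTwist (g.1⁻¹).ofConv (rightTwist g.2.ofConv x) := rfl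

theorem biTwist_antipode (g : WithConv (H →ₐ[k] k) × WithConv (H →ₐ[k] k)) (x : H) :
    biTwist g (S x) = S (biTwist (g.2, g.1) x) := by
  rw [biTwist_apply, rightTwist_antipode, leftTwist_antipode, inv_inv, biTwist_apply,
    leftTwist_rightTwist]

theorem biTwist_inv_apply_apply (g : WithConv (H →ₐ[k] k) × WithConv (H →ₐ[k] k)) (x : H) :
    biTwist g⁻¹ (biTwist g x) = x := by
  have h := congrArg (fun F => F x) (map_mul (biTwist (k := k) (H := H)) g⁻¹ g)
  rw [inv_mul_cancel, map_one] at h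
  exact h.symm

theorem biTwist_apply_inv_apply (g : WithConv (H →ₐ[k] k) × WithConv (H →ₐ[k] k)) (x : H) :
    biTwist g (biTwist g⁻¹ x) = x := by
  simpa using biTwist_inv_apply_apply g⁻¹ x

end Characters

section Radford
variable {k H : Type*} [Field k] [Ring H] [HopfAlgebra k H]

local notation "S" => HopfAlgebra.antipode k (A := H)

variable {l : H →ₗ[k] k}

/-- `t₁ l(x t₂) = S(x)`. -/
theorem IsDualIntegral.rightHit_mulLeft_integral (hl : IsDualIntegral l) {t : H}
    (ht : ∀ x, x * t = counit (R := k) x • t) (h1 : l t = 1) (x : H) :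
    rightHit (l ∘ₗ LinearMap.mulLeft k x) t = S x := by
  rw [hl.rightHit_mulLeft]
  have : l ∘ₗ LinearMap.mulRight k t = counit (R := k) := by
    ext y; simp [ht, h1]
  rw [this, rightHit_counit]

variable [FiniteDimensional k H]

variable (k H) in
theorem antipode_bijective [Nontrivial H] : Function.Bijective S := by
  obtain ⟨l, hl, h0⟩ := exists_isDualIntegral k H
  have hinj : Function.Injective S := by
    rw [injective_iff_map_eq_zero]
    intro x hx
    exact hl.eq_zero_of_mul_antipode h0 fun y => by rw [hx]; simp
  exact ⟨hinj, LinearMap.injective_iff_surjective.1 hinj⟩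

theorem IsDualIntegral.eq_zero_of_forall_mul [Nontrivial H] (hl : IsDualIntegral l)
    (h0 : l ≠ 0) {x : H}
    (hx : ∀ y, l (y * x) = 0) : x = 0 := by
  obtain ⟨z, rfl⟩ := (antipode_bijective k H).2 x
  rw [hl.eq_zero_of_mul_antipode h0 hx, map_zero]

theorem IsDualIntegral.exists_apply_mul_eq [Nontrivial H] (hl : IsDualIntegral l) (h0 : l ≠ 0)
    (f : H →ₗ[k] k) : ∃ x, ∀ y, f y = l (y * x) := by
  let T : H →ₗ[k] (H →ₗ[k] k) := (LinearMap.llcomp k H H k l) ∘ₗ (LinearMap.mul k H).flip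
  have hinj : Function.Injective T := by
    rw [injective_iff_map_eq_zero]
    exact fun x hx => hl.eq_zero_of_forall_mul h0 fun y => congrArg (fun F => F y) hx
  have hsurj := (LinearMap.injective_iff_surjective_of_finrank_eq_finrank
    (Subspace.dual_finrank_eq (K := k) (V := H)).symm).1 hinj
  obtain ⟨x, rfl⟩ := hsurj f
  exact ⟨x, fun y => rfl⟩

theorem IsDualIntegral.eq_zero_of_forall_mul' [Nontrivial H] (hl : IsDualIntegral l) (h0 : l ≠ 0)
    {x : H} (hx : ∀ y, l (x * y) = 0) : x = 0 := by
  refine eq_zero_of_forall_dual (k := k) fun g => ?_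
  obtain ⟨y, hy⟩ := hl.exists_apply_mul_eq h0 g
  rw [hy, hx]

theorem IsDualIntegral.exists_apply_mul_eq' [Nontrivial H] (hl : IsDualIntegral l) (h0 : l ≠ 0)
    (f : H →ₗ[k] k) : ∃ x, ∀ y, f y = l (x * y) := by
  let T : H →ₗ[k] (H →ₗ[k] k) := (LinearMap.llcomp k H H k l) ∘ₗ (LinearMap.mul k H)
  have hinj : Function.Injective T := by
    rw [injective_iff_map_eq_zero]
    exact fun x hx => hl.eq_zero_of_forall_mul' h0 fun y => congrArg (fun F => F y) hx
  have hsurj := (LinearMap.injective_iff_surjective_of_finrank_eq_finrank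
    (Subspace.dual_finrank_eq (K := k) (V := H)).symm).1 hinj
  obtain ⟨x, rfl⟩ := hsurj f
  exact ⟨x, fun y => rfl⟩

/-- A left integral `t`, normalised against a dual integral, and of the
distinguished character `α`. -/
theorem IsDualIntegral.exists_integral [Nontrivial H] (hl : IsDualIntegral l) (h0 : l ≠ 0) :
    ∃ (t : H) (α : H →ₐ[k] k), (∀ x, x * t = counit (R := k) x • t) ∧ (∀ x, t * x = α x • t) ∧
      l t = 1 := by
  obtain ⟨t, ht⟩ := hl.exists_apply_mul_eq h0 (counit (R := k))
  have h1 : l t = 1 := by rw [← one_mul t, ← ht]; simp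
  have h2 : ∀ x, x * t = counit (R := k) x • t := by
    intro x
    refine sub_eq_zero.1 (hl.eq_zero_of_forall_mul h0 fun y => ?_)
    rw [mul_sub, map_sub, ← mul_assoc, ← ht, mul_smul_comm, map_smul, ← ht]
    simp [mul_comm]
  have h3 : ∀ x, t * x = l (t * x) • t := by
    intro x
    refine sub_eq_zero.1 (hl.eq_zero_of_forall_mul h0 fun y => ?_)
    rw [mul_sub, map_sub, ← mul_assoc, h2, smul_mul_assoc, map_smul, mul_smul_comm, map_smul, h2,
      map_smul, h1]
    simp [mul_comm]
  refine ⟨t, AlgHom.ofLinearMap (l ∘ₗ LinearMap.mulLeft k t) (by simpa using h1) fun x y => ?_,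
    h2, h3, h1⟩
  change l (t * (x * y)) = l (t * x) * l (t * y)
  rw [← mul_assoc, h3 x, smul_mul_assoc, map_smul, map_smul, h1, smul_eq_mul, smul_eq_mul,
    mul_one]

theorem IsDualIntegral.eq_of_rightHit_integral [Nontrivial H] (hl : IsDualIntegral l)
    (h0 : l ≠ 0) {t : H} (ht : ∀ x, x * t = counit (R := k) x • t) (h1 : l t = 1)
    {f g : H →ₗ[k] k} (h : rightHit f t = rightHit g t) : f = g := by
  obtain ⟨x, hx⟩ := hl.exists_apply_mul_eq' h0 f
  obtain ⟨y, hy⟩ := hl.exists_apply_mul_eq' h0 g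
  have e1 : f = l ∘ₗ LinearMap.mulLeft k x := LinearMap.ext hx
  have e2 : g = l ∘ₗ LinearMap.mulLeft k y := LinearMap.ext hy
  rw [e1, e2, hl.rightHit_mulLeft_integral ht h1, hl.rightHit_mulLeft_integral ht h1] at h
  rw [e1, e2, (antipode_bijective k H).1 h]

variable (k H) in
/-- Radford's formula, in the form the right twist by `α` is conjugate to `S⁴` followed by the
left twist by `α`. -/
theorem exists_radford [Nontrivial H] : ∃ (α : WithConv (H →ₐ[k] k)) (u : Hˣ), ∀ w : H,
    rightTwist α.ofConv w * u = u * leftTwist α.ofConv (S (S (S (S w)))) := by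
  obtain ⟨l, hl, h0⟩ := exists_isDualIntegral k H
  obtain ⟨t, α, ht, hα, h1⟩ := hl.exists_integral h0
  have hbij := antipode_bijective k H
  let e := LinearEquiv.ofBijective S hbij
  have he : ∀ x, S (e.symm x) = x := fun x => e.apply_symm_apply x
  obtain ⟨σ, hσ⟩ : ∃ σ : H → H, ∀ y, S (S (σ y)) = rightTwist α y :=
    ⟨fun y => e.symm (e.symm (rightTwist α y)), fun y => by rw [he, he]⟩
  have hinj2 : ∀ {x y : H}, S (S x) = S (S y) → x = y := fun h => hbij.1 (hbij.1 h)
  have hl2 : ∀ y z, l (z * y) = l (σ y * z) := by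
    intro y z
    have e1 : α.toLinearMap = l ∘ₗ LinearMap.mulLeft k t := by
      ext x; simp [hα, h1]
    have e2 := hσ y
    rw [rightTwist_apply, e1, hl.rightHit_mulLeft] at e2
    have e3 := hbij.1 e2
    rw [← hl.rightHit_mulLeft_integral ht h1] at e3
    exact (congrArg (fun F => F z) (hl.eq_of_rightHit_integral h0 ht h1 e3)).symm
  have hσmul : ∀ x y, σ (x * y) = σ x * σ y := by
    intro x y
    apply hinj2
    rw [hσ, map_mul, HopfAlgebra.antipode_mul_antidistrib, HopfAlgebra.antipode_mul_antidistrib,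
      hσ, hσ]
  obtain ⟨v, hv⟩ := hl.exists_apply_mul_eq h0 (l ∘ₗ S)
  have hv1 : ∀ y, l (S y) = l (y * v) := hv
  have hvinj : Function.Injective (LinearMap.mulRight k v) := by
    rw [injective_iff_map_eq_zero]
    intro x hx
    refine hbij.1 ((hl.eq_zero_of_forall_mul' h0 fun y => ?_).trans (map_zero S).symm)
    obtain ⟨z, rfl⟩ := hbij.2 y
    rw [← HopfAlgebra.antipode_mul_antidistrib, hv1, mul_assoc]
    rw [LinearMap.mulRight_apply] at hx
    rw [hx, mul_zero, map_zero]
  obtain ⟨v', hv'⟩ := LinearMap.injective_iff_surjective.1 hvinj 1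
  rw [LinearMap.mulRight_apply] at hv'
  have hvv' : v * v' = 1 := hvinj (by simp [mul_assoc, hv'])
  have key : ∀ w, rightTwist α w * rightTwist α v =
      rightTwist α v * leftTwist α (S (S (S (S w)))) := by
    intro w
    have a1 : σ (S (leftTwist α (S (S w)))) = S w := by
      apply hinj2
      rw [hσ]
      have := rightTwist_antipode (toConv α) (leftTwist α (S (S w)))
      rw [ofConv_toConv] at this
      rw [this]
      have := leftTwist_mul (toConv α) (toConv α)⁻¹ (S (S w))
      rw [mul_inv_cancel, leftTwist_one] at this
      exact congrArg S this.symm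
    have a2 : ∀ z, l (z * w * v) = l (leftTwist α (S (S w)) * z * v) := by
      intro z
      rw [← hv1, ← hv1, HopfAlgebra.antipode_mul_antidistrib, HopfAlgebra.antipode_mul_antidistrib,
        hl2 _ (S z), a1]
    have a3 : σ w * σ v = σ v * leftTwist α (S (S w)) := by
      refine sub_eq_zero.1 (hl.eq_zero_of_forall_mul' h0 fun z => ?_)
      have := a2 z
      rw [mul_assoc, hl2 (w * v), hσmul, hl2 v] at this
      rw [sub_mul, map_sub, this, mul_assoc, sub_self]
    have a4 := congrArg (fun v => S (S v)) a3
    rw [← hσmul, hσ, rightTwist_apply, rightHit_mul] at a4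
    rw [HopfAlgebra.antipode_mul_antidistrib, HopfAlgebra.antipode_mul_antidistrib, hσ] at a4
    have a5 : S (S (leftTwist α (S (S w)))) = leftTwist α (S (S (S (S w)))) := by
      have b1 := leftTwist_antipode (toConv α) (S (S (S w)))
      have b2 := rightTwist_antipode (toConv α)⁻¹ (S (S w))
      rw [inv_inv, ofConv_toConv] at b2
      rw [ofConv_toConv, b2] at b1
      exact b1.symm
    rw [← a5]
    exact a4
  refine ⟨toConv α, ⟨rightTwist α v, rightTwist α v', ?_, ?_⟩, key⟩
  · rw [← map_mul, hvv', map_one]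
  · rw [← map_mul, hv', map_one]
end Radford

section Trace
variable {k H : Type*} [Field k] [Ring H] [HopfAlgebra k H]

local notation "S" => HopfAlgebra.antipode k (A := H)

variable {U : Type*} [AddCommGroup U] [Module k U]

/-- The map `u ⊗ x ↦ T(x₂)u ⊗ x₁`. -/
noncomputable def entwine (T : H →ₗ[k] Module.End k U) : U ⊗[k] H →ₗ[k] U ⊗[k] H :=
  TensorProduct.lift ((LinearMap.lcomp k _ ((TensorProduct.comm k H H).toLinearMap ∘ₗ comul)) ∘ₗ
    (LinearMap.rTensorHom H) ∘ₗ T.flip)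

theorem entwine_tmul (T : H →ₗ[k] Module.End k U) (u : U) {x : H} {ι : Type*}
    (r : Coalgebra.Repr k x ι) :
    entwine T (u ⊗ₜ x) = ∑ i ∈ r.index, T (r.right i) u ⊗ₜ r.left i := by
  simp [entwine, ← r.eq]

variable (k H) in
theorem linearIndependent_character :
    LinearIndependent k (fun χ : WithConv (H →ₐ[k] k) => χ.ofConv.toLinearMap) := by
  have h1 := (linearIndependent_monoidHom H k).comp
    (fun χ : WithConv (H →ₐ[k] k) => ((χ.ofConv : H →* k))) (fun χ β h =>
      WithConv.ofConv_injective (AlgHom.ext fun x => DFunLike.congr_fun h x))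
  have h2 : LinearIndependent k ((LinearMap.ltoFun k H k k) ∘
    (fun χ : WithConv (H →ₐ[k] k) => χ.ofConv.toLinearMap)) := h1
  exact LinearIndependent.of_comp _ h2

variable [FiniteDimensional k H]

theorem entwine_entwine_antipode (ρ : H →ₐ[k] Module.End k U) (t : U ⊗[k] H) :
    entwine ρ.toLinearMap (entwine (ρ.toLinearMap ∘ₗ S) t) = t := by
  induction t with
  | zero => simp
  | add x y hx hy => rw [map_add, map_add, hx, hy]
  | tmul u x =>
    let b := Module.finBasis k H
    let r : Coalgebra.Repr k x (Fin (Module.finrank k H)) :=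
      { index := Finset.univ, left := fun j => rightHit (b.coord j) x, right := fun j => b j,
        eq := (comul_eq_sum_rightHit b x).symm }
    rw [entwine_tmul _ _ r, map_sum]
    have e : ∀ j ∈ r.index, entwine ρ.toLinearMap
        ((ρ.toLinearMap ∘ₗ S) (r.right j) u ⊗ₜ[k] r.left j) =
        ∑ i ∈ (ℛ k x).index, ρ (rightHit (b.coord j) ((ℛ k x).right i) * S (b j)) u ⊗ₜ
          (ℛ k x).left i := by
      intro j _
      rw [entwine_tmul _ _ (r :=
        { index := (ℛ k x).index, left := fun i => (ℛ k x).left i,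
          right := fun i => rightHit (b.coord j) ((ℛ k x).right i),
          eq := (rightHit_repr_comul (b.coord j) (ℛ k x)).symm } )]
      simp [r]
    rw [Finset.sum_congr rfl e, Finset.sum_comm]
    have e2 : ∀ i, ∑ j ∈ r.index, ρ (rightHit (b.coord j) ((ℛ k x).right i) * S (b j)) u ⊗ₜ[k]
        (ℛ k x).left i = u ⊗ₜ (counit (R := k) ((ℛ k x).right i) • (ℛ k x).left i) := by
      intro i
      have := congrArg (fun v => ρ v u) (sum_rightHit_mul_antipode b ((ℛ k x).right i))
      rw [AlgHom.commutes, map_sum, LinearMap.sum_apply] at this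
      rw [← TensorProduct.sum_tmul, this]
      simp [TensorProduct.smul_tmul]
    simp_rw [e2]
    rw [← TensorProduct.tmul_sum, ← rightHit_repr, rightHit_counit]

theorem trace_mul_finrank_eq [FiniteDimensional k U] (ρ : H →ₐ[k] Module.End k U)
    (χ : H →ₐ[k] k) (φ : Module.End k U) (h : ∀ x, φ * ρ x = ρ (rightTwist χ x) * φ) :
    LinearMap.trace k U φ * Module.finrank k H =
      LinearMap.trace k U φ * LinearMap.trace k H (rightTwist χ).toLinearMap := by
  have hsurj : Function.Surjective (entwine ρ.toLinearMap) := fun t =>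
    ⟨_, entwine_entwine_antipode ρ t⟩
  let e := LinearEquiv.ofBijective _ ⟨LinearMap.injective_iff_surjective.2 hsurj, hsurj⟩
  have key : e.conj (TensorProduct.map φ (rightTwist χ).toLinearMap) =
      TensorProduct.map φ LinearMap.id := by
    have aux : ∀ s, e (TensorProduct.map φ (rightTwist χ).toLinearMap s) =
        TensorProduct.map φ LinearMap.id (e s) := by
      intro s
      induction s with
      | zero => simp
      | add x y hx hy => simp only [map_add, hx, hy]
      | tmul u x =>
        change entwine _ _ = TensorProduct.map φ LinearMap.id (entwine _ _)
        rw [entwine_tmul _ _ (ℛ k x), TensorProduct.map_tmul]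
        change entwine _ (φ u ⊗ₜ rightHit χ.toLinearMap x) = _
        rw [entwine_tmul _ _ (r :=
          { index := (ℛ k x).index, left := fun i => (ℛ k x).left i,
            right := fun i => rightTwist χ ((ℛ k x).right i),
            eq := (rightHit_repr_comul χ.toLinearMap (ℛ k x)).symm } ), map_sum]
        refine Finset.sum_congr rfl fun i _ => ?_
        rw [TensorProduct.map_tmul]
        exact (congrArg (fun F => F u ⊗ₜ[k] (ℛ k x).left i) (h ((ℛ k x).right i))).symm
    refine LinearMap.ext fun t => ?_
    rw [LinearEquiv.conj_apply_apply, aux, e.apply_symm_apply]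
  have := congrArg (LinearMap.trace k _) key
  rw [LinearMap.trace_conj', LinearMap.trace_tensorProduct', LinearMap.trace_tensorProduct',
    LinearMap.trace_id] at this
  exact this.symm

instance finite_character : Finite (WithConv (H →ₐ[k] k)) :=
  (linearIndependent_character k H).finite

end Trace

section TraceComplex
variable {H : Type*} [Ring H] [HopfAlgebra ℂ H] [FiniteDimensional ℂ H]

theorem Multiset.re_sum_le_card_of_norm_eq_one (s : Multiset ℂ) (h : ∀ μ ∈ s, ‖μ‖ = 1) :
    s.sum.re ≤ s.card ∧ (s.sum.re = s.card → ∀ μ ∈ s, μ = 1) := by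
  induction s using Multiset.induction with
  | empty => simp
  | cons a s ih =>
    obtain ⟨h1, h2⟩ := ih fun μ hμ => h μ (Multiset.mem_cons_of_mem hμ)
    have ha := h a (Multiset.mem_cons_self a s)
    have ha' : a.re ≤ 1 := ha ▸ Complex.re_le_norm a
    refine ⟨by simp; linarith, fun heq => ?_⟩
    simp only [Multiset.sum_cons, Complex.add_re, Multiset.card_cons, Nat.cast_add,
      Nat.cast_one] at heq
    have h3 : a.re = 1 := by linarith
    have h4 : a = 1 := by
      have h5 := Complex.sq_norm a
      rw [ha, Complex.normSq_apply, h3] at h5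
      exact Complex.ext (by simpa using h3) (by simpa using (by nlinarith : a.im * a.im = 0))
    intro μ hμ
    rcases Multiset.mem_cons.1 hμ with rfl | hμ
    · exact h4
    · exact h2 (by linarith) μ hμ

theorem eq_one_of_pow_eq_one_of_trace_eq {V : Type*} [AddCommGroup V] [Module ℂ V]
    [FiniteDimensional ℂ V] {f : Module.End ℂ V} {m : ℕ} (hm : 0 < m) (hf : f ^ m = 1)
    (htr : LinearMap.trace ℂ V f = Module.finrank ℂ V) : f = 1 := by
  have hs : f.charpoly.Splits := IsAlgClosed.splits _
  have hroot : ∀ μ ∈ f.charpoly.roots, ‖μ‖ = 1 := by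
    intro μ hμ
    have h1 := (Module.End.hasEigenvalue_iff_isRoot_charpoly f μ).2
      ((Polynomial.mem_roots f.charpoly_monic.ne_zero).1 hμ)
    obtain ⟨v, hv⟩ := h1.exists_hasEigenvector
    have h2 := hv.pow_apply m
    rw [hf] at h2
    have h3 : μ ^ m = 1 := by
      have : (μ ^ m - 1) • v = 0 := by rw [sub_smul, ← h2]; simp
      exact sub_eq_zero.1 ((smul_eq_zero.1 this).resolve_right hv.2)
    exact Complex.norm_eq_one_of_pow_eq_one h3 hm.ne'
  have hall : ∀ μ ∈ f.charpoly.roots, μ = 1 := by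
    have hsum := Module.End.trace_eq_sum_roots_charpoly_of_splits hs
    have hcard : f.charpoly.roots.card = Module.finrank ℂ V := by
      rw [← hs.natDegree_eq_card_roots, LinearMap.charpoly_natDegree]
    rw [htr, ← hcard] at hsum
    refine (Multiset.re_sum_le_card_of_norm_eq_one _ hroot).2 ?_
    rw [← hsum, Complex.natCast_re]
  have hspec : spectrum ℂ f ⊆ {1} := by
    intro μ hμ
    refine hall μ ?_
    rw [Polynomial.mem_roots f.charpoly_monic.ne_zero,
      ← Module.End.hasEigenvalue_iff_isRoot_charpoly]
    exact Module.End.HasEigenvalue.of_mem_spectrum hμ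
  have hu : IsUnit (∑ i ∈ Finset.range m, f ^ i) := by
    by_contra hcon
    rcases subsingleton_or_nontrivial V with h | h
    · exact hcon (isUnit_of_subsingleton _)
    have h0 : (0 : ℂ) ∈ spectrum ℂ (Polynomial.aeval f
        (∑ i ∈ Finset.range m, (Polynomial.X : Polynomial ℂ) ^ i)) := by
      rw [spectrum.zero_mem_iff]
      simpa using hcon
    rw [spectrum.map_polynomial_aeval_of_nonempty _ _
      (spectrum.nonempty_of_isAlgClosed_of_finiteDimensional ℂ f)] at h0
    obtain ⟨μ, hμ, h1⟩ := h0
    rw [Set.mem_singleton_iff.1 (hspec hμ)] at h1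
    simp [Polynomial.eval_finsetSum, hm.ne'] at h1
  have hmul : (∑ i ∈ Finset.range m, f ^ i) * (f - 1) = 0 := by
    rw [geom_sum_mul, hf, sub_self]
  exact sub_eq_zero.1 ((hu.mul_right_eq_zero).1 hmul)

theorem trace_rightTwist {χ : WithConv (H →ₐ[ℂ] ℂ)} (hχ : χ ≠ 1) :
    LinearMap.trace ℂ H (rightTwist χ.ofConv).toLinearMap = 0 := by
  have h := trace_mul_finrank_eq (Algebra.lmul ℂ H) χ.ofConv (rightTwist χ.ofConv).toLinearMap
    (fun x => by ext y; simp)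
  by_contra h0
  refine hχ (WithConv.ofConv_injective (AlgHom.ext fun x => ?_))
  have h1 := mul_left_cancel₀ h0 h
  have hpow : ∀ n : ℕ, ((rightTwist χ.ofConv).toLinearMap : Module.End ℂ H) ^ n =
      (rightTwist (χ ^ n).ofConv).toLinearMap := by
    intro n
    induction n with
    | zero => ext x; simp [rightTwist_one]
    | succ n ih =>
      rw [pow_succ, ih, pow_succ]
      ext x
      simp [rightTwist_mul]
  have h2 := eq_one_of_pow_eq_one_of_trace_eq (m := orderOf χ) (orderOf_pos χ)
    (f := (rightTwist χ.ofConv).toLinearMap) (by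
      rw [hpow, pow_orderOf_eq_one]; ext x; simp [rightTwist_one]) h1.symm
  have h3 := congrArg (fun v => counit (R := ℂ) (v x)) h2
  exact (counit_rightHit _ _).symm.trans h3

theorem card_dvd_finrank_of_trace {V : Type*} [AddCommGroup V] [Module ℂ V]
    [FiniteDimensional ℂ V] {G : Type*} [Group G] [Finite G] (T : G →* Module.End ℂ V)
    (hT : ∀ g ≠ 1, LinearMap.trace ℂ V (T g) = 0) : Nat.card G ∣ Module.finrank ℂ V := by
  have := Fintype.ofFinite G
  have hc : (Nat.card G : ℂ) ≠ 0 := by exact_mod_cast Nat.card_pos.ne'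
  have : Invertible (Fintype.card G : ℂ) :=
    invertibleOfNonzero (by rwa [← Nat.card_eq_fintype_card])
  have h := (Representation.isProj_averageMap T).trace
  have h2 : LinearMap.trace ℂ V (Representation.averageMap T) =
      (Nat.card G : ℂ)⁻¹ * Module.finrank ℂ V := by
    rw [Representation.averageMap, GroupAlgebra.average, map_smul, map_sum, map_smul, map_sum]
    rw [Finset.sum_eq_single 1]
    · simp [Nat.card_eq_fintype_card, invOf_eq_inv]
    · intro g _ hg
      simpa using hT g hg
    · simp
  rw [h2, inv_mul_eq_iff_eq_mul₀ hc] at h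
  exact ⟨_, by exact_mod_cast h⟩

variable (H) in
theorem card_character_dvd : Nat.card (WithConv (H →ₐ[ℂ] ℂ)) ∣ Module.finrank ℂ H :=
  card_dvd_finrank_of_trace
    { toFun := fun χ => (rightTwist χ.ofConv).toLinearMap
      map_one' := by ext x; simp [rightTwist_one]
      map_mul' := fun χ β => by ext x; simp [rightTwist_mul] }
    fun _ hχ => trace_rightTwist hχ

end TraceComplex

section SimpleKernels
variable {A : Type} [Ring A] [Algebra ℂ A]

/-- `K` is the kernel of an irreducible representation of dimension `n`. -/
def IsSimpleKernel (K : Ideal A) (n : ℕ) : Prop :=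
  ∃ (U : Type) (_ : AddCommGroup U) (_ : Module ℂ U) (_ : FiniteDimensional ℂ U)
    (ρ : A →ₐ[ℂ] Module.End ℂ U), Function.Surjective ρ ∧ Module.finrank ℂ U = n ∧ 0 < n ∧
      RingHom.ker ρ = K

theorem exists_linearEquiv_of_ker_eq {U : Type*} [AddCommGroup U] [Module ℂ U]
    {U' : Type*} [AddCommGroup U'] [Module ℂ U']
    {ρ : A →ₐ[ℂ] Module.End ℂ U} {ρ' : A →ₐ[ℂ] Module.End ℂ U'} (h : Function.Surjective ρ)
    (h' : Function.Surjective ρ') (hker : RingHom.ker ρ = RingHom.ker ρ') :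
    ∃ T : U ≃ₗ[ℂ] U', ∀ x u, ρ' x (T u) = T (ρ x u) := by
  let e := ((Ideal.quotientKerAlgEquivOfSurjective h).symm.trans
    (Ideal.quotientEquivAlgOfEq ℂ hker)).trans (Ideal.quotientKerAlgEquivOfSurjective h')
  have he : ∀ x, e (ρ x) = ρ' x := by
    intro x
    have : (Ideal.quotientKerAlgEquivOfSurjective h).symm (ρ x) = Ideal.Quotient.mk _ x := by
      rw [AlgEquiv.symm_apply_eq]; rfl
    simp only [e, AlgEquiv.trans_apply, this]
    rfl
  obtain ⟨T, hT⟩ := e.eq_linearEquivConjAlgEquiv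
  refine ⟨T, fun x u => ?_⟩
  rw [← he, hT]
  simp

theorem exists_sum_mul_mul_eq_one {U : Type*} [AddCommGroup U] [Module ℂ U]
    [FiniteDimensional ℂ U] {T : Module.End ℂ U} (hT : T ≠ 0) :
    ∃ a b : Fin (Module.finrank ℂ U) → Module.End ℂ U, ∑ i, a i * T * b i = 1 := by
  obtain ⟨u, hu⟩ : ∃ u, T u ≠ 0 := by
    by_contra! hcon
    exact hT (LinearMap.ext hcon)
  obtain ⟨g, hg⟩ := Module.Projective.exists_dual_ne_zero ℂ hu
  let c := Module.finBasis ℂ U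
  refine ⟨fun i => g.smulRight ((g (T u))⁻¹ • c i), fun i => (c.coord i).smulRight u, ?_⟩
  refine LinearMap.ext fun v => ?_
  simp only [LinearMap.sum_apply, Module.End.mul_apply, LinearMap.smulRight_apply, map_smul,
    smul_smul]
  conv_rhs => rw [Module.End.one_apply, ← c.sum_repr v]
  refine Finset.sum_congr rfl fun i _ => ?_
  rw [mul_inv_cancel₀ hg, mul_one, c.coord_apply]

namespace IsSimpleKernel
variable {K L : Ideal A} {n m : ℕ}

theorem isTwoSided (h : IsSimpleKernel K n) : K.IsTwoSided := by
  obtain ⟨U, _, _, _, ρ, -, -, -, rfl⟩ := h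
  infer_instance

theorem pos (h : IsSimpleKernel K n) : 0 < n := by
  obtain ⟨U, _, _, _, ρ, -, -, hn, -⟩ := h
  exact hn

theorem one_notMem (h : IsSimpleKernel K n) : (1 : A) ∉ K := by
  obtain ⟨U, _, _, _, ρ, -, rfl, hn, rfl⟩ := h
  have := Module.finrank_pos_iff.1 hn
  simp [RingHom.mem_ker]

theorem unique (h : IsSimpleKernel K n) (h' : IsSimpleKernel K m) : n = m := by
  obtain ⟨U, _, _, _, ρ, hρ, rfl, -, hk⟩ := h
  obtain ⟨U', _, _, _, ρ', hρ', rfl, -, hk'⟩ := h'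
  obtain ⟨T, -⟩ := exists_linearEquiv_of_ker_eq hρ hρ' (hk.trans hk'.symm)
  exact T.finrank_eq

theorem exists_one_sub_sum_mem (h : IsSimpleKernel K n) {x : A} (hx : x ∉ K) :
    ∃ a b : Fin n → A, 1 - ∑ i, a i * x * b i ∈ K := by
  obtain ⟨U, _, _, _, ρ, hρ, rfl, -, rfl⟩ := h
  obtain ⟨a, b, hab⟩ := exists_sum_mul_mul_eq_one (T := ρ x) hx
  choose f hf using hρ
  refine ⟨fun i => f (a i), fun i => f (b i), ?_⟩
  simp [RingHom.mem_ker, map_sum, hf, hab]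

theorem exists_mem_one_sub_mem (h : IsSimpleKernel K n) {I : Ideal A} [I.IsTwoSided]
    (hI : ¬ I ≤ K) : ∃ e ∈ I, 1 - e ∈ K := by
  obtain ⟨x, hxI, hx⟩ := Set.not_subset.1 hI
  obtain ⟨a, b, hab⟩ := h.exists_one_sub_sum_mem hx
  exact ⟨_, I.sum_mem fun i _ => I.mul_mem_right _ (I.mul_mem_left _ hxI), hab⟩

theorem eq_of_le (h : IsSimpleKernel K n) (h' : IsSimpleKernel L m) (hle : L ≤ K) : L = K := by
  refine le_antisymm hle ?_
  by_contra hcon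
  have := h.isTwoSided
  obtain ⟨e, he, he'⟩ := h'.exists_mem_one_sub_mem hcon
  exact h.one_notMem (by simpa using K.add_mem (hle he') he)

theorem le_or_le_of_mul_le (h : IsSimpleKernel K n) {I J : Ideal A} [I.IsTwoSided]
    [J.IsTwoSided] (hIJ : I * J ≤ K) : I ≤ K ∨ J ≤ K := by
  by_contra! hcon
  obtain ⟨e, he, he'⟩ := h.exists_mem_one_sub_mem hcon.1
  obtain ⟨f, hf, hf'⟩ := h.exists_mem_one_sub_mem hcon.2
  have h1 := hIJ (Ideal.mul_mem_mul he hf)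
  have h2 : (1 : A) = e * f + (e * (1 - f) + (1 - e)) := by noncomm_ring
  exact h.one_notMem (h2 ▸ K.add_mem h1 (K.add_mem (K.mul_mem_left _ hf') he'))

theorem exists_mem_forall_one_sub_mem (h : IsSimpleKernel K n) (s : Finset (Ideal A))
    (hs : ∀ L ∈ s, (∃ m, IsSimpleKernel L m) ∧ L ≠ K) : ∃ e, 1 - e ∈ K ∧ ∀ L ∈ s, e ∈ L := by
  induction s using Finset.cons_induction with
  | empty => exact ⟨1, by simp⟩
  | cons L s hL ih =>
    obtain ⟨e, he, hes⟩ := ih fun L hL => hs L (Finset.mem_cons_of_mem hL)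
    obtain ⟨⟨m, hm⟩, hne⟩ := hs L (Finset.mem_cons_self L s)
    have := hm.isTwoSided
    obtain ⟨f, hf, hf'⟩ := h.exists_mem_one_sub_mem (I := L) fun hle => hne (h.eq_of_le hm hle)
    refine ⟨f * e, ?_, fun L' hL' => ?_⟩
    · have h2 : 1 - f * e = f * (1 - e) + (1 - f) := by noncomm_ring
      exact h2 ▸ K.add_mem (K.mul_mem_left _ he) hf'
    · rcases Finset.mem_cons.1 hL' with rfl | hL'
      · exact L'.mul_mem_right _ hf
      · exact L'.mul_mem_left _ (hes L' hL')

theorem comap (h : IsSimpleKernel K n) {B : Type} [Ring B] [Algebra ℂ B] (f : B →ₐ[ℂ] A)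
    (hf : Function.Surjective f) : IsSimpleKernel (K.comap f) n := by
  obtain ⟨U, _, _, _, ρ, hρ, hn, hn', rfl⟩ := h
  exact ⟨U, _, _, ‹_›, ρ.comp f, hρ.comp hf, hn, hn', by ext; simp [RingHom.mem_ker]⟩

end IsSimpleKernel

section Family
variable {ι : Type} [Fintype ι] {U : ι → Type} [∀ i, AddCommGroup (U i)] [∀ i, Module ℂ (U i)]
  [∀ i, FiniteDimensional ℂ (U i)] {ρ : ∀ i, A →ₐ[ℂ] Module.End ℂ (U i)}

theorem surjective_pi_of_ker_injective (hρ : ∀ i, Function.Surjective (ρ i))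
    (hpos : ∀ i, 0 < Module.finrank ℂ (U i))
    (hinj : Function.Injective fun i => RingHom.ker (ρ i)) :
    Function.Surjective (AlgHom.pi ρ) := by
  classical
  have hs : ∀ i, IsSimpleKernel (RingHom.ker (ρ i)) (Module.finrank ℂ (U i)) :=
    fun i => ⟨U i, _, _, inferInstance, ρ i, hρ i, rfl, hpos i, rfl⟩
  have h1 : ∀ i, ∃ e, ρ i e = 1 ∧ ∀ j ≠ i, ρ j e = 0 := by
    intro i
    obtain ⟨e, he, he'⟩ := (hs i).exists_mem_forall_one_sub_mem
      ((Finset.univ.erase i).image fun j => RingHom.ker (ρ j)) (by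
        intro L hL
        obtain ⟨j, hj, rfl⟩ := Finset.mem_image.1 hL
        exact ⟨⟨_, hs j⟩, fun h => (Finset.mem_erase.1 hj).1 (hinj h)⟩)
    refine ⟨e, (sub_eq_zero.1 (by simpa [RingHom.mem_ker] using he)).symm, fun j hj => ?_⟩
    exact he' _ (Finset.mem_image.2 ⟨j, by simpa using hj, rfl⟩)
  choose e he he' using h1
  intro T
  choose x hx using fun i => hρ i (T i)
  refine ⟨∑ i, e i * x i, funext fun j => ?_⟩
  change ρ j _ = _
  rw [map_sum, Finset.sum_eq_single j, map_mul, he, hx, one_mul]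
  · intro i _ hi
    rw [map_mul, he' i j hi.symm, zero_mul]
  · simp

theorem sum_sq_lt_finrank [FiniteDimensional ℂ A] (hns : ¬ IsSemisimpleRing A)
    (hρ : ∀ i, Function.Surjective (ρ i))
    (hpos : ∀ i, 0 < Module.finrank ℂ (U i))
    (hinj : Function.Injective fun i => RingHom.ker (ρ i)) :
    ∑ i, (Module.finrank ℂ (U i)) ^ 2 < Module.finrank ℂ A := by
  have hsurj := surjective_pi_of_ker_injective hρ hpos hinj
  have hfr : Module.finrank ℂ (∀ i, Module.End ℂ (U i)) = ∑ i, (Module.finrank ℂ (U i)) ^ 2 := by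
    rw [Module.finrank_pi_fintype]
    exact Finset.sum_congr rfl fun i _ => by rw [Module.finrank_linearMap, sq]
  rw [← hfr]
  refine lt_of_le_of_ne
    (LinearMap.finrank_le_finrank_of_surjective (f := (AlgHom.pi ρ).toLinearMap) hsurj) ?_
  intro heq
  have hinj' := (LinearMap.injective_iff_surjective_of_finrank_eq_finrank
    (f := (AlgHom.pi ρ).toLinearMap) heq.symm).2 hsurj
  let e1 : A ≃+* ∀ i, Module.End ℂ (U i) := RingEquiv.ofBijective (AlgHom.pi ρ) ⟨hinj', hsurj⟩
  let e2 := RingEquiv.piCongrRight fun i =>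
    (LinearMap.toMatrixAlgEquiv (Module.finBasis ℂ (U i))).toRingEquiv
  exact hns (e1.trans e2).symm.isSemisimpleRing

theorem sum_finrank_le (hρ : ∀ i, Function.Surjective (ρ i))
    (hpos : ∀ i, 0 < Module.finrank ℂ (U i))
    (hinj : Function.Injective fun i => RingHom.ker (ρ i))
    {W : Type*} [AddCommGroup W] [Module ℂ W] [FiniteDimensional ℂ W]
    (σ : A →ₐ[ℂ] Module.End ℂ W) (hσ : ∀ i, RingHom.ker σ ≤ RingHom.ker (ρ i)) :
    ∑ i, Module.finrank ℂ (U i) ≤ Module.finrank ℂ W := by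
  classical
  let I := Σ i, Fin (Module.finrank ℂ (U i))
  let c : I → ℂ := fun j => (Fintype.equivFin I j : ℕ)
  have hc : Function.Injective c := fun a b h =>
    (Fintype.equivFin I).injective (Fin.ext (Nat.cast_injective h))
  let b := fun i => Module.finBasis ℂ (U i)
  obtain ⟨h, hh⟩ := surjective_pi_of_ker_injective hρ hpos hinj
    (fun i => (b i).constr ℂ fun a => c ⟨i, a⟩ • b i a)
  have hh' : ∀ i a, ρ i h (b i a) = c ⟨i, a⟩ • b i a := by
    intro i a
    have := congrArg (fun F => F i (b i a)) hh
    simpa using this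
  have hroot : ∀ j : I, (σ h).charpoly.IsRoot (c j) := by
    rintro ⟨i, a⟩
    have h1 : Polynomial.aeval h (σ h).charpoly ∈ RingHom.ker σ := by
      rw [RingHom.mem_ker, ← Polynomial.aeval_algHom_apply]
      exact LinearMap.aeval_self_charpoly _
    have h2 := hσ i h1
    rw [RingHom.mem_ker, ← Polynomial.aeval_algHom_apply] at h2
    have h3 := Module.End.aeval_apply_of_hasEigenvector (p := (σ h).charpoly)
      (f := ρ i h) (μ := c ⟨i, a⟩) (x := b i a)
      ⟨Module.End.mem_eigenspace_iff.2 (hh' i a), (b i).ne_zero a⟩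
    rw [h2, LinearMap.zero_apply] at h3
    exact (smul_eq_zero.1 h3.symm).resolve_right ((b i).ne_zero a)
  have hcard : Fintype.card I ≤ (σ h).charpoly.natDegree := by
    rw [← Finset.card_univ, ← Finset.card_image_of_injective _ hc]
    refine Polynomial.card_le_degree_of_subset_roots ?_
    intro z hz
    obtain ⟨j, -, rfl⟩ := Finset.mem_image.1 (Finset.mem_def.2 hz)
    exact (Polynomial.mem_roots (LinearMap.charpoly_monic _).ne_zero).2 (hroot j)
  simpa [I, LinearMap.charpoly_natDegree] using hcard

end Family
end SimpleKernels

section SimpleKernels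
variable {A : Type} [Ring A] [Algebra ℂ A]

theorem IsSimpleKernel.of_surjective {U : Type} [AddCommGroup U] [Module ℂ U]
    [FiniteDimensional ℂ U] {ρ : A →ₐ[ℂ] Module.End ℂ U} (hρ : Function.Surjective ρ)
    (hpos : 0 < Module.finrank ℂ U) : IsSimpleKernel (RingHom.ker ρ) (Module.finrank ℂ U) :=
  ⟨U, _, _, ‹_›, ρ, hρ, rfl, hpos, rfl⟩

theorem surjective_lsmul_of_isSimpleModule {V : Type*} [AddCommGroup V] [Module ℂ V] [Module A V]
    [IsScalarTower ℂ A V] [IsSimpleModule A V] [FiniteDimensional ℂ V] :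
    Function.Surjective (Algebra.lsmul ℂ ℂ V : A →ₐ[ℂ] Module.End ℂ V) := by
  classical
  intro f
  let f' : Module.End (Module.End A V) V :=
    { f with
      map_smul' := by
        intro g v
        obtain ⟨c, rfl⟩ :=
          (IsSimpleModule.algebraMap_end_bijective_of_isAlgClosed (A := A) (V := V) ℂ).2 g
        exact f.map_smul c v }
  obtain ⟨r, hr⟩ := jacobson_density (R := A) f' (Finset.univ.image (Module.finBasis ℂ V))
  refine ⟨r, (Module.finBasis ℂ V).ext fun i => ?_⟩
  exact (hr _ (Finset.mem_image_of_mem _ (Finset.mem_univ i))).symm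

/-- The dimension of the irreducible representation with a given kernel. -/
noncomputable def kerDim (K : Ideal A) : ℕ :=
  open Classical in if h : ∃ n, IsSimpleKernel K n then h.choose else 0

theorem IsSimpleKernel.kerDim_eq {K : Ideal A} {n : ℕ} (h : IsSimpleKernel K n) :
    kerDim K = n := by
  have hex : ∃ n, IsSimpleKernel K n := ⟨n, h⟩
  rw [kerDim, dif_pos hex]
  exact hex.choose_spec.unique h

theorem sum_kerDim_sq_lt [FiniteDimensional ℂ A] (hns : ¬ IsSemisimpleRing A)
    (s : Finset (Ideal A)) (hs : ∀ K ∈ s, ∃ n, IsSimpleKernel K n) :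
    ∑ K ∈ s, kerDim K ^ 2 < Module.finrank ℂ A := by
  choose! n U i1 i2 i3 ρ hρ hn hpos hk using hs
  have := @sum_sq_lt_finrank A _ _ s _ (fun K => U K) (fun K => i1 K K.2)
    (fun K => i2 K K.2) (fun K => i3 K K.2) (fun K => ρ K K.2) _ hns (fun K => hρ K K.2)
    (fun K => by rw [hn K K.2]; exact hpos K K.2) (fun K L h => by
      have : (K : Ideal A) = L := by
        rw [← hk K K.2, ← hk L L.2]; exact h
      exact Subtype.ext this)
  rw [← Finset.sum_coe_sort]
  refine lt_of_eq_of_lt (Finset.sum_congr rfl fun K _ => ?_) this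
  rw [IsSimpleKernel.kerDim_eq ⟨U K, _, _, i3 K K.2, ρ K K.2, hρ K K.2, rfl,
    (hn K K.2).symm ▸ hpos K K.2, hk K K.2⟩]

theorem sum_kerDim_le (s : Finset (Ideal A)) (hs : ∀ K ∈ s, ∃ n, IsSimpleKernel K n)
    {W : Type*} [AddCommGroup W] [Module ℂ W] [FiniteDimensional ℂ W]
    (σ : A →ₐ[ℂ] Module.End ℂ W) (hσ : ∀ K ∈ s, RingHom.ker σ ≤ K) :
    ∑ K ∈ s, kerDim K ≤ Module.finrank ℂ W := by
  choose! n U i1 i2 i3 ρ hρ hn hpos hk using hs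
  have := @sum_finrank_le A _ _ s _ (fun K => U K) (fun K => i1 K K.2)
    (fun K => i2 K K.2) (fun K => i3 K K.2) (fun K => ρ K K.2) (fun K => hρ K K.2)
    (fun K => by rw [hn K K.2]; exact hpos K K.2) (fun K L h => by
      have : (K : Ideal A) = L := by
        rw [← hk K K.2, ← hk L L.2]; exact h
      exact Subtype.ext this) W _ _ _ σ (fun K => by rw [hk K K.2]; exact hσ K K.2)
  rw [← Finset.sum_coe_sort]
  refine le_of_eq_of_le (Finset.sum_congr rfl fun K _ => ?_) this
  rw [IsSimpleKernel.kerDim_eq ⟨U K, _, _, i3 K K.2, ρ K K.2, hρ K K.2, rfl,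
    (hn K K.2).symm ▸ hpos K K.2, hk K K.2⟩]

end SimpleKernels

section IdealProducts
variable {A : Type} [Ring A]

/-- Finite nonempty products of members of a set of ideals. -/
inductive IsIdealProd (G : Set (Ideal A)) : Ideal A → Prop
  | base {W : Ideal A} : W ∈ G → IsIdealProd G W
  | mul {P Q : Ideal A} : IsIdealProd G P → IsIdealProd G Q → IsIdealProd G (P * Q)

theorem IsIdealProd.isTwoSided {G : Set (Ideal A)} (hG : ∀ W ∈ G, W.IsTwoSided) {P : Ideal A}
    (hP : IsIdealProd G P) : P.IsTwoSided := by
  induction hP with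
  | base h => exact hG _ h
  | mul _ _ _ _ => infer_instance

theorem exists_isIdealProd_mul_self [Algebra ℂ A] [FiniteDimensional ℂ A] {G : Set (Ideal A)}
    (hG : ∀ W ∈ G, W.IsTwoSided) (hne : G.Nonempty) :
    ∃ J, IsIdealProd G J ∧ J * J = J ∧ ∀ W ∈ G, J ≤ W := by
  have : IsArtinianRing A := IsArtinianRing.of_finite ℂ A
  obtain ⟨W₀, hW₀⟩ := hne
  obtain ⟨J, hJ, hmin⟩ := (wellFounded_lt (α := Ideal A)).has_min {P | IsIdealProd G P}
    ⟨W₀, .base hW₀⟩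
  have := hJ.isTwoSided hG
  have h : ∀ Q, IsIdealProd G Q → J * Q = J := fun Q hQ => by
    have := hQ.isTwoSided hG
    by_contra hne
    exact hmin _ (hJ.mul hQ) (lt_of_le_of_ne Ideal.mul_le_left hne)
  refine ⟨J, hJ, h J hJ, fun W hW => ?_⟩
  have := hG W hW
  rw [← h W (.base hW)]
  exact Ideal.mul_le_right

variable [Algebra ℂ A]

theorem IsIdealProd.mem_of_le {G : Set (Ideal A)} (hG : ∀ W ∈ G, ∃ n, IsSimpleKernel W n)
    {P : Ideal A} (hP : IsIdealProd G P) {X : Ideal A} {n : ℕ} (hX : IsSimpleKernel X n)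
    (hle : P ≤ X) : X ∈ G := by
  have hG' : ∀ W ∈ G, W.IsTwoSided := fun W hW => (hG W hW).choose_spec.isTwoSided
  induction hP with
  | base h =>
    obtain ⟨m, hm⟩ := hG _ h
    exact hX.eq_of_le hm hle ▸ h
  | mul hP hQ ihP ihQ =>
    have := hP.isTwoSided hG'
    have := hQ.isTwoSided hG'
    exact (hX.le_or_le_of_mul_le hle).elim ihP ihQ

theorem le_of_forall_isSimpleKernel_le [FiniteDimensional ℂ A] {J B : Ideal A} [J.IsTwoSided]
    [B.IsTwoSided] (hJ : J * J = J) (h : ∀ K n, IsSimpleKernel K n → B ≤ K → J ≤ K) : J ≤ B := by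
  by_contra hcon
  have : IsNoetherianRing A := IsNoetherianRing.of_finite ℂ A
  have hlt : B < J ⊔ B := lt_of_le_of_ne le_sup_right fun h => hcon (h ▸ le_sup_left)
  obtain ⟨N, hBN, hN⟩ := exists_le_covBy_of_lt hlt
  have hs := (covBy_iff_quot_is_simple hN.le).1 hN
  set Q := (J ⊔ B : Ideal A) ⧸ Submodule.comap (Submodule.subtype (J ⊔ B : Ideal A)) N with hQ
  have hnt : Nontrivial Q := IsSimpleModule.nontrivial A Q
  have hfd : FiniteDimensional ℂ Q := by
    have : Module.Finite A Q := inferInstance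
    exact Module.Finite.trans A Q
  have hker := IsSimpleKernel.of_surjective (surjective_lsmul_of_isSimpleModule (A := A) (V := Q))
    Module.finrank_pos
  have hmem : ∀ x, x ∈ RingHom.ker (Algebra.lsmul ℂ ℂ Q : A →ₐ[ℂ] Module.End ℂ Q) ↔
      ∀ y ∈ J ⊔ B, x * y ∈ N := by
    intro x
    rw [RingHom.mem_ker]
    constructor
    · intro hx y hy
      have h0 : x • (Submodule.Quotient.mk ⟨y, hy⟩ : Q) = 0 :=
        (congrArg (fun F => F (Submodule.Quotient.mk ⟨y, hy⟩)) hx)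
      rw [← Submodule.Quotient.mk_smul, Submodule.Quotient.mk_eq_zero] at h0
      exact h0
    · intro hx
      refine LinearMap.ext fun q => ?_
      obtain ⟨⟨y, hy⟩, rfl⟩ := Submodule.Quotient.mk_surjective _ q
      change x • (Submodule.Quotient.mk ⟨y, hy⟩ : Q) = 0
      rw [← Submodule.Quotient.mk_smul, Submodule.Quotient.mk_eq_zero]
      exact hx y hy
  have hJN : J ≤ N := by
    rw [← hJ, Ideal.mul_le]
    intro x hx y hy
    refine (hmem x).1 (h _ _ hker (fun b hb => (hmem b).2 fun z _ => ?_) hx) y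
      (le_sup_left (α := Ideal A) hy)
    exact hBN (B.mul_mem_right _ hb)
  exact absurd hN.lt (not_lt_of_ge (sup_le hJN hBN))

end IdealProducts

section DualIdeal
variable {H : Type} [Ring H] [HopfAlgebra ℂ H]

local notation "S" => HopfAlgebra.antipode ℂ (A := H)

/-- The preimage of a two-sided ideal under the antipode. -/
noncomputable def dualIdeal (K : Ideal H) : Ideal H where
  carrier := {x | ∀ y, S x * y ∈ K}
  add_mem' {a b} ha hb y := by rw [map_add, add_mul]; exact K.add_mem (ha y) (hb y)
  zero_mem' y := by simp
  smul_mem' c x hx y := by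
    rw [smul_eq_mul, HopfAlgebra.antipode_mul_antidistrib, mul_assoc]
    exact hx _

theorem mem_dualIdeal {K : Ideal H} [K.IsTwoSided] {x : H} : x ∈ dualIdeal K ↔ S x ∈ K :=
  ⟨fun h => by simpa using h 1, fun h y => K.mul_mem_right y h⟩

theorem bijective_transpose {U : Type*} [AddCommGroup U] [Module ℂ U] [FiniteDimensional ℂ U] :
    Function.Bijective (Module.Dual.transpose (R := ℂ) (M := U) (M' := U)) := by
  have hinj : Function.Injective (Module.Dual.transpose (R := ℂ) (M := U) (M' := U)) := by
    rw [injective_iff_map_eq_zero]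
    intro f hf
    refine LinearMap.ext fun u => ?_
    refine (Module.forall_dual_apply_eq_zero_iff ℂ _).1 fun φ => ?_
    exact congrArg (fun F => F φ u) hf
  exact ⟨hinj, (LinearMap.injective_iff_surjective_of_finrank_eq_finrank (by
    simp [Module.finrank_linearMap, Subspace.dual_finrank_eq])).1 hinj⟩

/-- The representation on the dual space, through the antipode. -/
noncomputable def dualRep {U : Type*} [AddCommGroup U] [Module ℂ U]
    (ρ : H →ₐ[ℂ] Module.End ℂ U) : H →ₐ[ℂ] Module.End ℂ (Module.Dual ℂ U) :=
  AlgHom.ofLinearMap (Module.Dual.transpose ∘ₗ ρ.toLinearMap ∘ₗ S)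
    (by ext; simp [HopfAlgebra.antipode_one, Module.Dual.transpose_apply])
    (fun x y => by
      ext
      simp [HopfAlgebra.antipode_mul_antidistrib, Module.Dual.transpose_apply])

theorem dualRep_apply {U : Type*} [AddCommGroup U] [Module ℂ U]
    (ρ : H →ₐ[ℂ] Module.End ℂ U) (x : H) :
    dualRep ρ x = Module.Dual.transpose (R := ℂ) (ρ (S x)) := rfl

theorem ker_dualRep {U : Type*} [AddCommGroup U] [Module ℂ U] [FiniteDimensional ℂ U]
    (ρ : H →ₐ[ℂ] Module.End ℂ U) : RingHom.ker (dualRep ρ) = dualIdeal (RingHom.ker ρ) := by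
  ext x
  rw [mem_dualIdeal, RingHom.mem_ker, RingHom.mem_ker, dualRep_apply,
    map_eq_zero_iff _ bijective_transpose.1]

variable [FiniteDimensional ℂ H]

theorem surjective_dualRep [Nontrivial H] {U : Type*} [AddCommGroup U] [Module ℂ U]
    [FiniteDimensional ℂ U]
    {ρ : H →ₐ[ℂ] Module.End ℂ U} (hρ : Function.Surjective ρ) :
    Function.Surjective (dualRep ρ) :=
  bijective_transpose.2.comp (hρ.comp (antipode_bijective ℂ H).2)

theorem IsSimpleKernel.dualIdeal {K : Ideal H} {n : ℕ} (h : IsSimpleKernel K n) :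
    IsSimpleKernel (dualIdeal K) n := by
  obtain ⟨U, _, _, _, ρ, hρ, rfl, hn, rfl⟩ := h
  have := Module.finrank_pos_iff.1 hn
  have := RingHom.domain_nontrivial ρ.toRingHom
  exact ⟨_, _, _, inferInstance, dualRep ρ, surjective_dualRep hρ, Subspace.dual_finrank_eq, hn,
    ker_dualRep ρ⟩

end DualIdeal

section Twists
variable {H : Type} [Ring H] [HopfAlgebra ℂ H]

local notation "S" => HopfAlgebra.antipode ℂ (A := H)

/-- Pairs of characters act on the left ideals. -/
noncomputable instance characterMulAction :
    MulAction (WithConv (H →ₐ[ℂ] ℂ) × WithConv (H →ₐ[ℂ] ℂ)) (Ideal H) where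
  smul g K := K.comap (biTwist g⁻¹)
  one_smul K := by
    ext x
    change biTwist (1 : WithConv (H →ₐ[ℂ] ℂ) × WithConv (H →ₐ[ℂ] ℂ))⁻¹ x ∈ K ↔ _
    rw [inv_one, map_one]; rfl
  mul_smul g g' K := by
    ext x
    change biTwist (g * g')⁻¹ x ∈ K ↔ biTwist g'⁻¹ (biTwist g⁻¹ x) ∈ K
    rw [mul_inv_rev, map_mul]; rfl

variable {g : WithConv (H →ₐ[ℂ] ℂ) × WithConv (H →ₐ[ℂ] ℂ)} {K : Ideal H}

theorem mem_character_smul {x : H} : x ∈ g • K ↔ biTwist g⁻¹ x ∈ K := Iff.rfl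

theorem surjective_biTwist (g : WithConv (H →ₐ[ℂ] ℂ) × WithConv (H →ₐ[ℂ] ℂ)) :
    Function.Surjective (biTwist g) := fun x => ⟨_, biTwist_apply_inv_apply g x⟩

theorem IsSimpleKernel.smul {n : ℕ} (h : IsSimpleKernel K n) : IsSimpleKernel (g • K) n :=
  h.comap (biTwist g⁻¹) (surjective_biTwist _)

theorem character_smul_mono {L : Ideal H} (h : K ≤ L) : g • K ≤ g • L := fun _ hx => h hx

theorem smul_dualIdeal [K.IsTwoSided] : g • dualIdeal K = dualIdeal (g.swap • K) := by
  have : (g.swap • K).IsTwoSided := inferInstanceAs (K.comap (biTwist g.swap⁻¹)).IsTwoSided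
  ext x
  rw [mem_character_smul, mem_dualIdeal, mem_dualIdeal, mem_character_smul, biTwist_antipode]
  rfl

variable [FiniteDimensional ℂ H]

theorem IsSimpleKernel.dvd_of_comap_rightTwist {n : ℕ} (hK : IsSimpleKernel K n)
    {χ : WithConv (H →ₐ[ℂ] ℂ)} (hχ : (orderOf χ).Prime)
    (h : K.comap (rightTwist χ.ofConv) = K) : orderOf χ ∣ n := by
  obtain ⟨U, _, _, _, ρ, hρ, rfl, hn, rfl⟩ := hK
  have := Module.finrank_pos_iff.1 hn
  have hinv : ∀ x, rightTwist χ.ofConv (rightTwist (χ⁻¹).ofConv x) = x := fun x => by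
    rw [← rightTwist_mul, mul_inv_cancel, rightTwist_one]
  have hsurj : Function.Surjective (ρ.comp (rightTwist χ.ofConv)) :=
    hρ.comp fun x => ⟨_, hinv x⟩
  obtain ⟨T, hT⟩ := exists_linearEquiv_of_ker_eq hρ hsurj (h.symm.trans (by
    ext x; simp [RingHom.mem_ker]))
  have hpow : ∀ i : ℕ, ∀ x, (T.toLinearMap ^ i) * ρ x =
      ρ (rightTwist (χ ^ i).ofConv x) * (T.toLinearMap ^ i) := by
    intro i
    induction i with
    | zero => intro x; simp [rightTwist_one]
    | succ i ih =>
      intro x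
      have hT' : T.toLinearMap * ρ x = ρ (rightTwist χ.ofConv x) * T.toLinearMap :=
        LinearMap.ext fun u => (hT x u).symm
      rw [pow_succ, mul_assoc, hT', ← mul_assoc, ih, pow_succ, rightTwist_mul, mul_assoc]
  obtain ⟨c, hc⟩ : ∃ c : ℂ, T.toLinearMap ^ orderOf χ = algebraMap ℂ _ c := by
    have hmem : T.toLinearMap ^ orderOf χ ∈ Subalgebra.center ℂ (Module.End ℂ U) := by
      rw [Subalgebra.mem_center_iff]
      intro b
      obtain ⟨x, rfl⟩ := hρ b
      rw [hpow, pow_orderOf_eq_one, rightTwist_one]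
    rw [Algebra.IsCentral.center_eq_bot] at hmem
    obtain ⟨c, hc⟩ := Algebra.mem_bot.1 hmem
    exact ⟨c, hc.symm⟩
  have hc0 : c ≠ 0 := by
    rintro rfl
    obtain ⟨u, hu⟩ := exists_ne (0 : U)
    have hinj : ∀ i : ℕ, (T.toLinearMap ^ i) u ≠ 0 := by
      intro i
      induction i with
      | zero => simpa using hu
      | succ i ih =>
        rw [pow_succ', Module.End.mul_apply]
        exact (T.map_ne_zero_iff).2 ih
    exact hinj _ (by rw [hc]; simp)
  obtain ⟨μ, hμ⟩ := IsAlgClosed.exists_pow_nat_eq c⁻¹ hχ.pos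
  set φ := μ • T.toLinearMap with hφ
  have hφr : φ ^ orderOf χ = 1 := by
    rw [hφ, smul_pow, hc, hμ, Algebra.smul_def, ← map_mul, inv_mul_cancel₀ hc0, map_one]
  have htr : ∀ i : ℕ, φ ^ i ≠ 1 → LinearMap.trace ℂ U (φ ^ i) = 0 := by
    intro i hi
    have hχi : χ ^ i ≠ 1 := by
      intro h1
      obtain ⟨j, rfl⟩ := orderOf_dvd_of_pow_eq_one h1
      exact hi (by rw [pow_mul, hφr, one_pow])
    have h2 := trace_mul_finrank_eq ρ (χ ^ i).ofConv (φ ^ i) (fun x => by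
      rw [hφ, smul_pow, smul_mul_assoc, hpow, mul_smul_comm])
    rw [trace_rightTwist hχi, mul_zero] at h2
    refine (mul_eq_zero.1 h2).resolve_right ?_
    have : Nontrivial H := RingHom.domain_nontrivial χ.ofConv.toRingHom
    exact_mod_cast (Module.finrank_pos (R := ℂ) (M := H)).ne'
  let u : (Module.End ℂ U)ˣ := Units.ofPowEqOne φ (orderOf χ) hφr hχ.pos.ne'
  have hu : (u : Module.End ℂ U) = φ := rfl
  have huo : orderOf u = orderOf χ := by
    refine orderOf_eq_prime_iff (hp := ⟨hχ⟩) |>.2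
      ⟨Units.ext (by rw [Units.val_pow_eq_pow_val]; exact hφr), fun h1 => ?_⟩
    have h1' : φ = 1 := by rw [← hu, h1, Units.val_one]
    have hχ1 : χ ≠ 1 := fun h => by simp [h, Nat.not_prime_one] at hχ
    have h2 := trace_mul_finrank_eq ρ χ.ofConv φ (fun x => by
      have := hpow 1 x
      simp only [pow_one] at this
      rw [hφ, smul_mul_assoc, this, mul_smul_comm])
    have : Nontrivial H := RingHom.domain_nontrivial χ.ofConv.toRingHom
    rw [trace_rightTwist hχ1, mul_zero, h1', LinearMap.trace_one] at h2
    have h3 : (Module.finrank ℂ U : ℂ) ≠ 0 := by exact_mod_cast hn.ne'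
    have h4 : (Module.finrank ℂ H : ℂ) ≠ 0 := by
      exact_mod_cast (Module.finrank_pos (R := ℂ) (M := H)).ne'
    exact (mul_ne_zero h3 h4) h2
  have hfin : Finite (Subgroup.zpowers u) :=
    Nat.finite_of_card_ne_zero (by rw [Nat.card_zpowers, huo]; exact hχ.pos.ne')
  have hfo : IsOfFinOrder u := orderOf_pos_iff.1 (huo ▸ hχ.pos)
  rw [← huo, ← Nat.card_zpowers]
  refine card_dvd_finrank_of_trace ((Units.coeHom _).comp (Subgroup.zpowers u).subtype) ?_
  rintro ⟨g, hg⟩ hg1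
  obtain ⟨i, rfl⟩ := (IsOfFinOrder.mem_powers_iff_mem_zpowers hfo).2 hg
  change LinearMap.trace ℂ U (u ^ i : (Module.End ℂ U)ˣ) = 0
  rw [Units.val_pow_eq_pow_val]
  refine htr i fun h1 => hg1 (Subtype.ext (Units.ext ?_))
  exact (Units.val_pow_eq_pow_val u i).trans h1

theorem IsSimpleKernel.dvd_of_comap_leftTwist {n : ℕ} (hK : IsSimpleKernel K n)
    {χ : WithConv (H →ₐ[ℂ] ℂ)} (hχ : (orderOf χ).Prime)
    (h : K.comap (leftTwist χ.ofConv) = K) : orderOf χ ∣ n := by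
  have := hK.isTwoSided
  rw [← orderOf_inv]
  refine hK.dualIdeal.dvd_of_comap_rightTwist (by rwa [orderOf_inv]) ?_
  ext x
  rw [Ideal.mem_comap, mem_dualIdeal, mem_dualIdeal, ← leftTwist_antipode, ← Ideal.mem_comap, h]

end Twists

section Wedge
variable {H : Type} [Ring H] [HopfAlgebra ℂ H]

local notation "i₁" => (Algebra.TensorProduct.includeLeft : H →ₐ[ℂ] H ⊗[ℂ] H)
local notation "i₂" => (Algebra.TensorProduct.includeRight : H →ₐ[ℂ] H ⊗[ℂ] H)

theorem ker_mkₐ (A : Ideal H) [A.IsTwoSided] : RingHom.ker (Ideal.Quotient.mkₐ ℂ A) = A :=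
  Ideal.Quotient.mkₐ_ker ℂ A

instance isTwoSided_map_includeLeft (A : Ideal H) [A.IsTwoSided] : (A.map i₁).IsTwoSided := by
  have h := Algebra.TensorProduct.rTensor_ker (R := ℂ) (C := H) _
    (Ideal.Quotient.mkₐ_surjective ℂ A)
  rw [ker_mkₐ] at h
  rw [← h]
  infer_instance

instance isTwoSided_map_includeRight (A : Ideal H) [A.IsTwoSided] : (A.map i₂).IsTwoSided := by
  have h := Algebra.TensorProduct.lTensor_ker (R := ℂ) (A := H) _
    (Ideal.Quotient.mkₐ_surjective ℂ A)
  rw [ker_mkₐ] at h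
  rw [← h]
  infer_instance

theorem Ideal.isTwoSided_sup {R : Type*} [Ring R] (I J : Ideal R) [I.IsTwoSided] [J.IsTwoSided] :
    (I ⊔ J).IsTwoSided := ⟨fun b h => by
  obtain ⟨x, hx, y, hy, rfl⟩ := Submodule.mem_sup.1 h
  rw [add_mul]
  exact Submodule.mem_sup.2 ⟨_, I.mul_mem_right _ hx, _, J.mul_mem_right _ hy, rfl⟩⟩

/-- The preimage of `A ⊗ H + H ⊗ B` under comultiplication. -/
noncomputable def wedge (A B : Ideal H) : Ideal H :=
  (A.map i₁ ⊔ B.map i₂).comap (Bialgebra.comulAlgHom ℂ H)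

instance isTwoSided_wedge (A B : Ideal H) [A.IsTwoSided] [B.IsTwoSided] :
    (wedge A B).IsTwoSided := by
  have := Ideal.isTwoSided_sup (A.map i₁) (B.map i₂)
  unfold wedge
  infer_instance

theorem mem_wedge {A B : Ideal H} {x : H} :
    x ∈ wedge A B ↔ comul (R := ℂ) x ∈ A.map i₁ ⊔ B.map i₂ := Iff.rfl

theorem mem_wedge_ker {X Y : Type*} [Ring X] [Algebra ℂ X] [Ring Y] [Algebra ℂ Y]
    {f : H →ₐ[ℂ] X} {g : H →ₐ[ℂ] Y} (hf : Function.Surjective f) (hg : Function.Surjective g)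
    {x : H} : x ∈ wedge (RingHom.ker f) (RingHom.ker g) ↔
      Algebra.TensorProduct.map f g (comul (R := ℂ) x) = 0 := by
  rw [mem_wedge, ← Algebra.TensorProduct.map_ker (R := ℂ) (S := ℂ) f g hf hg, RingHom.mem_ker]

theorem Ideal.map_mul_map_le {R T F : Type*} [Ring R] [Ring T] [FunLike F R T]
    [RingHomClass F R T] (f : F) (A B : Ideal R) [(A.map f).IsTwoSided] :
    A.map f * B.map f ≤ (A * B).map f := by
  rw [Ideal.mul_le]
  intro u hu v hv
  rw [Ideal.map] at hv
  induction hv using Submodule.span_induction generalizing u with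
  | zero => simp
  | add v w _ _ hv hw => rw [mul_add]; exact Ideal.add_mem _ (hv u hu) (hw u hu)
  | smul c v _ hv =>
    rw [smul_eq_mul, ← mul_assoc]
    exact hv _ (Ideal.mul_mem_right _ _ hu)
  | mem v hv =>
    obtain ⟨z, hz, rfl⟩ := hv
    rw [Ideal.map] at hu
    induction hu using Submodule.span_induction with
    | zero => simp
    | add v w _ _ hv hw => rw [add_mul]; exact Ideal.add_mem _ hv hw
    | smul c v _ hv => rw [smul_mul_assoc]; exact Ideal.mul_mem_left _ _ hv
    | mem v hv =>
      obtain ⟨w, hw, rfl⟩ := hv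
      rw [← map_mul]
      exact Ideal.mem_map_of_mem _ (Ideal.mul_mem_mul hw hz)

theorem Ideal.sup_mul_sup_le {R : Type*} [Ring R] (I J K : Ideal R) [K.IsTwoSided] :
    (I ⊔ K) * (J ⊔ K) ≤ I * J ⊔ K := by
  rw [Ideal.mul_le]
  intro x hx y hy
  obtain ⟨a, ha, b, hb, rfl⟩ := Submodule.mem_sup.1 hx
  obtain ⟨a', ha', b', hb', rfl⟩ := Submodule.mem_sup.1 hy
  rw [add_mul, mul_add, add_assoc]
  exact Ideal.add_mem _ (Ideal.mem_sup_left (Ideal.mul_mem_mul ha ha')) (Ideal.mem_sup_right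
    (Ideal.add_mem _ (Ideal.mul_mem_left _ _ hb') (Ideal.mul_mem_right _ _ hb)))

theorem wedge_mul_left (A₁ A₂ B : Ideal H) [A₁.IsTwoSided] [B.IsTwoSided] :
    wedge A₁ B * wedge A₂ B ≤ wedge (A₁ * A₂) B := by
  rw [Ideal.mul_le]
  intro x hx y hy
  rw [mem_wedge, Bialgebra.comul_mul]
  exact sup_le_sup_right (Ideal.map_mul_map_le i₁ A₁ A₂) _
    (Ideal.sup_mul_sup_le _ _ _ (Ideal.mul_mem_mul (mem_wedge.1 hx) (mem_wedge.1 hy)))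

theorem wedge_mul_right (A B₁ B₂ : Ideal H) [A.IsTwoSided] [B₁.IsTwoSided] :
    wedge A B₁ * wedge A B₂ ≤ wedge A (B₁ * B₂) := by
  rw [Ideal.mul_le]
  intro x hx y hy
  rw [mem_wedge, sup_comm] at hx hy
  rw [mem_wedge, Bialgebra.comul_mul, sup_comm]
  exact sup_le_sup_right (Ideal.map_mul_map_le i₂ B₁ B₂) _
    (Ideal.sup_mul_sup_le _ _ _ (Ideal.mul_mem_mul hx hy))

theorem rTensor_rightHit_comul (f : H →ₗ[ℂ] ℂ) (x : H) :
    (rightHit f).rTensor H (comul (R := ℂ) x) = (leftHit f).lTensor H (comul (R := ℂ) x) := by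
  have h := congrArg (fun v =>
    (LinearMap.lTensor H ((TensorProduct.lid ℂ H).toLinearMap ∘ₗ f.rTensor H))
    v) (Coalgebra.coassoc_apply (R := ℂ) x)
  rw [← LinearMap.comp_apply (LinearMap.lTensor H _), ← LinearMap.lTensor_comp] at h
  refine Eq.trans ?_ h
  rw [← (ℛ ℂ x).eq]
  simp only [map_sum, LinearMap.rTensor_tmul]
  refine Finset.sum_congr rfl fun i _ => ?_
  rw [rightHit_repr f (ℛ ℂ ((ℛ ℂ x).left i)), ← (ℛ ℂ ((ℛ ℂ x).left i)).eq]
  simp [TensorProduct.sum_tmul, TensorProduct.smul_tmul]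

theorem map_biTwist_comul (χ β γ : WithConv (H →ₐ[ℂ] ℂ)) (x : H) :
    Algebra.TensorProduct.map (biTwist (χ, β)) (biTwist (β, γ)) (comul (R := ℂ) x) =
      comul (R := ℂ) (biTwist (χ, γ) x) := by
  have h1 : comul (R := ℂ) (biTwist (χ, γ) x) = TensorProduct.map
      (leftTwist (χ⁻¹).ofConv).toLinearMap (rightTwist γ.ofConv).toLinearMap
      (comul (R := ℂ) x) := by
    rw [biTwist_apply, leftTwist_apply, rightTwist_apply, comul_leftHit, comul_rightHit,
      ← LinearMap.comp_apply, LinearMap.rTensor_comp_lTensor]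
    rfl
  have h2 : TensorProduct.map (rightTwist β.ofConv).toLinearMap (leftTwist (β⁻¹).ofConv).toLinearMap
      (comul (R := ℂ) x) = comul (R := ℂ) x := by
    have h3 : TensorProduct.map (rightTwist β.ofConv).toLinearMap
        (leftTwist (β⁻¹).ofConv).toLinearMap =
      (leftTwist (β⁻¹).ofConv).toLinearMap.lTensor H ∘ₗ (rightHit β.ofConv.toLinearMap).rTensor H :=
        (LinearMap.lTensor_comp_rTensor _ _ _).symm
    rw [h3, LinearMap.comp_apply, rTensor_rightHit_comul, ← LinearMap.comp_apply,
      ← LinearMap.lTensor_comp]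
    have h4 : (leftTwist (β⁻¹).ofConv).toLinearMap ∘ₗ leftHit β.ofConv.toLinearMap = .id := by
      ext y
      exact (leftTwist_mul β β⁻¹ y).symm.trans (by rw [mul_inv_cancel, leftTwist_one]; rfl)
    rw [h4, LinearMap.lTensor_id, LinearMap.id_apply]
  rw [h1]
  conv_rhs => rw [← h2]
  rw [← LinearMap.comp_apply, ← TensorProduct.map_comp]
  change TensorProduct.map (biTwist (χ, β)).toLinearMap (biTwist (β, γ)).toLinearMap _ = _
  congr 2
  ext y
  exact leftTwist_rightTwist _ _ _

theorem wedge_smul (A B : Ideal H) [A.IsTwoSided] [B.IsTwoSided]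
    (χ β γ : WithConv (H →ₐ[ℂ] ℂ)) :
    wedge ((χ, β) • A) ((β, γ) • B) = (χ, γ) • wedge A B := by
  have h : ∀ (g : WithConv (H →ₐ[ℂ] ℂ) × WithConv (H →ₐ[ℂ] ℂ)) (C : Ideal H) [C.IsTwoSided],
      g • C = RingHom.ker ((Ideal.Quotient.mkₐ ℂ C).comp (biTwist g⁻¹)) := by
    intro g C _
    ext x
    rw [mem_character_smul, RingHom.mem_ker, AlgHom.comp_apply, Ideal.Quotient.mkₐ_eq_mk,
      Ideal.Quotient.eq_zero_iff_mem]
  ext x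
  have hs := fun (C : Ideal H) [C.IsTwoSided] => Ideal.Quotient.mkₐ_surjective ℂ C
  rw [h, h, mem_wedge_ker (f := (Ideal.Quotient.mkₐ ℂ A).comp (biTwist (χ, β)⁻¹))
    (g := (Ideal.Quotient.mkₐ ℂ B).comp (biTwist (β, γ)⁻¹)) ((hs A).comp (surjective_biTwist _))
    ((hs B).comp (surjective_biTwist _)), mem_character_smul]
  have hw := mem_wedge_ker (hs A) (hs B) (x := biTwist (χ, γ)⁻¹ x)
  rw [ker_mkₐ, ker_mkₐ] at hw
  rw [hw, Algebra.TensorProduct.map_comp, AlgHom.comp_apply]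
  have := map_biTwist_comul χ⁻¹ β⁻¹ γ⁻¹ x
  rw [show ((χ, γ) : WithConv (H →ₐ[ℂ] ℂ) × WithConv (H →ₐ[ℂ] ℂ))⁻¹ = (χ⁻¹, γ⁻¹) from rfl, ← this]
  rfl

/-- The tensor product of two representations. -/
noncomputable def tensorRep {U W : Type*} [AddCommGroup U] [Module ℂ U] [AddCommGroup W]
    [Module ℂ W] (ρ : H →ₐ[ℂ] Module.End ℂ U) (σ : H →ₐ[ℂ] Module.End ℂ W) :
    H →ₐ[ℂ] Module.End ℂ (U ⊗[ℂ] W) :=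
  (Module.endTensorEndAlgHom (R := ℂ) (S := ℂ) (A := ℂ)).comp
    ((Algebra.TensorProduct.map ρ σ).comp (Bialgebra.comulAlgHom ℂ H))

theorem ker_tensorRep {U W : Type*} [AddCommGroup U] [Module ℂ U] [FiniteDimensional ℂ U]
    [AddCommGroup W] [Module ℂ W] [FiniteDimensional ℂ W]
    {ρ : H →ₐ[ℂ] Module.End ℂ U} {σ : H →ₐ[ℂ] Module.End ℂ W} (hρ : Function.Surjective ρ)
    (hσ : Function.Surjective σ) :
    RingHom.ker (tensorRep ρ σ) = wedge (RingHom.ker ρ) (RingHom.ker σ) := by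
  have hinj : Function.Injective
      (Module.endTensorEndAlgHom (R := ℂ) (S := ℂ) (A := ℂ) (M := U) (N := W)) := by
    have h : ∀ z, Module.endTensorEndAlgHom (R := ℂ) (S := ℂ) (A := ℂ) (M := U) (N := W) z =
        homTensorHomEquiv ℂ U W U W z := by
      intro z
      rw [homTensorHomEquiv_apply]
      rfl
    intro y z hyz
    rw [h, h] at hyz
    exact (homTensorHomEquiv ℂ U W U W).injective hyz
  ext x
  rw [mem_wedge_ker hρ hσ, RingHom.mem_ker]
  exact map_eq_zero_iff _ hinj

theorem sum_kerDim_le_of_wedge {A B : Ideal H} {a b : ℕ} (hA : IsSimpleKernel A a)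
    (hB : IsSimpleKernel B b) (s : Finset (Ideal H))
    (hs : ∀ K ∈ s, (∃ n, IsSimpleKernel K n) ∧ wedge A B ≤ K) :
    ∑ K ∈ s, kerDim K ≤ a * b := by
  obtain ⟨U, _, _, _, ρ, hρ, rfl, -, rfl⟩ := hA
  obtain ⟨W, _, _, _, σ, hσ, rfl, -, rfl⟩ := hB
  rw [← Module.finrank_tensorProduct]
  refine sum_kerDim_le s (fun K hK => (hs K hK).1) (tensorRep ρ σ) fun K hK => ?_
  rw [ker_tensorRep hρ hσ]
  exact (hs K hK).2

/-- Simple kernels above a wedge of products of members of `G` are in `G` once this holds for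
members of `G`. -/
theorem mem_of_wedge_le_of_isIdealProd {G : Set (Ideal H)}
    (hG : ∀ W ∈ G, ∃ n, IsSimpleKernel W n)
    (h : ∀ A ∈ G, ∀ B ∈ G, ∀ X n, IsSimpleKernel X n → wedge A B ≤ X → X ∈ G)
    {P Q : Ideal H} (hP : IsIdealProd G P) (hQ : IsIdealProd G Q) {X : Ideal H} {n : ℕ}
    (hX : IsSimpleKernel X n) (hle : wedge P Q ≤ X) : X ∈ G := by
  have hG' : ∀ W ∈ G, W.IsTwoSided := fun W hW => (hG W hW).choose_spec.isTwoSided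
  have := hQ.isTwoSided hG'
  induction hP with
  | mul hP₁ hP₂ ih₁ ih₂ =>
    have := hP₁.isTwoSided hG'
    have := hP₂.isTwoSided hG'
    exact (hX.le_or_le_of_mul_le ((wedge_mul_left _ _ _).trans hle)).elim ih₁ ih₂
  | base hW =>
    have := hG' _ hW
    induction hQ with
    | base hW' => exact h _ hW _ hW' X n hX hle
    | mul hQ₁ hQ₂ ih₁ ih₂ =>
      have := hQ₁.isTwoSided hG'
      have := hQ₂.isTwoSided hG'
      exact (hX.le_or_le_of_mul_le ((wedge_mul_right _ _ _).trans hle)).elim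
        (fun h => ih₁ ‹_› h) (fun h => ih₂ ‹_› h)

end Wedge

section Orbits

theorem injective_smul_of_prime_card {G Γ X : Type*} [Group G] [Group Γ] [MulAction Γ X]
    (hG : (Nat.card G).Prime) (φ : G →* Γ) {x : X} {g : G} (h : φ g • x ≠ x) :
    Function.Injective fun g => φ g • x := by
  have := Fact.mk hG
  rcases Subgroup.eq_bot_or_eq_top_of_prime_card ((MulAction.stabilizer Γ x).comap φ) with hb | ht
  · intro a b hab
    have : a⁻¹ * b ∈ (MulAction.stabilizer Γ x).comap φ := by
      rw [Subgroup.mem_comap, MulAction.mem_stabilizer_iff, map_mul, mul_smul]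
      change φ a • x = φ b • x at hab
      rw [← hab, ← mul_smul, ← map_mul, inv_mul_cancel, map_one, one_smul]
    rw [hb, Subgroup.mem_bot] at this
    exact (inv_mul_eq_one.1 this)
  · have : g ∈ (MulAction.stabilizer Γ x).comap φ := ht ▸ Subgroup.mem_top g
    exact absurd this h

theorem smul_eq_of_prime_card {G Γ X : Type*} [Group G] [Group Γ] [MulAction Γ X]
    (hG : (Nat.card G).Prime) (φ : G →* Γ) {x : X} {g : G} (hg : g ≠ 1) (h : φ g • x = x)
    (g' : G) : φ g' • x = x := by
  by_contra hne
  refine hg (injective_smul_of_prime_card hG φ hne ?_)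
  change φ g • x = φ 1 • x
  rw [h, map_one, one_smul]

end Orbits

section CharacterKernels
variable {H : Type} [Ring H] [HopfAlgebra ℂ H]

/-- The kernel of a character, as an ideal. -/
def characterKer (χ : WithConv (H →ₐ[ℂ] ℂ)) : Ideal H := RingHom.ker χ.ofConv

theorem mem_characterKer {χ : WithConv (H →ₐ[ℂ] ℂ)} {x : H} :
    x ∈ characterKer χ ↔ χ.ofConv x = 0 := Iff.rfl

theorem isSimpleKernel_characterKer (χ : WithConv (H →ₐ[ℂ] ℂ)) :
    IsSimpleKernel (characterKer χ) 1 := by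
  refine ⟨ℂ, inferInstance, inferInstance, inferInstance,
    (Algebra.lmul ℂ ℂ).comp χ.ofConv, fun f => ?_, Module.finrank_self ℂ, one_pos, ?_⟩
  · refine ⟨algebraMap ℂ H (f 1), LinearMap.ext_ring ?_⟩
    rw [AlgHom.comp_apply, AlgHom.commutes]
    simp
  · ext x
    rw [RingHom.mem_ker, mem_characterKer, AlgHom.comp_apply]
    exact map_eq_zero_iff _ Algebra.lmul_injective

theorem IsSimpleKernel.exists_characterKer {K : Ideal H} (h : IsSimpleKernel K 1) :
    ∃ χ, characterKer χ = K := by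
  obtain ⟨U, _, _, _, ρ, hρ, hU, -, rfl⟩ := h
  have he : Function.Bijective (algebraMap ℂ (Module.End ℂ U)) := by
    have : Nontrivial U := Module.nontrivial_of_finrank_pos (R := ℂ) (by omega)
    refine ⟨FaithfulSMul.algebraMap_injective ℂ (Module.End ℂ U), fun f => ?_⟩
    obtain ⟨c, -, hc⟩ := finrank_eq_one_iff'.1 hU
    obtain ⟨a, ha⟩ := hc (f c)
    refine ⟨a, LinearMap.ext fun w => ?_⟩
    obtain ⟨b, rfl⟩ := hc w
    rw [Module.algebraMap_end_apply, map_smul, ← ha, smul_comm]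
  let e := AlgEquiv.ofBijective (Algebra.ofId ℂ (Module.End ℂ U)) he
  refine ⟨toConv ((e.symm : Module.End ℂ U →ₐ[ℂ] ℂ).comp ρ), ?_⟩
  ext x
  rw [mem_characterKer, RingHom.mem_ker]
  exact map_eq_zero_iff _ e.symm.injective

theorem characterKer_injective :
    Function.Injective (characterKer : WithConv (H →ₐ[ℂ] ℂ) → Ideal H) := by
  intro χ β h
  refine WithConv.ofConv_injective (AlgHom.ext fun x => ?_)
  have hx : x - algebraMap ℂ H (χ.ofConv x) ∈ characterKer χ := by
    rw [mem_characterKer, map_sub, AlgHom.commutes]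
    exact sub_self _
  rw [h, mem_characterKer, map_sub, AlgHom.commutes, sub_eq_zero] at hx
  exact hx.symm

theorem smul_characterKer (β γ χ : WithConv (H →ₐ[ℂ] ℂ)) :
    (β, γ) • characterKer χ = characterKer (β * χ * γ⁻¹) := by
  ext x
  rw [mem_character_smul, mem_characterKer, mem_characterKer, ofConv_mul_apply, ofConv_mul_apply',
    biTwist_apply]
  simp only [Prod.fst_inv, Prod.snd_inv, inv_inv]

/-- Invariance under twisting on both sides by the same character. -/
def IsDiagFixed (K : Ideal H) : Prop := ∀ g : WithConv (H →ₐ[ℂ] ℂ), (g, g) • K = K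

theorem isDiagFixed_of_ne_one (hG : (Nat.card (WithConv (H →ₐ[ℂ] ℂ))).Prime) {K : Ideal H}
    {α : WithConv (H →ₐ[ℂ] ℂ)} (hα : α ≠ 1) (h : (α, α) • K = K) : IsDiagFixed K :=
  smul_eq_of_prime_card hG ((MonoidHom.id _).prod (MonoidHom.id _)) hα h

theorem injective_diag_smul (hG : (Nat.card (WithConv (H →ₐ[ℂ] ℂ))).Prime) {K : Ideal H}
    (h : ¬ IsDiagFixed K) :
    Function.Injective fun g : WithConv (H →ₐ[ℂ] ℂ) => (g, g) • K := by
  obtain ⟨g, hg⟩ := not_forall.1 h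
  exact injective_smul_of_prime_card hG ((MonoidHom.id _).prod (MonoidHom.id _)) hg

theorem character_mul_comm (hG : (Nat.card (WithConv (H →ₐ[ℂ] ℂ))).Prime)
    (a b : WithConv (H →ₐ[ℂ] ℂ)) : a * b = b * a := by
  have := Fact.mk hG
  have := isCyclic_of_prime_card (α := WithConv (H →ₐ[ℂ] ℂ)) rfl
  exact IsCyclic.commGroup.mul_comm a b

theorem isDiagFixed_characterKer (hG : (Nat.card (WithConv (H →ₐ[ℂ] ℂ))).Prime)
    (χ : WithConv (H →ₐ[ℂ] ℂ)) : IsDiagFixed (characterKer χ) := by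
  intro g
  rw [smul_characterKer, character_mul_comm hG g, mul_inv_cancel_right]

theorem IsDiagFixed.smul (hG : (Nat.card (WithConv (H →ₐ[ℂ] ℂ))).Prime) {K : Ideal H}
    (h : IsDiagFixed K) (g : WithConv (H →ₐ[ℂ] ℂ) × WithConv (H →ₐ[ℂ] ℂ)) :
    IsDiagFixed (g • K) := by
  intro a
  rw [← mul_smul, Prod.mk_mul_mk, character_mul_comm hG a, character_mul_comm hG a,
    ← Prod.mk_mul_mk, mul_smul, h a]

theorem IsDiagFixed.of_smul (hG : (Nat.card (WithConv (H →ₐ[ℂ] ℂ))).Prime) {K : Ideal H}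
    {g : WithConv (H →ₐ[ℂ] ℂ) × WithConv (H →ₐ[ℂ] ℂ)} (h : IsDiagFixed (g • K)) :
    IsDiagFixed K := by
  have := h.smul hG g⁻¹
  rwa [inv_smul_smul] at this

theorem IsDiagFixed.dualIdeal {K : Ideal H} [K.IsTwoSided] (h : IsDiagFixed K) :
    IsDiagFixed (dualIdeal K) := by
  intro a
  rw [smul_dualIdeal, Prod.swap_prod_mk, h a]

theorem IsSimpleKernel.ne_of_ne {A : Type} [Ring A] [Algebra ℂ A] {K L : Ideal A} {n m : ℕ}
    (hK : IsSimpleKernel K n) (hL : IsSimpleKernel L m) (h : n ≠ m) : K ≠ L := by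
  rintro rfl
  exact h (hK.unique hL)

theorem sum_sq_lt_of_injective {A ι : Type} [Ring A] [Algebra ℂ A] [FiniteDimensional ℂ A]
    (hns : ¬ IsSemisimpleRing A) [Fintype ι] (f : ι → Ideal A) (hf : Function.Injective f)
    (n : ι → ℕ) (h : ∀ i, IsSimpleKernel (f i) (n i)) : ∑ i, n i ^ 2 < Module.finrank ℂ A := by
  classical
  have := sum_kerDim_sq_lt hns (Finset.univ.image f) (by simpa using fun i => ⟨_, h i⟩)
  rw [Finset.sum_image fun a _ b _ hab => hf hab] at this
  simpa only [(h _).kerDim_eq] using this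

end CharacterKernels

section Counting
variable {H : Type} [Ring H] [HopfAlgebra ℂ H]

local notation "𝓖" => (WithConv (H →ₐ[ℂ] ℂ))

theorem IsSimpleKernel.two_le (hG : (Nat.card 𝓖).Prime) {K : Ideal H} {n : ℕ}
    (hK : IsSimpleKernel K n) (hf : ¬ IsDiagFixed K) : 2 ≤ n := by
  by_contra h
  obtain rfl : n = 1 := by have := hK.pos; omega
  obtain ⟨χ, rfl⟩ := hK.exists_characterKer
  exact hf (isDiagFixed_characterKer hG χ)

/-- Existence of a diagonally fixed simple kernel of dimension at least the number of characters. -/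
def HasBigFixed (H : Type) [Ring H] [HopfAlgebra ℂ H] : Prop :=
  ∃ (X : Ideal H) (m : ℕ), IsSimpleKernel X m ∧ IsDiagFixed X ∧ Nat.card (WithConv (H →ₐ[ℂ] ℂ)) ≤ m

/-- Bounds on a dimension making products of two such dimensions small. -/
def IsSmallDim (H : Type) [Ring H] [HopfAlgebra ℂ H] (w : ℕ) : Prop :=
  w ^ 2 < 2 * Nat.card (WithConv (H →ₐ[ℂ] ℂ)) ∧
    (HasBigFixed H → w ^ 2 < Nat.card (WithConv (H →ₐ[ℂ] ℂ)))

theorem IsSmallDim.mul_lt {a b : ℕ} (ha : IsSmallDim H a) (hb : IsSmallDim H b) :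
    a * b < 2 * Nat.card 𝓖 ∧ (HasBigFixed H → a * b < Nat.card 𝓖) := by
  have h : ∀ c : ℕ, a ^ 2 < c → b ^ 2 < c → a * b < c := fun c h1 h2 => by
    have : 2 * (a * b) ≤ a ^ 2 + b ^ 2 := by rw [← mul_assoc]; exact two_mul_le_add_sq a b
    omega
  exact ⟨h _ ha.1 hb.1, fun hX => h _ (ha.2 hX) (hb.2 hX)⟩

/-- The diagonally fixed simple kernels of small dimension. -/
def goodKernels (H : Type) [Ring H] [HopfAlgebra ℂ H] : Set (Ideal H) :=
  {W | ∃ n, IsSimpleKernel W n ∧ n < Nat.card (WithConv (H →ₐ[ℂ] ℂ)) ∧ IsDiagFixed W}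

variable [FiniteDimensional ℂ H]

theorem IsSimpleKernel.dvd_of_left_smul (hG : (Nat.card 𝓖).Prime) {K : Ideal H} {n : ℕ}
    (hK : IsSimpleKernel K n) {β : 𝓖} (hβ : β ≠ 1) (h : (β, (1 : 𝓖)) • K = K) :
    Nat.card 𝓖 ∣ n := by
  have := Fact.mk hG
  have ho : orderOf β = Nat.card 𝓖 := orderOf_eq_prime (pow_card_eq_one') hβ
  rw [← ho]
  refine hK.dvd_of_comap_leftTwist (ho ▸ hG) ?_
  conv_rhs => rw [← h]
  ext x
  rw [mem_character_smul, Ideal.mem_comap, biTwist_apply]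
  simp only [Prod.fst_inv, Prod.snd_inv, inv_inv, inv_one]
  rw [rightTwist_one]

theorem IsSimpleKernel.dvd_of_right_smul (hG : (Nat.card 𝓖).Prime) {K : Ideal H} {n : ℕ}
    (hK : IsSimpleKernel K n) {β : 𝓖} (hβ : β ≠ 1) (h : ((1 : 𝓖), β) • K = K) :
    Nat.card 𝓖 ∣ n := by
  have := hK.isTwoSided
  refine hK.dualIdeal.dvd_of_left_smul hG hβ ?_
  rw [smul_dualIdeal, Prod.swap_prod_mk, h]

/-- Characters together with a nonfixed orbit. -/
theorem count_orbit (hG : (Nat.card 𝓖).Prime) (hns : ¬ IsSemisimpleRing H) {K : Ideal H} {n : ℕ}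
    (hK : IsSimpleKernel K n) (hf : ¬ IsDiagFixed K) :
    Nat.card 𝓖 + Nat.card 𝓖 * n ^ 2 < Module.finrank ℂ H := by
  have := Fintype.ofFinite 𝓖
  have h2 := hK.two_le hG hf
  have h := sum_sq_lt_of_injective hns
    (Sum.elim (characterKer : 𝓖 → Ideal H) fun g => (g, g) • K)
    (characterKer_injective.sumElim (injective_diag_smul hG hf) fun a b =>
      (isSimpleKernel_characterKer a).ne_of_ne hK.smul (by omega))
    (Sum.elim (fun _ => 1) fun _ => n)
    (Sum.rec (fun χ => isSimpleKernel_characterKer χ) fun _ => hK.smul)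
  simpa [Nat.card_eq_fintype_card] using h

theorem count_orbit_of_fixed (hG : (Nat.card 𝓖).Prime) (hns : ¬ IsSemisimpleRing H) {K : Ideal H}
    {n : ℕ} (hK : IsSimpleKernel K n) (hf : ¬ IsDiagFixed K) {X : Ideal H} {m : ℕ}
    (hX : IsSimpleKernel X m) (hfX : IsDiagFixed X) (hm : 2 ≤ m) :
    Nat.card 𝓖 + Nat.card 𝓖 * n ^ 2 + m ^ 2 < Module.finrank ℂ H := by
  have := Fintype.ofFinite 𝓖
  have h2 := hK.two_le hG hf
  have h := sum_sq_lt_of_injective hns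
    (Sum.elim (Sum.elim (characterKer : 𝓖 → Ideal H) fun g => (g, g) • K) fun _ : Unit => X)
    ((characterKer_injective.sumElim (injective_diag_smul hG hf) fun a b =>
      (isSimpleKernel_characterKer a).ne_of_ne hK.smul (by omega)).sumElim
        (Function.injective_of_subsingleton _) (by
          rintro (a | a) -
          · exact (isSimpleKernel_characterKer a).ne_of_ne hX (by omega)
          · exact fun he => hf (IsDiagFixed.of_smul hG (g := (a, a)) (by
              change (a, a) • K = X at he
              rwa [he]))))
    (Sum.elim (Sum.elim (fun _ => 1) fun _ => n) fun _ => m)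
    (Sum.rec (Sum.rec (fun χ => isSimpleKernel_characterKer χ) fun _ => hK.smul) fun _ => hX)
  simpa [Nat.card_eq_fintype_card] using h

theorem count_two_orbits (hG : (Nat.card 𝓖).Prime) (hns : ¬ IsSemisimpleRing H) {K : Ideal H}
    {n : ℕ} (hK : IsSimpleKernel K n) (hf : ¬ IsDiagFixed K) {W : Ideal H} {w : ℕ}
    (hW : IsSimpleKernel W w) (hfW : IsDiagFixed W) (hw : 2 ≤ w) (hwr : w < Nat.card 𝓖) :
    Nat.card 𝓖 + Nat.card 𝓖 * n ^ 2 + Nat.card 𝓖 * w ^ 2 < Module.finrank ℂ H ∧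
    ∀ (X : Ideal H) (m : ℕ), IsSimpleKernel X m → IsDiagFixed X → Nat.card 𝓖 ≤ m →
      Nat.card 𝓖 + Nat.card 𝓖 * n ^ 2 + Nat.card 𝓖 * w ^ 2 + m ^ 2 < Module.finrank ℂ H := by
  have := Fintype.ofFinite 𝓖
  have h2 := hK.two_le hG hf
  have hnt : Nontrivial 𝓖 := Finite.one_lt_card_iff_nontrivial.1 hG.one_lt
  obtain ⟨β, hβ⟩ := exists_ne (1 : 𝓖)
  have hinj : Function.Injective fun g : 𝓖 => (g, (1 : 𝓖)) • W :=
    injective_smul_of_prime_card hG (MonoidHom.inl 𝓖 𝓖) (x := W) (g := β) fun h =>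
      absurd (Nat.le_of_dvd (by omega) (hW.dvd_of_left_smul hG hβ h)) (by omega)
  have h3 := (((characterKer_injective (H := H)).sumElim (injective_diag_smul hG hf) fun a b =>
      (isSimpleKernel_characterKer a).ne_of_ne hK.smul (by omega)).sumElim hinj (by
          rintro (a | a) b
          · exact (isSimpleKernel_characterKer a).ne_of_ne hW.smul (by omega)
          · exact fun he => hf (IsDiagFixed.of_smul hG (g := (a, a)) (by
              change (a, a) • K = (b, 1) • W at he
              rw [he]
              exact hfW.smul hG _))))
  constructor
  · have h := sum_sq_lt_of_injective hns _ h3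
      (Sum.elim (Sum.elim (fun _ => 1) fun _ => n) fun _ => w)
      (Sum.rec (Sum.rec (fun χ => isSimpleKernel_characterKer χ) fun _ => hK.smul) fun _ => hW.smul)
    simpa [Nat.card_eq_fintype_card] using h
  · intro X m hX hfX hm
    have h := sum_sq_lt_of_injective hns _
      (h3.sumElim (Function.injective_of_subsingleton fun _ : Unit => X) (by
        rintro ((a | a) | a) -
        · exact (isSimpleKernel_characterKer a).ne_of_ne hX (by omega)
        · exact fun he => hf (IsDiagFixed.of_smul hG (g := (a, a)) (by
            change (a, a) • K = X at he
            rwa [he]))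
        · exact hW.smul.ne_of_ne hX (by omega)))
      (Sum.elim (Sum.elim (Sum.elim (fun _ => 1) fun _ => n) fun _ => w) fun _ => m)
      (Sum.rec (Sum.rec (Sum.rec (fun χ => isSimpleKernel_characterKer χ) fun _ => hK.smul)
        fun _ => hW.smul) fun _ => hX)
    simpa [Nat.card_eq_fintype_card] using h

theorem isSmallDim_of_not_fixed (hG : (Nat.card 𝓖).Prime) (hns : ¬ IsSemisimpleRing H) {s : ℕ}
    (hdim : Module.finrank ℂ H = Nat.card 𝓖 * s) (hs : s ≤ 2 * Nat.card 𝓖 + 1) {K : Ideal H}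
    {n : ℕ} (hK : IsSimpleKernel K n) (hf : ¬ IsDiagFixed K) : IsSmallDim H n := by
  constructor
  · have := count_orbit hG hns hK hf
    rw [hdim] at this
    have h : 1 + n ^ 2 < s := by
      refine lt_of_mul_lt_mul_left (a := Nat.card 𝓖) ?_ (Nat.zero_le _)
      linarith
    omega
  · rintro ⟨X, m, hX, hfX, hm⟩
    have := count_orbit_of_fixed hG hns hK hf hX hfX (hG.two_le.trans hm)
    rw [hdim] at this
    have h : 1 + n ^ 2 + Nat.card 𝓖 < s := by
      refine lt_of_mul_lt_mul_left (a := Nat.card 𝓖) ?_ (Nat.zero_le _)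
      nlinarith
    omega

theorem isSmallDim_of_fixed (hG : (Nat.card 𝓖).Prime) (hns : ¬ IsSemisimpleRing H) {s : ℕ}
    (hdim : Module.finrank ℂ H = Nat.card 𝓖 * s) (hs : s ≤ 2 * Nat.card 𝓖 + 1) {K : Ideal H}
    {n : ℕ} (hK : IsSimpleKernel K n) (hf : ¬ IsDiagFixed K) {W : Ideal H} {w : ℕ}
    (hW : IsSimpleKernel W w) (hfW : IsDiagFixed W) (hwr : w < Nat.card 𝓖) : IsSmallDim H w := by
  have h2 := hG.two_le
  rcases Nat.lt_or_ge w 2 with hw | hw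
  · have hw1 : w = 1 := by have := hW.pos; omega
    subst hw1
    exact ⟨by omega, fun _ => by omega⟩
  obtain ⟨h, h'⟩ := count_two_orbits hG hns hK hf hW hfW hw hwr
  rw [hdim] at h h'
  constructor
  · have h : 1 + n ^ 2 + w ^ 2 < s := by
      refine lt_of_mul_lt_mul_left (a := Nat.card 𝓖) ?_ (Nat.zero_le _)
      linarith
    omega
  · rintro ⟨X, m, hX, hfX, hm⟩
    have := h' X m hX hfX hm
    have h : 1 + n ^ 2 + w ^ 2 + Nat.card 𝓖 < s := by
      refine lt_of_mul_lt_mul_left (a := Nat.card 𝓖) ?_ (Nat.zero_le _)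
      nlinarith
    omega

theorem mem_goodKernels_of_wedge_le (hG : (Nat.card 𝓖).Prime) {A B : Ideal H} {a b : ℕ}
    (hA : IsSimpleKernel A a) (hB : IsSimpleKernel B b) (ha : IsSmallDim H a)
    (hb : IsSmallDim H b) (hf : IsDiagFixed (wedge A B)) {X : Ideal H} {m : ℕ}
    (hX : IsSimpleKernel X m) (hle : wedge A B ≤ X) : X ∈ goodKernels H := by
  classical
  have := Fintype.ofFinite 𝓖
  obtain ⟨hab, hab'⟩ := ha.mul_lt hb
  have hfX : IsDiagFixed X := by
    by_contra hfX
    have h := sum_kerDim_le_of_wedge hA hB (Finset.univ.image fun g : 𝓖 => (g, g) • X) (by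
      intro K hK
      obtain ⟨g, -, rfl⟩ := Finset.mem_image.1 hK
      refine ⟨⟨m, hX.smul⟩, ?_⟩
      rw [← hf g]
      exact character_smul_mono hle)
    rw [Finset.sum_image fun a _ b _ hab => injective_diag_smul hG hfX hab] at h
    simp only [hX.smul.kerDim_eq, Finset.sum_const, Finset.card_univ, smul_eq_mul,
      ← Nat.card_eq_fintype_card] at h
    have := Nat.mul_le_mul_left (Nat.card 𝓖) (hX.two_le hG hfX)
    omega
  refine ⟨m, hX, ?_, hfX⟩
  by_contra hm
  have h := sum_kerDim_le_of_wedge hA hB {X} (by simpa using ⟨⟨m, hX⟩, hle⟩)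
  rw [Finset.sum_singleton, hX.kerDim_eq] at h
  have := hab' ⟨X, m, hX, hfX, by omega⟩
  omega

end Counting

section HopfIdeal
variable {H : Type} [Ring H] [HopfAlgebra ℂ H]

instance isTwoSided_dualIdeal (J : Ideal H) [J.IsTwoSided] : (dualIdeal J).IsTwoSided :=
  ⟨fun {a} b ha => by
    rw [mem_dualIdeal] at ha ⊢
    rw [HopfAlgebra.antipode_mul_antidistrib]
    exact J.mul_mem_left _ ha⟩

theorem dualIdeal_mul_le (P Q : Ideal H) [P.IsTwoSided] [Q.IsTwoSided] :
    dualIdeal Q * dualIdeal P ≤ dualIdeal (P * Q) := by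
  rw [Ideal.mul_le]
  intro x hx y hy
  rw [mem_dualIdeal] at hx hy ⊢
  rw [HopfAlgebra.antipode_mul_antidistrib]
  exact Ideal.mul_mem_mul hy hx

variable [FiniteDimensional ℂ H]

local notation "𝓖" => (WithConv (H →ₐ[ℂ] ℂ))

theorem isDiagFixed_wedge_dualIdeal (hG : (Nat.card 𝓖).Prime) (hns : ¬ IsSemisimpleRing H) {s : ℕ}
    (hdim : Module.finrank ℂ H = Nat.card 𝓖 * s) (hs : s ≤ 2 * Nat.card 𝓖 + 1) {K : Ideal H}
    {n : ℕ} (hK : IsSimpleKernel K n) (hn : 2 ≤ n) (hnd : ¬ Nat.card 𝓖 ∣ n) :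
    IsDiagFixed (wedge K (dualIdeal K)) := by
  have := Fintype.ofFinite 𝓖
  have := hK.isTwoSided
  have := hK.dualIdeal.isTwoSided
  have hst : MulAction.stabilizer (𝓖 × 𝓖) K ≠ ⊥ := by
    intro hb
    have h := sum_sq_lt_of_injective hns (fun g : 𝓖 × 𝓖 => g • K) (fun a b hab => by
      have : a⁻¹ * b ∈ MulAction.stabilizer (𝓖 × 𝓖) K := by
        change a • K = b • K at hab
        rw [MulAction.mem_stabilizer_iff, mul_smul, ← hab, inv_smul_smul]
      rw [hb, Subgroup.mem_bot] at this
      exact inv_mul_eq_one.1 this) (fun _ => n) fun _ => hK.smul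
    simp only [Finset.sum_const, Finset.card_univ, smul_eq_mul, ← Nat.card_eq_fintype_card] at h
    rw [hdim, Nat.card_prod, mul_assoc] at h
    have h1 := lt_of_mul_lt_mul_left h (Nat.zero_le _)
    have h2 : 4 ≤ n ^ 2 := by nlinarith
    have h3 := Nat.mul_le_mul_left (Nat.card 𝓖) h2
    have := hG.two_le
    omega
  obtain ⟨⟨β, γ⟩, hmem, hne⟩ := (Subgroup.bot_or_exists_ne_one _).resolve_left hst
  rw [MulAction.mem_stabilizer_iff] at hmem
  have hβ : β ≠ 1 := by
    rintro rfl
    refine hnd (hK.dvd_of_right_smul hG (fun h => hne ?_) hmem)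
    rw [h]
    rfl
  refine isDiagFixed_of_ne_one hG hβ ?_
  rw [← wedge_smul K (dualIdeal K) β γ β, smul_dualIdeal, Prod.swap_prod_mk, hmem]

theorem mem_goodKernels_of_dualIdeal_le {P : Ideal H} (hP : IsIdealProd (goodKernels H) P)
    {X : Ideal H} {n : ℕ} (hX : IsSimpleKernel X n) (hle : dualIdeal P ≤ X) :
    X ∈ goodKernels H := by
  have hG' : ∀ W ∈ goodKernels H, W.IsTwoSided := fun W hW => hW.choose_spec.1.isTwoSided
  induction hP with
  | base h =>
    obtain ⟨m, hm, hmr, hf⟩ := h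
    have := hm.isTwoSided
    rw [← hX.eq_of_le hm.dualIdeal hle]
    exact ⟨m, hm.dualIdeal, hmr, hf.dualIdeal⟩
  | mul hP hQ ihP ihQ =>
    have := (hP.mul hQ).isTwoSided hG'
    have := hP.isTwoSided hG'
    have := hQ.isTwoSided hG'
    exact (hX.le_or_le_of_mul_le ((dualIdeal_mul_le _ _).trans hle)).elim ihQ ihP

theorem exists_hopf_ideal (hG : (Nat.card 𝓖).Prime) (hns : ¬ IsSemisimpleRing H) {s : ℕ}
    (hdim : Module.finrank ℂ H = Nat.card 𝓖 * s)
    (hs : s ≤ 2 * Nat.card 𝓖 + 1) {K : Ideal H} {n : ℕ} (hK : IsSimpleKernel K n)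
    (hf : ¬ IsDiagFixed K) :
    ¬ Nat.card 𝓖 ∣ n ∧ ∃ J : Ideal H, J.IsTwoSided ∧ J ≠ ⊥ ∧ J ≤ wedge J J ∧ J ≤ dualIdeal J ∧
      (∀ χ : 𝓖, J ≤ characterKer χ) ∧ J ≤ wedge K (dualIdeal K) := by
  have hn := hK.two_le hG hf
  have hKs := isSmallDim_of_not_fixed hG hns hdim hs hK hf
  have hnd : ¬ Nat.card 𝓖 ∣ n := fun h => by
    have h1 := Nat.le_of_dvd hK.pos h
    have h2 := hKs.1
    nlinarith
  refine ⟨hnd, ?_⟩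
  have hfw := isDiagFixed_wedge_dualIdeal hG hns hdim hs hK hn hnd
  have hgood : ∀ W ∈ goodKernels H, ∃ n, IsSimpleKernel W n := fun W hW => ⟨_, hW.choose_spec.1⟩
  have hG' : ∀ W ∈ goodKernels H, W.IsTwoSided := fun W hW => hW.choose_spec.1.isTwoSided
  have hchar : ∀ χ : 𝓖, characterKer χ ∈ goodKernels H := fun χ =>
    ⟨1, isSimpleKernel_characterKer χ, hG.one_lt, isDiagFixed_characterKer hG χ⟩
  obtain ⟨J, hJ, hJJ, hJle⟩ := exists_isIdealProd_mul_self hG' ⟨_, hchar 1⟩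
  have hJt := hJ.isTwoSided hG'
  have hw : ∀ A ∈ goodKernels H, ∀ B ∈ goodKernels H, ∀ (X : Ideal H) (n : ℕ),
      IsSimpleKernel X n → wedge A B ≤ X → X ∈ goodKernels H := by
    rintro A ⟨a, hA, har, hfA⟩ B ⟨b, hB, hbr, hfB⟩ X m hX hle
    have := hA.isTwoSided
    have := hB.isTwoSided
    refine mem_goodKernels_of_wedge_le hG hA hB
      (isSmallDim_of_fixed hG hns hdim hs hK hf hA hfA har)
      (isSmallDim_of_fixed hG hns hdim hs hK hf hB hfB hbr) (fun g => ?_) hX hle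
    rw [← wedge_smul A B g g g, hfA, hfB]
  have := hK.isTwoSided
  have := hK.dualIdeal.isTwoSided
  refine ⟨J, hJt, ?_, ?_, ?_, fun χ => hJle _ (hchar χ), ?_⟩
  · rintro rfl
    obtain ⟨-, -, -, h⟩ := hJ.mem_of_le hgood hK bot_le
    exact hf h
  · exact le_of_forall_isSimpleKernel_le hJJ fun X m hX hle =>
      hJle _ (mem_of_wedge_le_of_isIdealProd hgood hw hJ hJ hX hle)
  · exact le_of_forall_isSimpleKernel_le hJJ fun X m hX hle =>
      hJle _ (mem_goodKernels_of_dualIdeal_le hJ hX hle)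
  · exact le_of_forall_isSimpleKernel_le hJJ fun X m hX hle =>
      hJle _ (mem_goodKernels_of_wedge_le hG hK hK.dualIdeal hKs hKs hfw hX hle)

end HopfIdeal

section AdjointAction
variable {H : Type} [Ring H] [HopfAlgebra ℂ H] {U : Type} [AddCommGroup U] [Module ℂ U]
  (ρ : H →ₐ[ℂ] Module.End ℂ U)

/-- Right multiplication by the image of the antipode. -/
noncomputable def antipodeMulRight : H →ₐ[ℂ] Module.End ℂ (Module.End ℂ U) :=
  AlgHom.ofLinearMap ((LinearMap.mul ℂ (Module.End ℂ U)).flip ∘ₗ ρ.toLinearMap ∘ₗ antipode ℂ)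
    (by ext f : 1; simp) (fun x y => by
      ext f : 1
      simp [HopfAlgebra.antipode_mul_antidistrib, mul_assoc])

/-- The action of `H ⊗ H` on endomorphisms by left multiplication and right multiplication through
the antipode. -/
noncomputable def bimoduleAction : H ⊗[ℂ] H →ₐ[ℂ] Module.End ℂ (Module.End ℂ U) :=
  Algebra.TensorProduct.lift ((Algebra.lmul ℂ (Module.End ℂ U)).comp ρ) (antipodeMulRight ρ)
    fun _ _ => LinearMap.ext fun _ => (mul_assoc _ _ _).symm

theorem bimoduleAction_tmul (x y : H) (f : Module.End ℂ U) :
    bimoduleAction ρ (x ⊗ₜ y) f = ρ x * f * ρ (antipode ℂ y) := by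
  rw [mul_assoc]
  exact DFunLike.congr_fun (Algebra.TensorProduct.lift_tmul
    ((Algebra.lmul ℂ (Module.End ℂ U)).comp ρ) (antipodeMulRight ρ) _ x y) f

/-- The adjoint action on endomorphisms of a representation. -/
noncomputable def adjointAction : H →ₐ[ℂ] Module.End ℂ (Module.End ℂ U) :=
  (bimoduleAction ρ).comp (Bialgebra.comulAlgHom ℂ H)

theorem adjointAction_repr {x : H} {ι : Type*} (r : Coalgebra.Repr ℂ x ι) (f : Module.End ℂ U) :
    adjointAction ρ x f = ∑ i ∈ r.index, ρ (r.left i) * f * ρ (antipode ℂ (r.right i)) := by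
  change bimoduleAction ρ (comul x) f = _
  rw [← r.eq, map_sum, LinearMap.sum_apply]
  exact Finset.sum_congr rfl fun i _ => bimoduleAction_tmul _ _ _ _

theorem adjointAction_eq_zero {x : H}
    (hx : x ∈ wedge (RingHom.ker ρ) (dualIdeal (RingHom.ker ρ))) : adjointAction ρ x = 0 := by
  have h : (RingHom.ker ρ).map (Algebra.TensorProduct.includeLeft : H →ₐ[ℂ] H ⊗[ℂ] H) ⊔
      (dualIdeal (RingHom.ker ρ)).map (Algebra.TensorProduct.includeRight : H →ₐ[ℂ] H ⊗[ℂ] H) ≤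
      RingHom.ker (bimoduleAction ρ) := by
    refine sup_le (Ideal.map_le_iff_le_comap.2 fun y hy => ?_)
      (Ideal.map_le_iff_le_comap.2 fun y hy => ?_)
    · rw [Ideal.mem_comap, RingHom.mem_ker]
      ext f : 1
      rw [RingHom.mem_ker] at hy
      rw [Algebra.TensorProduct.includeLeft_apply, bimoduleAction_tmul, hy, zero_mul, zero_mul]
      rfl
    · rw [Ideal.mem_comap, RingHom.mem_ker]
      ext f : 1
      rw [mem_dualIdeal, RingHom.mem_ker] at hy
      rw [Algebra.TensorProduct.includeRight_apply, bimoduleAction_tmul, hy, mul_zero]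
      rfl
  exact h (mem_wedge.1 hx)

theorem sum_adjointAction_mul {x : H} {ι : Type*} (r : Coalgebra.Repr ℂ x ι)
    (f : Module.End ℂ U) :
    ∑ i ∈ r.index, adjointAction ρ (r.left i) f * ρ (r.right i) = ρ x * f := by
  let F : H ⊗[ℂ] (H ⊗[ℂ] H) →ₗ[ℂ] Module.End ℂ U :=
    LinearMap.mul' ℂ _ ∘ₗ TensorProduct.map ((LinearMap.mul ℂ (Module.End ℂ U)).flip f ∘ₗ
      ρ.toLinearMap) (ρ.toLinearMap ∘ₗ LinearMap.mul' ℂ H ∘ₗ (antipode ℂ).rTensor H)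
  have hF : ∀ a b c, F (a ⊗ₜ (b ⊗ₜ c)) = ρ a * f * ρ (antipode ℂ b * c) := fun _ _ _ => rfl
  have h := congrArg F (Coalgebra.sum_tmul_tmul_eq r (fun i => ℛ ℂ (r.left i))
    fun i => ℛ ℂ (r.right i))
  simp only [map_sum, hF] at h
  have h1 : ∀ i, adjointAction ρ (r.left i) f * ρ (r.right i) =
      ∑ j ∈ (ℛ ℂ (r.left i)).index, ρ ((ℛ ℂ (r.left i)).left j) * f *
        ρ (antipode ℂ ((ℛ ℂ (r.left i)).right j) * r.right i) := fun i => by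
    rw [adjointAction_repr ρ (ℛ ℂ (r.left i)), Finset.sum_mul]
    simp only [map_mul, mul_assoc]
  simp only [h1]
  rw [h]
  simp only [← Finset.mul_sum, ← map_sum, HopfAlgebra.sum_antipode_mul_eq_algebraMap_counit,
    AlgHom.commutes, ← Algebra.commutes (R := ℂ) (A := Module.End ℂ U)]
  have h2 := congrArg (fun v => ρ ((TensorProduct.rid ℂ H) v)) (Coalgebra.sum_tmul_counit_eq r)
  simp only [map_sum, TensorProduct.rid_tmul, map_smul, one_smul] at h2
  rw [← h2, Finset.sum_mul]
  simp only [← Algebra.smul_def, smul_mul_assoc]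

theorem mul_eq_mul_leftTwist {χ : WithConv (H →ₐ[ℂ] ℂ)} {f : Module.End ℂ U}
    (hf : ∀ x, adjointAction ρ x f = χ.ofConv x • f) (x : H) :
    ρ x * f = f * ρ (leftTwist χ.ofConv x) := by
  rw [← sum_adjointAction_mul ρ (ℛ ℂ x), leftTwist_apply, leftHit_repr _ (ℛ ℂ x), map_sum,
    Finset.mul_sum]
  refine Finset.sum_congr rfl fun i _ => ?_
  rw [hf, map_smul, smul_mul_assoc, mul_smul_comm]
  rfl

end AdjointAction

section QuotientOfCharacters
variable {H : Type} [Ring H] [HopfAlgebra ℂ H] [FiniteDimensional ℂ H]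

theorem exists_dual_basis_characters (χ : WithConv (H →ₐ[ℂ] ℂ)) :
    ∃ e : H, χ.ofConv e = 1 ∧ ∀ χ' ≠ χ, χ'.ofConv e = 0 := by
  classical
  have := Fintype.ofFinite (WithConv (H →ₐ[ℂ] ℂ))
  obtain ⟨e, h1, h2⟩ := (isSimpleKernel_characterKer χ).exists_mem_forall_one_sub_mem
    ((Finset.univ.erase χ).image characterKer) (by
      intro L hL
      obtain ⟨χ', hχ', rfl⟩ := Finset.mem_image.1 hL
      exact ⟨⟨1, isSimpleKernel_characterKer χ'⟩, fun h =>
        (Finset.mem_erase.1 hχ').1 (characterKer_injective h)⟩)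
  refine ⟨e, ?_, fun χ' h => h2 _ (Finset.mem_image_of_mem _ (by simpa using h))⟩
  rw [mem_characterKer, map_sub, map_one, sub_eq_zero] at h1
  exact h1.symm

theorem mem_of_forall_character_eq_zero {J : Ideal H} (hJ : ∀ χ, J ≤ characterKer χ)
    (hd : Module.finrank ℂ (H ⧸ J) = Nat.card (WithConv (H →ₐ[ℂ] ℂ))) {x : H}
    (hx : ∀ χ : WithConv (H →ₐ[ℂ] ℂ), χ.ofConv x = 0) : x ∈ J := by
  classical
  have := Fintype.ofFinite (WithConv (H →ₐ[ℂ] ℂ))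
  let Φ : H →ₗ[ℂ] (WithConv (H →ₐ[ℂ] ℂ) → ℂ) := LinearMap.pi fun χ => χ.ofConv.toLinearMap
  choose e he he' using exists_dual_basis_characters (H := H)
  have hsurj : Function.Surjective Φ := by
    intro y
    refine ⟨∑ χ, y χ • e χ, ?_⟩
    ext χ
    change χ.ofConv _ = _
    rw [map_sum, Finset.sum_eq_single χ (fun β _ hβ => by rw [map_smul, he' β χ hβ.symm, smul_zero])
      (by simp), map_smul, he, smul_eq_mul, mul_one]
  have h1 := Φ.finrank_range_add_finrank_ker
  rw [LinearMap.range_eq_top.2 hsurj, finrank_top, Module.finrank_fintype_fun_eq_card,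
    ← Nat.card_eq_fintype_card] at h1
  have h2 := Submodule.finrank_quotient_add_finrank (J.restrictScalars ℂ)
  have h3 : Module.finrank ℂ (H ⧸ J.restrictScalars ℂ) = Module.finrank ℂ (H ⧸ J) := rfl
  have h4 : J.restrictScalars ℂ = LinearMap.ker Φ :=
    Submodule.eq_of_le_of_finrank_eq (fun y hy => funext fun χ => hJ χ hy) (by omega)
  have h5 : x ∈ LinearMap.ker Φ := funext hx
  rwa [← h4] at h5

theorem IsSimpleKernel.lt_two_of_quotient (hG : (Nat.card (WithConv (H →ₐ[ℂ] ℂ))).Prime)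
    {K : Ideal H} {n : ℕ} (hK : IsSimpleKernel K n)
    (hn : ¬ Nat.card (WithConv (H →ₐ[ℂ] ℂ)) ∣ n) {J : Ideal H}
    (hJ : ∀ χ, J ≤ characterKer χ)
    (hd : Module.finrank ℂ (H ⧸ J) = Nat.card (WithConv (H →ₐ[ℂ] ℂ)))
    (hle : J ≤ wedge K (_root_.dualIdeal K)) : n < 2 := by
  classical
  have := Fintype.ofFinite (WithConv (H →ₐ[ℂ] ℂ))
  have hK' := hK
  obtain ⟨U, _, _, _, ρ, hρ, rfl, hpos, rfl⟩ := hK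
  choose e he he' using exists_dual_basis_characters (H := H)
  have hT : ∀ x, (∀ χ : WithConv (H →ₐ[ℂ] ℂ), χ.ofConv x = 0) → adjointAction ρ x = 0 :=
    fun x hx => adjointAction_eq_zero ρ (hle (mem_of_forall_character_eq_zero hJ hd hx))
  have hiso : ∀ f χ x, adjointAction ρ x (adjointAction ρ (e χ) f) =
      χ.ofConv x • adjointAction ρ (e χ) f := by
    intro f χ x
    have h := hT (x * e χ - χ.ofConv x • e χ) fun χ' => by
      rw [map_sub, map_mul, map_smul, smul_eq_mul]
      by_cases h : χ' = χ
      · rw [h, sub_self]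
      · rw [he' χ χ' h, mul_zero, mul_zero, sub_zero]
    rw [map_sub, map_mul, map_smul, sub_eq_zero] at h
    exact congrArg (fun F => F f) h
  have hzero : ∀ f, ∀ χ ≠ 1, adjointAction ρ (e χ) f = 0 := by
    intro f χ hχ
    have hKl : ¬ (χ, (1 : WithConv (H →ₐ[ℂ] ℂ))) • RingHom.ker ρ ≤ RingHom.ker ρ := fun h =>
      hn (hK'.dvd_of_left_smul hG hχ (hK'.eq_of_le hK'.smul h))
    have := hK'.smul (g := (χ, 1)) |>.isTwoSided
    obtain ⟨z, hz, hz1⟩ := hK'.exists_mem_one_sub_mem hKl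
    have hz' : ρ (leftTwist χ.ofConv z) = 0 := by
      rw [mem_character_smul, RingHom.mem_ker, biTwist_apply] at hz
      simpa only [Prod.fst_inv, Prod.snd_inv, inv_inv, inv_one, rightTwist_one] using hz
    rw [RingHom.mem_ker, map_sub, map_one, sub_eq_zero] at hz1
    rw [← one_mul (adjointAction ρ (e χ) f), hz1, mul_eq_mul_leftTwist ρ (hiso f χ), hz', mul_zero]
  have hone : ∀ f, adjointAction ρ (e 1) f = f := by
    intro f
    have h := hT (1 - ∑ χ, e χ) fun χ => by
      rw [map_sub, map_one, map_sum, Finset.sum_eq_single χ (fun β _ hβ => he' β χ hβ.symm)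
        (by simp), he, sub_self]
    rw [map_sub, map_one, sub_eq_zero, map_sum] at h
    have h := congrArg (fun F => F f) h
    rw [LinearMap.sum_apply, Finset.sum_eq_single 1 (fun χ _ hχ => hzero f χ hχ) (by simp)] at h
    exact h.symm
  have htop : (⊥ : Subalgebra ℂ (Module.End ℂ U)) = ⊤ := by
    rw [← Algebra.IsCentral.center_eq_bot ℂ (Module.End ℂ U), eq_top_iff]
    rintro f -
    rw [Subalgebra.mem_center_iff]
    intro g
    obtain ⟨x, rfl⟩ := hρ g
    have h := mul_eq_mul_leftTwist ρ (hiso f 1) x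
    rwa [hone, leftTwist_one] at h
  have : Nontrivial U := Module.nontrivial_of_finrank_pos hpos
  rw [Subalgebra.bot_eq_top_iff_finrank_eq_one, Module.finrank_linearMap] at htop
  rw [Nat.eq_one_of_mul_eq_one_left htop]
  exact one_lt_two

end QuotientOfCharacters

section ComulMatrix
variable {k : Type*} [Field k] {C : Type*} [AddCommGroup C] [Module k C] [Coalgebra k C]
  {ι κ : Type*} [Fintype ι] [Fintype κ]

/-- Coordinates of a tensor with respect to a basis in the first factor. -/
theorem eq_sum_basis_tmul {M N : Type*} [AddCommGroup M] [Module k M] [AddCommGroup N] [Module k N]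
    (b : Module.Basis ι k M) (t : M ⊗[k] N) :
    t = ∑ j, b j ⊗ₜ TensorProduct.lid k N ((b.coord j).rTensor N t) := by
  induction t with
  | zero => simp
  | tmul y z =>
    conv_lhs => rw [← b.sum_repr y, TensorProduct.sum_tmul]
    simp [TensorProduct.smul_tmul]
  | add y z hy hz =>
    conv_lhs => rw [hy, hz]
    simp [TensorProduct.tmul_add, Finset.sum_add_distrib]

/-- The matrix coefficients of a coalgebra with respect to a basis. -/
noncomputable def coeffMatrix (b : Module.Basis ι k C) (i j : ι) : C := leftHit (b.coord i) (b j)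

theorem comul_basis (b : Module.Basis ι k C) (j : ι) :
    comul (R := k) (b j) = ∑ i, b i ⊗ₜ coeffMatrix b i j :=
  eq_sum_basis_tmul b (comul (b j))

theorem sum_counit_smul_coeffMatrix (b : Module.Basis ι k C) (j : ι) :
    ∑ i, counit (R := k) (b i) • coeffMatrix b i j = b j := by
  have h := Coalgebra.rTensor_counit_comul (R := k) (b j)
  rw [comul_basis] at h
  simpa using congrArg (fun v => TensorProduct.lid k C v) h

variable [DecidableEq ι] [DecidableEq κ]

variable (k) in
/-- A square matrix of elements of a coalgebra that is multiplicative for the coproduct. -/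
structure IsComulMatrix (c : ι → ι → C) : Prop where
  comul : ∀ i j, comul (R := k) (c i j) = ∑ l, c i l ⊗ₜ c l j
  counit : ∀ i j, counit (R := k) (c i j) = if i = j then 1 else 0

theorem isComulMatrix_coeffMatrix (b : Module.Basis ι k C) : IsComulMatrix k (coeffMatrix b) where
  comul i j := by
    rw [coeffMatrix, comul_leftHit, comul_basis, map_sum]
    rfl
  counit i j := by
    rw [coeffMatrix, counit_leftHit, Module.Basis.coord_apply, Module.Basis.repr_self,
      Finsupp.single_apply]
    exact if_congr eq_comm rfl rfl

theorem IsComulMatrix.map {D : Type*} [AddCommGroup D] [Module k D] [Coalgebra k D] {c : ι → ι → C}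
    (hc : IsComulMatrix k c) (π : C →ₗc[k] D) : IsComulMatrix k fun i j => π (c i j) where
  comul i j := by
    rw [← CoalgHomClass.map_comp_comul_apply, hc.comul]
    simp
  counit i j := by rw [CoalgHomClass.counit_comp_apply, hc.counit]

theorem leftHit_comp {D : Type*} [AddCommGroup D] [Module k D] [Coalgebra k D]
    (π : C →ₗc[k] D) (f : D →ₗ[k] k) (x : C) :
    π (leftHit (f ∘ₗ (π : C →ₗ[k] D)) x) = leftHit f (π x) := by
  rw [leftHit_apply f, ← CoalgHomClass.map_comp_comul_apply, leftHit_repr _ (ℛ k x), ← (ℛ k x).eq]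
  simp

theorem IsComulMatrix.mul {B : Type*} [Ring B] [Bialgebra k B] {c : ι → ι → B} {d : κ → κ → B}
    (hc : IsComulMatrix k c) (hd : IsComulMatrix k d) :
    IsComulMatrix k fun x y : ι × κ => c x.1 y.1 * d x.2 y.2 where
  comul x y := by
    rw [Bialgebra.comul_mul, hc.comul, hd.comul, Finset.sum_mul_sum, Fintype.sum_prod_type]
    simp
  counit x y := by
    rw [Bialgebra.counit_mul, hc.counit, hd.counit, ite_zero_mul_ite_zero, one_mul]
    exact if_congr Prod.ext_iff.symm rfl rfl

theorem IsComulMatrix.submatrix_inl {c : ι ⊕ κ → ι ⊕ κ → C} (hc : IsComulMatrix k c)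
    (h : ∀ i j, c (.inr i) (.inl j) = 0) : IsComulMatrix k fun i j => c (.inl i) (.inl j) where
  comul i j := by simp [hc.comul, h]
  counit i j := by simp [hc.counit]

theorem IsComulMatrix.submatrix_inr {c : ι ⊕ κ → ι ⊕ κ → C} (hc : IsComulMatrix k c)
    (h : ∀ i j, c (.inr i) (.inl j) = 0) : IsComulMatrix k fun i j => c (.inr i) (.inr j) where
  comul i j := by simp [hc.comul, h]
  counit i j := by simp [hc.counit]

variable {B : Type*} [Ring B] [HopfAlgebra k B] {c : ι → ι → B}

theorem IsComulMatrix.sum_antipode_mul (hc : IsComulMatrix k c) (i j : ι) :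
    ∑ l, antipode k (c i l) * c l j = if i = j then 1 else 0 := by
  have h := HopfAlgebra.mul_antipode_rTensor_comul_apply (R := k) (c i j)
  rw [hc.comul, hc.counit] at h
  simpa [apply_ite] using h

theorem IsComulMatrix.sum_mul_antipode (hc : IsComulMatrix k c) (i j : ι) :
    ∑ l, c i l * antipode k (c l j) = if i = j then 1 else 0 := by
  have h := HopfAlgebra.mul_antipode_lTensor_comul_apply (R := k) (c i j)
  rw [hc.comul, hc.counit] at h
  simpa [apply_ite] using h

end ComulMatrix

section Solutions
variable {k : Type*} [Field k] {H B : Type*} [Ring H] [HopfAlgebra k H] [Ring B] [HopfAlgebra k B]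
  (π : H →ₐc[k] B) {ι κ : Type*} [Fintype ι] [Fintype κ]

/-- The left coaction of `B` on `H` induced by a bialgebra homomorphism. -/
noncomputable def coaction : H →ₐ[k] B ⊗[k] H :=
  (Algebra.TensorProduct.map (π : H →ₐ[k] B) (AlgHom.id k H)).comp (Bialgebra.comulAlgHom k H)

theorem coaction_apply (x : H) :
    coaction π x = (π : H →ₗ[k] B).rTensor H (comul x) := rfl

/-- The homomorphisms into `H` from the comodule with coefficient matrix `c`. -/
noncomputable def comoduleHoms (c : ι → ι → B) : Submodule k (ι → H) where
  carrier := {x | ∀ i, coaction π (x i) = ∑ j, c i j ⊗ₜ x j}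
  zero_mem' := by simp
  add_mem' hx hy i := by
    simp only [Pi.add_apply, map_add, TensorProduct.tmul_add, Finset.sum_add_distrib, hx i, hy i]
  smul_mem' a x hx i := by
    simp only [Pi.smul_apply, map_smul, TensorProduct.tmul_smul, hx i, Finset.smul_sum]

variable {π}
theorem mem_comoduleHoms {c : ι → ι → B} {x : ι → H} :
    x ∈ comoduleHoms π c ↔ ∀ i, coaction π (x i) = ∑ j, c i j ⊗ₜ x j := Iff.rfl

theorem coaction_of_isComulMatrix [DecidableEq ι] {c : ι → ι → H} (hc : IsComulMatrix k c)
    (i j : ι) :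
    coaction π (c i j) = ∑ l, π (c i l) ⊗ₜ c l j := by
  rw [coaction_apply, hc.comul]
  simp

theorem finrank_comoduleHoms_reindex {c : ι → ι → B} (e : κ ≃ ι) :
    Module.finrank k (comoduleHoms π fun i j => c (e i) (e j)) =
      Module.finrank k (comoduleHoms π c) := by
  refine LinearEquiv.finrank_eq (LinearEquiv.ofSubmodules (LinearEquiv.funCongrLeft k H e.symm)
    _ _ ?_)
  ext x
  simp only [Submodule.mem_map]
  constructor
  · rintro ⟨y, hy, rfl⟩ i
    have := hy (e.symm i)
    rw [← e.sum_comp]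
    simpa using this
  · intro hx
    refine ⟨fun j => x (e j), fun i => ?_, by ext i; simp⟩
    rw [hx (e i), ← e.sum_comp]

variable [FiniteDimensional k H]

theorem finrank_comoduleHoms_le (c : ι → ι → B) :
    Module.finrank k (comoduleHoms π c) ≤ Fintype.card ι * Module.finrank k H :=
  (Submodule.finrank_le _).trans_eq (by simp [Module.finrank_pi_fintype])

theorem finrank_comoduleHoms_sum_le {c : ι ⊕ κ → ι ⊕ κ → B} (h : ∀ i j, c (.inr i) (.inl j) = 0) :
    Module.finrank k (comoduleHoms π c) ≤
      Module.finrank k (comoduleHoms π fun i j => c (.inl i) (.inl j)) +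
        Module.finrank k (comoduleHoms π fun i j => c (.inr i) (.inr j)) := by
  have h1 (x : comoduleHoms π c) : LinearMap.funLeft k H Sum.inr x.1 ∈
      comoduleHoms π fun i j => c (.inr i) (.inr j) := fun i => by
    simpa [h] using x.2 (.inr i)
  let f := (LinearMap.funLeft k H Sum.inr ∘ₗ (comoduleHoms π c).subtype).codRestrict _ h1
  have hf (x : LinearMap.ker f) (i : κ) : x.1.1 (.inr i) = 0 :=
    congr_fun (congr_arg Subtype.val (LinearMap.mem_ker.mp x.2)) i
  have h2 (x : LinearMap.ker f) : LinearMap.funLeft k H Sum.inl x.1.1 ∈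
      comoduleHoms π fun i j => c (.inl i) (.inl j) := fun i => by
    simpa [hf x] using x.1.2 (.inl i)
  let g := (LinearMap.funLeft k H Sum.inl ∘ₗ (comoduleHoms π c).subtype ∘ₗ
    (LinearMap.ker f).subtype).codRestrict _ h2
  have hg : Function.Injective g := fun x y hxy => by
    ext i
    rcases i with i | i
    · exact congr_fun (congr_arg Subtype.val hxy) i
    · rw [hf, hf]
  rw [← f.finrank_range_add_finrank_ker, add_comm]
  exact add_le_add (LinearMap.finrank_le_finrank_of_injective hg) (Submodule.finrank_le _)

theorem finrank_comoduleHoms_sum_prod_le {κ' : Type*} [Fintype κ'] {t : κ ⊕ κ' → κ ⊕ κ' → B}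
    (h : ∀ i j, t (.inr i) (.inl j) = 0) (c : ι → ι → B) :
    Module.finrank k (comoduleHoms π fun x y : (κ ⊕ κ') × ι => t x.1 y.1 * c x.2 y.2) ≤
      Module.finrank k (comoduleHoms π fun x y : κ × ι => t (.inl x.1) (.inl y.1) * c x.2 y.2) +
      Module.finrank k
        (comoduleHoms π fun x y : κ' × ι => t (.inr x.1) (.inr y.1) * c x.2 y.2) := by
  rw [← finrank_comoduleHoms_reindex (Equiv.sumProdDistrib κ κ' ι).symm]
  exact finrank_comoduleHoms_sum_le fun x y => by simp [h]

theorem le_finrank_comoduleHoms_mul [DecidableEq κ] {t : κ → κ → H} (ht : IsComulMatrix k t)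
    (c : ι → ι → B) :
    Fintype.card κ * Module.finrank k (comoduleHoms π c) ≤
      Module.finrank k (comoduleHoms π fun x y : κ × ι => π (t x.1 y.1) * c x.2 y.2) := by
  let F : (κ → comoduleHoms π c) →ₗ[k] (κ × ι → H) :=
    { toFun x y := ∑ b, t y.1 b * (x b).1 y.2
      map_add' x y := by ext; simp [mul_add, Finset.sum_add_distrib]
      map_smul' a x := by ext; simp [Finset.smul_sum] }
  have hF (x) : F x ∈ comoduleHoms π fun x y : κ × ι => π (t x.1 y.1) * c x.2 y.2 := fun y => by
    simp only [F, LinearMap.coe_mk, AddHom.coe_mk, map_sum, map_mul, coaction_of_isComulMatrix ht,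
      mem_comoduleHoms.mp (x _).2, Finset.sum_mul_sum, Algebra.TensorProduct.tmul_mul_tmul,
      Fintype.sum_prod_type, TensorProduct.tmul_sum]
    rw [Finset.sum_comm]
    exact Finset.sum_congr rfl fun _ _ => Finset.sum_comm
  have hinj : Function.Injective (F.codRestrict _ hF) := by
    rw [← LinearMap.ker_eq_bot, LinearMap.ker_codRestrict, LinearMap.ker_eq_bot']
    intro x hx
    ext a i
    have h : ∑ l, antipode k (t a l) * F x (l, i) = (x a).1 i := by
      simp only [F, LinearMap.coe_mk, AddHom.coe_mk, Finset.mul_sum, ← mul_assoc]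
      rw [Finset.sum_comm]
      simp [← Finset.sum_mul, ht.sum_antipode_mul]
    simp [← h, hx]
  simpa [Module.finrank_pi_fintype] using LinearMap.finrank_le_finrank_of_injective hinj

theorem finrank_comoduleHoms_mul_le [DecidableEq ι] [FiniteDimensional k B] [Nontrivial B]
    [DecidableEq κ] (b : Module.Basis κ k B) {c : ι → ι → B} (hc : IsComulMatrix k c) :
    Module.finrank k (comoduleHoms π fun x y : κ × ι => coeffMatrix b x.1 y.1 * c x.2 y.2) ≤
      Fintype.card ι * Module.finrank k H := by
  let F : (κ × ι → H) →ₗ[k] (ι → H) :=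
    { toFun x i := ∑ a, counit (R := k) (b a) • x (a, i)
      map_add' x y := by ext; simp [Finset.sum_add_distrib]
      map_smul' a x := by ext; simp [Finset.smul_sum, smul_comm a] }
  set W := comoduleHoms π fun x y : κ × ι => coeffMatrix b x.1 y.1 * c x.2 y.2
  have hinj : Function.Injective (F ∘ₗ W.subtype) := by
    rw [← LinearMap.ker_eq_bot, LinearMap.ker_eq_bot']
    rintro ⟨x, hx⟩ hFx
    have h1 (i : ι) : ∑ a, ∑ j, (b a * c i j) ⊗ₜ[k] x (a, j) = 0 := by
      have h : coaction π (F x i) = 0 := by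
        rw [show F x = 0 from hFx]; simp
      rw [← h]
      simp only [F, LinearMap.coe_mk, AddHom.coe_mk, map_sum, map_smul, hx _,
        Fintype.sum_prod_type, Finset.smul_sum, TensorProduct.smul_tmul', ← smul_mul_assoc]
      symm
      rw [Finset.sum_comm]
      refine Finset.sum_congr rfl fun a _ => ?_
      rw [Finset.sum_comm]
      simp only [← TensorProduct.sum_tmul, ← Finset.sum_mul, sum_counit_smul_coeffMatrix]
    have h2 (l : ι) : ∑ a, antipode k (b a) ⊗ₜ[k] x (a, l) = 0 := by
      have h (i : ι) := congrArg (fun v => (LinearMap.mulLeft k (c l i)).rTensor H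
        ((antipode k (A := B)).rTensor H v)) (h1 i)
      simp only [map_sum, LinearMap.rTensor_tmul, antipode_mul_antidistrib, LinearMap.mulLeft_apply,
        ← mul_assoc, map_zero] at h
      have h3 := Finset.sum_eq_zero fun i (_ : i ∈ Finset.univ) => h i
      rw [Finset.sum_comm] at h3
      rw [← h3]
      refine Finset.sum_congr rfl fun a _ => ?_
      rw [Finset.sum_comm]
      simp [← TensorProduct.sum_tmul, ← Finset.sum_mul, hc.sum_mul_antipode, TensorProduct.ite_tmul]
    have hS := antipode_bijective k B
    let e := b.map (LinearEquiv.ofBijective _ hS)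
    ext ⟨a, i⟩
    have h3 := TensorProduct.sum_tmul_basis_left_eq_zero (R := k) (N := H) e
      (Finsupp.equivFunOnFinite.symm fun a => x (a, i)) (by
        rw [Finsupp.sum_fintype _ _ (by simp)]
        simpa [e] using h2 i)
    simpa using DFunLike.congr_fun h3 a
  simpa [Module.finrank_pi_fintype] using LinearMap.finrank_le_finrank_of_injective hinj

theorem le_finrank_comoduleHoms_coeffMatrix (β : Module.Basis κ k B) :
    Module.finrank k H ≤ Module.finrank k (comoduleHoms π (coeffMatrix β)) := by
  let F : H →ₗ[k] (κ → H) := LinearMap.pi fun a =>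
    (TensorProduct.lid k H).toLinearMap ∘ₗ (β.coord a).rTensor H ∘ₗ (coaction π).toLinearMap
  have hsum (x : H) : coaction π x = ∑ a, β a ⊗ₜ F x a := eq_sum_basis_tmul β _
  have hF (x : H) : F x ∈ comoduleHoms π (coeffMatrix β) := fun a => by
    have h1 : F x a = leftHit (β.coord a ∘ₗ (π : H →ₗ[k] B)) x := by
      rw [leftHit_apply, LinearMap.rTensor_comp]; rfl
    have h3 : leftHit (β.coord a) ∘ₗ (π : H →ₗ[k] B) =
        (π : H →ₗ[k] B) ∘ₗ leftHit (β.coord a ∘ₗ (π : H →ₗ[k] B)) :=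
      LinearMap.ext fun y => (leftHit_comp (π : H →ₗc[k] B) _ y).symm
    have h2 : (leftHit (β.coord a)).rTensor H (coaction π x) = coaction π (F x a) := by
      rw [h1, coaction_apply, coaction_apply, comul_leftHit, ← LinearMap.rTensor_comp_apply,
        ← LinearMap.rTensor_comp_apply, h3]
    rw [← h2, hsum, map_sum]
    rfl
  have hinj : Function.Injective (F.codRestrict _ hF) := by
    rw [← LinearMap.ker_eq_bot, LinearMap.ker_codRestrict, LinearMap.ker_eq_bot']
    intro x hx
    have h1 : coaction π x = 0 := by simp [hsum, hx]
    have h2 : (counit (R := k) (A := B)).rTensor H (coaction π x) = 1 ⊗ₜ x := by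
      rw [coaction_apply, ← LinearMap.comp_apply, ← LinearMap.rTensor_comp,
        ← Coalgebra.rTensor_counit_comul (R := k) x]
      congr 2
      ext y
      exact CoalgHomClass.counit_comp_apply (π : H →ₗc[k] B) y
    rw [h1, map_zero] at h2
    simpa using congrArg (fun v => TensorProduct.lid k H v) h2.symm
  exact LinearMap.finrank_le_finrank_of_injective hinj

end Solutions

/-- A basis of the target of a surjective linear map lifts to the source, compatibly with a basis of
the kernel. -/
theorem exists_basis_sum_of_surjective {k V W κ : Type*} [Field k] [AddCommGroup V] [Module k V]
    [FiniteDimensional k V] [AddCommGroup W] [Module k W] {f : V →ₗ[k] W}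
    (hf : Function.Surjective f) (β : Module.Basis κ k W) :
    ∃ b : Module.Basis (Fin (Module.finrank k (LinearMap.ker f)) ⊕ κ) k V,
      (∀ i, f (b (.inl i)) = 0) ∧ ∀ j, f (b (.inr j)) = β j := by
  let e := f.quotKerEquivOfSurjective hf
  refine ⟨(Module.finBasis k (LinearMap.ker f)).sumQuot (β.map e.symm), fun i => ?_, fun j => ?_⟩
  · simp
  · have h := Module.Basis.sumQuot_inr (Module.finBasis k (LinearMap.ker f)) (β.map e.symm) j
    rw [Module.Basis.map_apply, LinearEquiv.eq_symm_apply] at h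
    exact h

section Divisibility
variable {k : Type*} [Field k] {H B : Type*} [Ring H] [HopfAlgebra k H] [Ring B] [HopfAlgebra k B]
  [FiniteDimensional k H] [FiniteDimensional k B] {π : H →ₐc[k] B}

/-- The matrix coefficients of the kernel of a surjective bialgebra homomorphism `π`, as a comodule
over the target. -/
theorem exists_isComulMatrix_ker (hπ : Function.Surjective π) [Nontrivial B] :
    ∃ (L : ℕ) (j : Fin L → Fin L → B), Module.finrank k H = Module.finrank k B + L ∧
      IsComulMatrix k j ∧ ∀ {ι : Type} [Fintype ι] [DecidableEq ι] {c : ι → ι → B},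
        IsComulMatrix k c →
        Module.finrank k H * Module.finrank k (comoduleHoms π c) ≤
          Module.finrank k (comoduleHoms π fun x y : _ × ι => j x.1 y.1 * c x.2 y.2) +
            Fintype.card ι * Module.finrank k H := by
  let β := Module.finBasis k B
  obtain ⟨b, hb0, hb1⟩ := exists_basis_sum_of_surjective (f := (π : H →ₗ[k] B)) hπ β
  have hcoord (a) : b.coord (.inr a) = β.coord a ∘ₗ (π : H →ₗ[k] B) := by
    refine b.ext fun i => ?_
    rcases i with i | i
    · rw [LinearMap.comp_apply, hb0]; simp
    · rw [LinearMap.comp_apply, hb1]; simp [Finsupp.single_apply]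
  have ht (a i) : π (coeffMatrix b (.inr a) i) = leftHit (β.coord a) (π (b i)) := by
    rw [coeffMatrix, hcoord]
    exact leftHit_comp (π : H →ₗc[k] B) _ _
  have h0 (a i) : π (coeffMatrix b (.inr a) (.inl i)) = 0 := by
    rw [ht, show π (b (.inl i)) = 0 from hb0 i, map_zero]
  have h1 (a i) : π (coeffMatrix b (.inr a) (.inr i)) = coeffMatrix β a i := by
    rw [ht, show π (b (.inr i)) = β i from hb1 i]; rfl
  have hπt := (isComulMatrix_coeffMatrix b).map (π : H →ₗc[k] B)
  have hL := (π : H →ₗ[k] B).finrank_range_add_finrank_ker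
  have hr : LinearMap.range (π : H →ₗ[k] B) = ⊤ := LinearMap.range_eq_top.mpr hπ
  rw [hr, finrank_top] at hL
  refine ⟨_, _, hL.symm, hπt.submatrix_inl h0, fun {ι} _ _ {c} hc => ?_⟩
  have h2 := le_finrank_comoduleHoms_mul (π := π) (isComulMatrix_coeffMatrix b) c
  rw [← Module.finrank_eq_card_basis b] at h2
  have h3 := finrank_comoduleHoms_sum_prod_le (π := π) (t := fun i j => π (coeffMatrix b i j)) h0 c
  have h4 : (fun x y : _ × ι => π (coeffMatrix b (.inr x.1) (.inr y.1)) * c x.2 y.2) =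
      fun x y => coeffMatrix β x.1 y.1 * c x.2 y.2 := funext₂ fun x y => by rw [h1]
  beta_reduce at h3
  rw [h4] at h3
  exact h2.trans (h3.trans (Nat.add_le_add le_rfl (finrank_comoduleHoms_mul_le β hc)))

theorem finrank_mul_comoduleHoms_le (hπ : Function.Surjective π) [Nontrivial B] {ι : Type}
    [Fintype ι] [DecidableEq ι] {c : ι → ι → B} (hc : IsComulMatrix k c) :
    Module.finrank k B * Module.finrank k (comoduleHoms π c) ≤
      Module.finrank k H * Fintype.card ι := by
  obtain ⟨L, j, hML, hj, h⟩ := exists_isComulMatrix_ker hπ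
  set M := Module.finrank k H
  set N := Module.finrank k B
  have hN : 0 < N := Module.finrank_pos
  have key (n : ℕ) : ∀ {ι : Type} [Fintype ι] [DecidableEq ι] {c : ι → ι → B},
      IsComulMatrix k c → (M : ℤ) ^ n * (N * Module.finrank k (comoduleHoms π c) -
        M * Fintype.card ι) ≤ N * M * L ^ n * Fintype.card ι := by
    induction n with
    | zero =>
      intro ι _ _ c _
      have h1 := finrank_comoduleHoms_le (π := π) c
      have h1' : (Module.finrank k (comoduleHoms π c) : ℤ) ≤ Fintype.card ι * M := by
        exact_mod_cast h1
      nlinarith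
    | succ n ih =>
      intro ι _ _ c hc
      have h1 := ih (hj.mul hc)
      have h2 := h hc
      set x := Module.finrank k (comoduleHoms π c)
      set y := Module.finrank k (comoduleHoms π fun x y : Fin L × ι => j x.1 y.1 * c x.2 y.2)
      have h2' : (M : ℤ) * x ≤ y + Fintype.card ι * M := by exact_mod_cast h2
      rw [Fintype.card_prod, Fintype.card_fin] at h1
      push_cast at h1
      have h3 : (M : ℤ) * (N * x - M * Fintype.card ι) ≤ N * y - M * (L * Fintype.card ι) := by
        have hL : (L : ℤ) = M - N := by rw [eq_sub_iff_add_eq']; exact_mod_cast hML.symm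
        have h4 := mul_le_mul_of_nonneg_left h2' (Int.natCast_nonneg N)
        rw [hL]
        linarith
      calc (M : ℤ) ^ (n + 1) * (N * x - M * Fintype.card ι)
          = M ^ n * (M * (N * x - M * Fintype.card ι)) := by ring
        _ ≤ M ^ n * (N * y - M * (L * Fintype.card ι)) := by gcongr
        _ ≤ _ := h1
        _ = _ := by ring
  by_contra! hlt
  have hM : (0 : ℝ) < M := by exact_mod_cast (by omega : 0 < M)
  have hlt1 : (L : ℝ) / M < 1 := by
    rw [div_lt_one hM]; exact_mod_cast (by omega : L < M)
  obtain ⟨n, hn⟩ := exists_pow_lt_of_lt_one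
    (show (0 : ℝ) < 1 / (N * M * Fintype.card ι + 1) by positivity) hlt1
  rw [div_pow, div_lt_div_iff₀ (by positivity) (by positivity)] at hn
  have hk := key n hc
  have h1 : (M : ℤ) ^ n * 1 ≤ (M : ℤ) ^ n * (N * Module.finrank k (comoduleHoms π c) -
        M * Fintype.card ι) := by
    gcongr
    have : ((M * Fintype.card ι : ℕ) : ℤ) < (N * Module.finrank k (comoduleHoms π c) : ℕ) := by
      exact_mod_cast hlt
    push_cast at this
    linarith
  have h2 : (M : ℤ) ^ n ≤ N * M * L ^ n * Fintype.card ι := by linarith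
  have h2' : (M : ℝ) ^ n ≤ N * M * L ^ n * Fintype.card ι := by exact_mod_cast h2
  have h3 : (0 : ℝ) ≤ L ^ n := by positivity
  nlinarith

/-- The dimension of a finite-dimensional Hopf algebra is divisible by the dimensions of its
quotients. -/
theorem finrank_dvd_of_surjective (hπ : Function.Surjective π) :
    Module.finrank k B ∣ Module.finrank k H := by
  have : Nontrivial B := ⟨1, 0, fun h => by simpa using (congrArg (counit (R := k)) h)⟩
  let e := LinearEquiv.toSpanNonzeroSingleton k B 1 one_ne_zero
  let β := ((Module.Basis.singleton (Fin 1) k).map e).sumQuot (Module.finBasis k (B ⧸ k ∙ (1 : B)))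
  have hβ : β (.inl 0) = 1 := by simp [β, e]
  have h0 (a b) : coeffMatrix β (.inr a) (.inl b) = 0 := by
    have hz : β.coord (.inr a) (β (.inl 0)) = 0 := by simp
    rw [hβ] at hz
    rw [Subsingleton.elim b 0, coeffMatrix, leftHit_apply, hβ, Bialgebra.comul_one,
      Algebra.TensorProduct.one_def, LinearMap.rTensor_tmul, hz, TensorProduct.zero_tmul, map_zero]
  have hc := isComulMatrix_coeffMatrix β
  have h1 := finrank_mul_comoduleHoms_le hπ (hc.submatrix_inl h0)
  have h2 := finrank_mul_comoduleHoms_le hπ (hc.submatrix_inr h0)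
  have h3 := (le_finrank_comoduleHoms_coeffMatrix (π := π) β).trans
    (finrank_comoduleHoms_sum_le h0)
  have h4 := Module.finrank_eq_card_basis β
  rw [Fintype.card_sum, Fintype.card_fin, Fintype.card_fin] at h4
  rw [Fintype.card_fin] at h1 h2
  generalize Module.finrank k (comoduleHoms π fun i j => coeffMatrix β (.inl i) (.inl j)) = x at *
  refine ⟨x, le_antisymm ?_ (by linarith)⟩
  nlinarith

end Divisibility

section FourthPower
variable {H : Type} [Ring H] [HopfAlgebra ℂ H]

local notation "𝓖" => (WithConv (H →ₐ[ℂ] ℂ))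

theorem isHopfIdeal_of_le {J : Ideal H} [J.IsTwoSided] (hmul : J ≤ wedge J J)
    (hdual : J ≤ dualIdeal J) (hone : J ≤ characterKer 1) : J.IsHopfIdeal ℂ where
  toIsCoideal := by
    refine (Submodule.isCoideal_iff _).2 ⟨fun x hx => hone hx, fun x hx => ?_⟩
    have h := hmul (show x ∈ J from hx)
    have h' := mem_wedge_ker (f := Ideal.Quotient.mkₐ ℂ J) (g := Ideal.Quotient.mkₐ ℂ J)
      (Ideal.Quotient.mkₐ_surjective ℂ J) (Ideal.Quotient.mkₐ_surjective ℂ J) (x := x)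
    rw [ker_mkₐ] at h'
    exact h'.1 h
  antipode_mem x hx := mem_dualIdeal.1 (hdual hx)

theorem card_character_quotient {J : Ideal H} [J.IsTwoSided] [J.IsHopfIdeal ℂ]
    (hJ : ∀ χ : 𝓖, J ≤ characterKer χ) :
    Nat.card (WithConv (H ⧸ J →ₐ[ℂ] ℂ)) = Nat.card 𝓖 := by
  refine Nat.card_eq_of_bijective
    (fun χ => toConv (χ.ofConv.comp (Ideal.Quotient.mkₐ ℂ J))) ⟨fun χ β h => ?_, fun χ => ?_⟩
  · refine WithConv.ofConv_injective (AlgHom.ext fun x => ?_)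
    obtain ⟨x, rfl⟩ := Ideal.Quotient.mkₐ_surjective ℂ J x
    exact DFunLike.congr_fun (WithConv.toConv_injective h) x
  · exact ⟨toConv (Ideal.Quotient.liftₐ J χ.ofConv fun a ha => hJ χ ha), rfl⟩

theorem leftTwist_antipode_pow_four (α : 𝓖) (x : H) :
    leftTwist α.ofConv ((antipode ℂ ^ 4 : Module.End ℂ H) (leftTwist (α⁻¹).ofConv x)) =
      (antipode ℂ ^ 4 : Module.End ℂ H) x := by
  simp only [pow_succ, pow_zero, one_mul, Module.End.mul_apply]
  rw [leftTwist_antipode, rightTwist_antipode, inv_inv, leftTwist_antipode, rightTwist_antipode,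
    inv_inv, ← leftTwist_mul]
  simp [leftTwist_one]

variable [FiniteDimensional ℂ H]

theorem IsSimpleKernel.isDiagFixed (hG : (Nat.card 𝓖).Prime) (hns : ¬ IsSemisimpleRing H) {s : ℕ}
    (hsp : s.Prime) (hdim : Module.finrank ℂ H = Nat.card 𝓖 * s) (hs : s ≤ 2 * Nat.card 𝓖 + 1)
    {K : Ideal H} {n : ℕ} (hK : IsSimpleKernel K n) : IsDiagFixed K := by
  by_contra hf
  obtain ⟨hn, J, _, hJ, hmul, hdual, hchar, hle⟩ := exists_hopf_ideal hG hns hdim hs hK hf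
  have := isHopfIdeal_of_le hmul hdual (hchar 1)
  have h1 : Module.finrank ℂ (H ⧸ J) ∣ Module.finrank ℂ H :=
    finrank_dvd_of_surjective (π := Bialgebra.Quotient.mkBialgHom J) Ideal.Quotient.mk_surjective
  have h2 := card_character_dvd (H ⧸ J)
  rw [card_character_quotient hchar] at h2
  obtain ⟨m, hm⟩ := h2
  have hmd : m ∣ s := Nat.dvd_of_mul_dvd_mul_left hG.pos (by rwa [← hdim, ← hm])
  rcases (Nat.dvd_prime hsp).1 hmd with rfl | rfl
  · have := hK.lt_two_of_quotient hG hn hchar (by rw [hm, mul_one]) hle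
    have := hK.two_le hG hf
    omega
  · apply hJ
    have h3 := Submodule.finrank_quotient_add_finrank (J.restrictScalars ℂ)
    have h4 : Module.finrank ℂ (J.restrictScalars ℂ) = 0 := by
      have : Module.finrank ℂ (H ⧸ J.restrictScalars ℂ) = Module.finrank ℂ (H ⧸ J) := rfl
      omega
    rw [Submodule.finrank_eq_zero] at h4
    exact (Submodule.restrictScalars_eq_bot_iff ℂ H H).1 h4

theorem card_character_lt (hns : ¬ IsSemisimpleRing H) : Nat.card 𝓖 < Module.finrank ℂ H := by
  have := Fintype.ofFinite 𝓖
  have h := sum_sq_lt_of_injective hns (characterKer : 𝓖 → Ideal H) characterKer_injective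
    (fun _ => 1) isSimpleKernel_characterKer
  simpa [Nat.card_eq_fintype_card] using h

/-- In a non-semisimple Hopf algebra of dimension `p * q` every simple kernel is fixed by the
diagonal action of the characters. -/
theorem IsSimpleKernel.diag_smul_eq {p q : ℕ} (hp : p.Prime) (hq : q.Prime) (hpq : p < q)
    (hqp : q ≤ 2 * p + 1) (hdim : Module.finrank ℂ H = p * q) (hns : ¬ IsSemisimpleRing H)
    {K : Ideal H} {n : ℕ} (hK : IsSimpleKernel K n) (α : 𝓖) : (α, α) • K = K := by
  rcases eq_or_ne α 1 with rfl | hα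
  · exact one_smul _ K
  have hlt := card_character_lt hns
  have hdvd := card_character_dvd H
  rw [hdim] at hlt hdvd
  have hne : Nat.card 𝓖 ≠ 1 := fun h =>
    hα ((Nat.card_eq_one_iff_unique.1 h).1.elim α 1)
  obtain ⟨a, b, ha, hb, hab⟩ := (Nat.dvd_mul).1 hdvd
  rcases (Nat.dvd_prime hp).1 ha with rfl | rfl <;> rcases (Nat.dvd_prime hq).1 hb with rfl | rfl
  · omega
  · rw [one_mul] at hab
    exact hK.isDiagFixed (hab ▸ hq) hns hp (by rw [hdim, ← hab, mul_comm]) (by omega) α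
  · rw [mul_one] at hab
    exact hK.isDiagFixed (hab ▸ hp) hns hq (by rw [hdim, ← hab]) (by omega) α
  · omega

/-- A simple module is isomorphic to its twist by `S⁴` if its kernel is fixed by the diagonal
action of the characters. -/
theorem exists_linearEquiv_antipode_pow_four {V : Type} [AddCommGroup V] [Module ℂ V] [Module H V]
    [IsScalarTower ℂ H V] [IsSimpleModule H V] [FiniteDimensional ℂ V]
    (hfix : ∀ α : 𝓖, (α, α) • RingHom.ker (Algebra.lsmul ℂ ℂ V : H →ₐ[ℂ] Module.End ℂ V) =
      RingHom.ker (Algebra.lsmul ℂ ℂ V : H →ₐ[ℂ] Module.End ℂ V)) :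
    ∃ a : V ≃ₗ[ℂ] V, ∀ (x : H) (v : V),
      a (x • v) = (antipode ℂ ^ 4 : Module.End ℂ H) x • a v := by
  have : Nontrivial H := ⟨1, 0, fun h => by simpa using congrArg (counit (R := ℂ)) h⟩
  obtain ⟨α, u, hu⟩ := exists_radford ℂ H
  have htwist (x : H) : biTwist (α, α) x * u = u * (antipode ℂ ^ 4 : Module.End ℂ H) x := by
    rw [← leftTwist_antipode_pow_four α x, biTwist_apply, leftTwist_rightTwist, hu]
    rfl
  set ρ : H →ₐ[ℂ] Module.End ℂ V := Algebra.lsmul ℂ ℂ V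
  have hρ : Function.Surjective ρ := surjective_lsmul_of_isSimpleModule
  obtain ⟨T, hT⟩ := exists_linearEquiv_of_ker_eq hρ
    (ρ' := ρ.comp (biTwist (α, α) : H →ₐ[ℂ] H)) (hρ.comp (surjective_biTwist _)) (by
      ext x
      conv_lhs => rw [← hfix α⁻¹]
      rw [mem_character_smul, Prod.inv_mk, inv_inv]
      exact Iff.rfl)
  refine ⟨T.trans (DistribMulAction.toLinearEquiv ℂ V u⁻¹), fun x v => ?_⟩
  have h1 : T (x • v) = biTwist (α, α) x • T v := (hT x v).symm
  have h2 : (↑u⁻¹ : H) * biTwist (α, α) x = (antipode ℂ ^ 4 : Module.End ℂ H) x * ↑u⁻¹ := by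
    rw [Units.inv_mul_eq_iff_eq_mul, ← mul_assoc, ← htwist, Units.mul_inv_cancel_right]
  simp only [LinearEquiv.trans_apply, DistribMulAction.toLinearEquiv_apply, h1, Units.smul_def,
    smul_smul, h2]

end FourthPower

end

/-- For a non-semisimple Hopf algebra `H` over `ℂ` of dimension `p·q`, where
`p < q ≤ 2p + 1` are odd primes, every finite-dimensional simple `H`-module `V`
is isomorphic to its fourth dual `V****`: there is a `ℂ`-linear automorphism `a`
of `V` with `a (x • v) = S⁴(x) • a v`, i.e. `V` is isomorphic to its twist along
`S⁴`. -/
theorem simple_iso_fourth_dual (p q : ℕ) (hp : p.Prime) (hq : q.Prime)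
    (hpodd : Odd p) (hqodd : Odd q) (hpq : p < q) (hq2p : q ≤ 2 * p + 1)
    (H : Type) [Ring H] [HopfAlgebra ℂ H]
    (hdim : Module.finrank ℂ H = p * q)
    (hns : ¬ IsSemisimpleRing H)
    (V : Type) [AddCommGroup V] [Module ℂ V] [Module H V] [IsScalarTower ℂ H V]
    (hsimple : IsSimpleModule H V) (hfd : FiniteDimensional ℂ V) :
    ∃ a : V ≃ₗ[ℂ] V, ∀ (x : H) (v : V),
      a (x • v) =
        (((HopfAlgebra.antipode (R := ℂ) (A := H) : Module.End ℂ H) ^ 4) x) • a v := by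
  have : FiniteDimensional ℂ H :=
    Module.finite_of_finrank_pos (by rw [hdim]; exact Nat.mul_pos hp.pos hq.pos)
  have : Nontrivial V := IsSimpleModule.nontrivial H V
  exact exists_linearEquiv_antipode_pow_four fun α =>
    (IsSimpleKernel.of_surjective surjective_lsmul_of_isSimpleModule
      Module.finrank_pos).diag_smul_eq hp hq hpq hq2p hdim hns α
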